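/- Assume [H1] and [H2], and let ψ be the maximal L^p-solution of the nonlocal Fokker–Planck equation with maximal interval of existence (0, T_max). Then T_max = +∞, i.e. the solution is global in time. -/

import Mathlib

open MeasureTheory ENNReal Set Filter

noncomputable section

/-- Ambient space `ℝ × ℝ^m`: the universal cover of the torus `𝕋^{m+1}` (so `n = m + 1`). -/
abbrev Spc (m : ℕ) : Type := ℝ × (Fin m → ℝ)

/-- Unit cube in the last `m` coordinates: a fundamental domain for `𝕋^m`. -/
def cube1 (m : ℕ) : Set (Fin m → ℝ) := Set.pi Set.univ fun _ => Set.Ico (0 : ℝ) 1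

/-- A fundamental domain for the torus `𝕋^{m+1}`. -/
def cube (m : ℕ) : Set (Spc m) := Set.Ico (0 : ℝ) 1 ×ˢ cube1 m

/-- The measure of the torus: Lebesgue measure restricted to a fundamental domain. -/
def μT (m : ℕ) : Measure (Spc m) := volume.restrict (cube m)

/-- `ℤ^{m+1}`-periodicity: `f` is a function on the torus `𝕋^{m+1}`. -/
def IsPeriodic {m : ℕ} (f : Spc m → ℝ) : Prop :=
  ∀ (x : Spc m) (k : ℤ) (j : Fin m → ℤ), f (x.1 + k, fun i => x.2 i + j i) = f x

/-- The first coordinate direction. -/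
def e1 (m : ℕ) : Spc m := (1, 0)

/-- The remaining coordinate directions. -/
def eC (m : ℕ) (i : Fin m) : Spc m := (0, Pi.single i 1)

/-- Partial derivative in the direction `v`. -/
def pd {m : ℕ} (v : Spc m) (f : Spc m → ℝ) (x : Spc m) : ℝ := fderiv ℝ f x v

/-- `∇f ⋅ ∇g`. -/
def gradDot {m : ℕ} (f g : Spc m → ℝ) (x : Spc m) : ℝ :=
  pd (e1 m) f x * pd (e1 m) g x + ∑ i, pd (eC m i) f x * pd (eC m i) g x

/-- The Laplacian. -/
def lap {m : ℕ} (f : Spc m → ℝ) (x : Spc m) : ℝ :=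
  pd (e1 m) (pd (e1 m) f) x + ∑ i, pd (eC m i) (pd (eC m i) f) x

/-- The marginal `ψ̄(x₁) = ∫_{𝕋^m} ψ(x₁, ⋅)`. -/
def marg {m : ℕ} (ψ : Spc m → ℝ) (x1 : ℝ) : ℝ := ∫ y in cube1 m, ψ (x1, y)

/-- The nonlocal coefficient `φ_ψ = (∫ ∂_{x₁}V ψ dx₂…dxₙ) / ψ̄`. -/
def phiF {m : ℕ} (V ψ : Spc m → ℝ) (x1 : ℝ) : ℝ :=
  (∫ y in cube1 m, pd (e1 m) V (x1, y) * ψ (x1, y)) / marg ψ x1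

/-- `F(ψ) = ∇V⋅∇ψ + ΔV ψ − ∂_{x₁}(φ_ψ ψ)`. -/
def Fop {m : ℕ} (V ψ : Spc m → ℝ) (x : Spc m) : ℝ :=
  gradDot V ψ x + lap V x * ψ x - pd (e1 m) (fun z => phiF V ψ z.1 * ψ z) x

/-- `L^p`-norm on the torus. -/
def LpN {m : ℕ} (p : ℝ) (f : Spc m → ℝ) : ℝ≥0∞ := eLpNorm f (ENNReal.ofReal p) (μT m)

/-- Gagliardo (Sobolev–Slobodeckij) seminorm of fractional order `s`. -/
def gagl {m : ℕ} {F : Type*} [NormedAddCommGroup F] (s p : ℝ) (f : Spc m → F) : ℝ≥0∞ :=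
  (∫⁻ x in cube m, ∫⁻ y in cube m,
      ENNReal.ofReal (‖f x - f y‖ ^ p / ‖x - y‖ ^ ((m : ℝ) + 1 + s * p))) ^ (1 / p)

/-- The differential of `f`. -/
def grd {m : ℕ} (f : Spc m → ℝ) (x : Spc m) : Spc m →L[ℝ] ℝ := fderiv ℝ f x

/-- The `W^{σ,p}`-norm on the torus, for `0 ≤ σ ≤ 2`. -/
def WNorm {m : ℕ} (σ p : ℝ) (f : Spc m → ℝ) : ℝ≥0∞ :=
  if σ ≤ 0 then LpN p f
  else if σ < 1 then LpN p f + gagl σ p f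
  else if σ < 2 then
    LpN p f + eLpNorm (fun x => ‖grd f x‖) (ENNReal.ofReal p) (μT m)
      + (if σ = 1 then 0 else gagl (σ - 1) p (grd f))
  else
    LpN p f + eLpNorm (fun x => ‖grd f x‖) (ENNReal.ofReal p) (μT m)
      + eLpNorm (fun x => ‖iteratedFDeriv ℝ 2 f x‖) (ENNReal.ofReal p) (μT m)

/-- Membership in `W^{σ,p}(𝕋^{m+1})`, for `0 ≤ σ ≤ 2`. -/
def MemW {m : ℕ} (σ p : ℝ) (f : Spc m → ℝ) : Prop :=
  IsPeriodic f ∧ Measurable f ∧ (1 ≤ σ → Differentiable ℝ f) ∧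
    (2 ≤ σ → Differentiable ℝ (grd f)) ∧ WNorm σ p f < ⊤

/-- Membership in `𝒟^{σ,p}(𝕋^{m+1}) = {ψ ∈ W^{σ,p} | ψ̄ > 0}`. -/
def MemD {m : ℕ} (σ p : ℝ) (f : Spc m → ℝ) : Prop :=
  MemW σ p f ∧ ∀ x1 : ℝ, 0 < marg f x1

/-- Hypothesis `[H₁]`: `ψ₀ ∈ 𝒟^{σ,p}`, `ψ₀ ≥ 0`, `∫ ψ₀ = 1`. -/
def Hyp1 {m : ℕ} (σ p : ℝ) (ψ0 : Spc m → ℝ) : Prop :=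
  MemD σ p ψ0 ∧ (∀ x, 0 ≤ ψ0 x) ∧ (∫ x in cube m, ψ0 x) = 1

/-- Hypothesis `[H₂]`: `n = m + 1 ≥ 2`, `p > n`, `σ ∈ (1 + n/p, 2)`. -/
def Hyp2 (m : ℕ) (σ p : ℝ) : Prop :=
  1 ≤ m ∧ (m : ℝ) + 1 < p ∧ 1 + ((m : ℝ) + 1) / p < σ ∧ σ < 2

/-- The real interval `[0, Tmax)`, where `Tmax ∈ (0, ∞]`. -/
def Ico0 (Tmax : ℝ≥0∞) : Set ℝ := {t : ℝ | 0 ≤ t ∧ ENNReal.ofReal t < Tmax}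

/-- The real interval `(0, Tmax)`, where `Tmax ∈ (0, ∞]`. -/
def Ioo0 (Tmax : ℝ≥0∞) : Set ℝ := {t : ℝ | 0 < t ∧ ENNReal.ofReal t < Tmax}

/-- Continuity in `W^{σ,p}`-norm of a curve, on a time set `s`. -/
def ContW {m : ℕ} (σ p : ℝ) (s : Set ℝ) (ψ : ℝ → Spc m → ℝ) : Prop :=
  ∀ t ∈ s, ∀ ε : ℝ, 0 < ε → ∃ δ > 0, ∀ t' ∈ s, |t' - t| < δ →
    WNorm σ p (fun x => ψ t' x - ψ t x) < ENNReal.ofReal ε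

/-- Hölder continuity (exponent `α`) in `W^{σ,p}`-norm of a curve, on a time set `s`. -/
def HolderW {m : ℕ} (α σ p : ℝ) (s : Set ℝ) (ψ : ℝ → Spc m → ℝ) : Prop :=
  ∃ C : ℝ, ∀ t ∈ s, ∀ t' ∈ s,
    WNorm σ p (fun x => ψ t' x - ψ t x) ≤ ENNReal.ofReal (C * |t' - t| ^ α)

/-- `ψ` is an `L^p`-solution on `[0, Tmax)` of the nonlocal Fokker–Planck equation
`∂ₜψ = div(∇V ψ + β⁻¹∇ψ) − ∂_{x₁}(φ_ψ ψ) = β⁻¹Δψ + F(ψ)`, `ψ(0) = ψ₀`. -/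
structure IsLpSolution {m : ℕ} (V : Spc m → ℝ) (β σ p : ℝ) (ψ0 : Spc m → ℝ)
    (Tmax : ℝ≥0∞) (ψ : ℝ → Spc m → ℝ) : Prop where
  init : ∀ x, ψ 0 x = ψ0 x
  contLp : ContW 0 p (Ico0 Tmax) ψ
  regW2 : ∀ t ∈ Ioo0 Tmax, MemW 2 p (ψ t)
  regD : ∀ t ∈ Ioo0 Tmax, MemD σ p (ψ t)
  eqn : ∀ t ∈ Ioo0 Tmax,
    Tendsto (fun h : ℝ => LpN p
        (fun x => (ψ (t + h) x - ψ t x) / h - (β⁻¹ * lap (ψ t) x + Fop V (ψ t) x)))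
      (nhdsWithin 0 {h : ℝ | h ≠ 0}) (nhds 0)
  derivCont : ContW 0 p (Ioo0 Tmax)
    (fun t x => β⁻¹ * lap (ψ t) x + Fop V (ψ t) x)

/-- A maximal `L^p`-solution: an `L^p`-solution admitting no proper extension. -/
def IsMaximalLpSolution {m : ℕ} (V : Spc m → ℝ) (β σ p : ℝ) (ψ0 : Spc m → ℝ)
    (Tmax : ℝ≥0∞) (ψ : ℝ → Spc m → ℝ) : Prop :=
  IsLpSolution V β σ p ψ0 Tmax ψ ∧ 0 < Tmax ∧
    ∀ (Tmax' : ℝ≥0∞) (ψ' : ℝ → Spc m → ℝ), IsLpSolution V β σ p ψ0 Tmax' ψ' →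
      (∀ t ∈ Ico0 Tmax, ψ' t = ψ t) → Tmax' ≤ Tmax

/-- The Euclidean quadratic form on `Spc m`. -/
def qd {m : ℕ} (z : Spc m) : ℝ := z.1 ^ 2 + ∑ i, z.2 i ^ 2

/-- The heat semigroup `e^{β⁻¹ t Δ}` on the torus, realized by convolution with the Gaussian
heat kernel on the universal cover (and the identity for `t ≤ 0`). -/
def heatSG {m : ℕ} (β t : ℝ) (f : Spc m → ℝ) (x : Spc m) : ℝ :=
  if t ≤ 0 then f x
  else ∫ y : Spc m, (4 * Real.pi * (t / β)) ^ (-((m : ℝ) + 1) / 2) *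
      Real.exp (-qd (x - y) / (4 * (t / β))) * f y

/-- `ψ` is a mild solution of the nonlocal Fokker–Planck equation on `[0, Tmax)`:
`ψ ∈ C([0,Tmax), 𝒟^{σ,p})` and `ψ(t) = e^{β⁻¹tΔ}ψ₀ + ∫₀ᵗ e^{β⁻¹(t−s)Δ} F(ψ(s)) ds`. -/
def IsMildSolution {m : ℕ} (V : Spc m → ℝ) (β σ p : ℝ) (ψ0 : Spc m → ℝ)
    (Tmax : ℝ≥0∞) (ψ : ℝ → Spc m → ℝ) : Prop :=
  (∀ x, ψ 0 x = ψ0 x) ∧ (∀ t ∈ Ico0 Tmax, MemD σ p (ψ t)) ∧ ContW σ p (Ico0 Tmax) ψ ∧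
    ∀ t ∈ Ico0 Tmax, ∀ᵐ x ∂(volume : Measure (Spc m)),
      ψ t x = heatSG β t ψ0 x + ∫ s in Set.Ioc (0 : ℝ) t, heatSG β (t - s) (Fop V (ψ s)) x

/-- A maximal mild solution. -/
def IsMaximalMildSolution {m : ℕ} (V : Spc m → ℝ) (β σ p : ℝ) (ψ0 : Spc m → ℝ)
    (Tmax : ℝ≥0∞) (ψ : ℝ → Spc m → ℝ) : Prop :=
  IsMildSolution V β σ p ψ0 Tmax ψ ∧ 0 < Tmax ∧
    ∀ (Tmax' : ℝ≥0∞) (ψ' : ℝ → Spc m → ℝ), IsMildSolution V β σ p ψ0 Tmax' ψ' →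
      (∀ t ∈ Ico0 Tmax, ψ' t = ψ t) → Tmax' ≤ Tmax

/-- `L^p`-norm on the one-dimensional torus `𝕋`. -/
def LpN1 (p : ℝ) (g : ℝ → ℝ) : ℝ≥0∞ :=
  eLpNorm g (ENNReal.ofReal p) (volume.restrict (Set.Ico (0 : ℝ) 1))

/-- Membership in `L^p₀(𝕋^{m+1})`: periodic, `L^p` and of mean zero. -/
def MemL0 {m : ℕ} (p : ℝ) (f : Spc m → ℝ) : Prop :=
  IsPeriodic f ∧ Measurable f ∧ LpN p f < ⊤ ∧ (∫ x in cube m, f x) = 0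

noncomputable section
namespace FP
open scoped Topology BoundedContinuousFunction
variable {m : ℕ}
def ip (m : ℕ) : Spc m →L[ℝ] Spc m →L[ℝ] ℝ :=
  (ContinuousLinearMap.fst ℝ ℝ (Fin m → ℝ)).smulRight (ContinuousLinearMap.fst ℝ ℝ (Fin m → ℝ)) +
  ∑ i : Fin m, ((ContinuousLinearMap.proj (R := ℝ) (φ := fun _ : Fin m => ℝ) i).comp
      (ContinuousLinearMap.snd ℝ ℝ (Fin m → ℝ))).smulRight
    ((ContinuousLinearMap.proj (R := ℝ) (φ := fun _ : Fin m => ℝ) i).comp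
      (ContinuousLinearMap.snd ℝ ℝ (Fin m → ℝ)))
lemma ip_apply (z v : Spc m) : ip m z v = z.1 * v.1 + ∑ i, z.2 i * v.2 i := by
  simp [ip]
lemma qd_eq (z : Spc m) : qd z = ip m z z := by
  simp [qd, ip_apply, sq]
lemma ip_comm (z v : Spc m) : ip m z v = ip m v z := by
  simp [ip_apply, mul_comm]
lemma qd_nonneg (z : Spc m) : 0 ≤ qd z := by
  unfold qd; positivity
lemma norm_sq_le_qd (z : Spc m) : ‖z‖ ^ 2 ≤ qd z := by
  have h : ‖z‖ ≤ Real.sqrt (qd z) := by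
    rw [Prod.norm_def]
    refine max_le ?_ ((pi_norm_le_iff_of_nonneg (Real.sqrt_nonneg _)).2 fun i => ?_)
    · rw [Real.norm_eq_abs]
      refine Real.abs_le_sqrt ?_
      have : 0 ≤ ∑ i, z.2 i ^ 2 := by positivity
      unfold qd; linarith
    · rw [Real.norm_eq_abs]
      refine Real.abs_le_sqrt ?_
      have := Finset.single_le_sum (f := fun i => z.2 i ^ 2) (fun i _ => sq_nonneg _)
        (Finset.mem_univ i)
      have h1 := sq_nonneg z.1
      unfold qd; linarith
  calc ‖z‖ ^ 2 ≤ Real.sqrt (qd z) ^ 2 := by gcongr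
    _ = qd z := Real.sq_sqrt (qd_nonneg z)
lemma qd_le (z : Spc m) : qd z ≤ ‖ip m‖ * ‖z‖ ^ 2 := by
  rw [qd_eq]
  calc ip m z z ≤ ‖ip m z z‖ := le_abs_self _
    _ ≤ ‖ip m‖ * ‖z‖ * ‖z‖ := (ip m).le_opNorm₂ z z
    _ = _ := by ring
lemma qd_sub (z a : Spc m) : qd z / 2 - qd a ≤ qd (z - a) := by
  have h : 0 ≤ qd (z - (2:ℝ) • a) := qd_nonneg _
  rw [qd_eq] at *
  simp only [qd_eq, map_sub, map_smul, _root_.sub_apply, smul_eq_mul,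
    _root_.smul_apply] at *
  rw [ip_comm a z] at *
  linarith
lemma integrable_exp_qd (c : ℝ) (hc : 0 < c) :
    Integrable (fun z : Spc m => Real.exp (-c * qd z)) volume := by
  have h1 : Integrable (fun x : ℝ => Real.exp (-c * x ^ 2)) volume := integrable_exp_neg_mul_sq hc
  have h2 : Integrable (fun y : Fin m → ℝ => ∏ i, Real.exp (-c * (y i) ^ 2)) volume :=
    Integrable.fintype_prod (f := fun _ x => Real.exp (-c * x ^ 2)) fun _ => h1
  have h3 := h1.mul_prod h2
  refine h3.congr (ae_of_all _ fun z => ?_)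
  simp only [qd, ← Real.exp_sum, ← Real.exp_add, mul_add, Finset.mul_sum]
def rho (z : Spc m) : ℝ := Real.exp (-(1/2) * qd z)
lemma rho_pos (z : Spc m) : 0 < rho z := Real.exp_pos _
lemma integrable_rho : Integrable (rho (m := m)) volume := integrable_exp_qd _ (by norm_num)
def Z0 (m : ℕ) : ℝ := ∫ z : Spc m, rho z
lemma Z0_pos : 0 < Z0 m := by
  refine (integral_pos_iff_support_of_nonneg (fun z => (rho_pos z).le) integrable_rho).2 ?_
  have : Function.support (rho (m := m)) = univ := by
    ext z; simp [(rho_pos z).ne']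
  rw [this]
  exact Measure.measure_univ_pos.2 (NeZero.ne _)
def ga (m : ℕ) : Measure (Spc m) := volume.withDensity fun z => ENNReal.ofReal (rho z / Z0 m)
lemma continuous_qd : Continuous (qd (m := m)) := by
  unfold qd; fun_prop
lemma continuous_rho : Continuous (rho (m := m)) := by
  unfold rho; have := continuous_qd (m := m); fun_prop
lemma measurable_dens : Measurable fun z : Spc m => ENNReal.ofReal (rho z / Z0 m) :=
  (continuous_rho.div_const _).measurable.ennreal_ofReal
instance : IsProbabilityMeasure (ga m) := by
  refine ⟨?_⟩
  rw [ga, withDensity_apply _ MeasurableSet.univ, setLIntegral_univ,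
    ← ofReal_integral_eq_lintegral_ofReal (integrable_rho.div_const _)
      (ae_of_all _ fun z => (div_pos (rho_pos z) Z0_pos).le), integral_div, ← Z0,
      div_self Z0_pos.ne', ENNReal.ofReal_one]
set_option linter.unusedSectionVars false
variable {F : Type} [NormedAddCommGroup F] [NormedSpace ℝ F]
lemma integral_ga (f : Spc m → F) : ∫ z, f z ∂(ga m) = ∫ z, (rho z / Z0 m) • f z := by
  rw [ga, integral_withDensity_eq_integral_toReal_smul measurable_dens
    (ae_of_all _ fun z => ENNReal.ofReal_lt_top)]
  congr 1; ext z
  rw [ENNReal.toReal_ofReal (div_pos (rho_pos z) Z0_pos).le]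
lemma integrable_ga_iff (f : Spc m → F) :
    Integrable f (ga m) ↔ Integrable (fun z => (rho z / Z0 m) • f z) volume := by
  rw [ga, integrable_withDensity_iff_integrable_smul' measurable_dens
    (ae_of_all _ fun z => ENNReal.ofReal_lt_top)]
  simp only [ENNReal.toReal_ofReal (div_pos (rho_pos _) Z0_pos).le]
lemma pow_mul_rho_le (z : Spc m) : (1 + ‖z‖ ^ 2) * rho z ≤ 5 * Real.exp (-(1/4) * qd z) := by
  have h := norm_sq_le_qd z
  have h1 : 1 + ‖z‖ ^ 2 ≤ 5 * Real.exp (1/4 * qd z) := by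
    have := Real.add_one_le_exp (1/4 * qd z)
    nlinarith [qd_nonneg z]
  have : rho z = Real.exp (-(1/4) * qd z) * Real.exp (-(1/4) * qd z) := by
    rw [rho, ← Real.exp_add]; ring_nf
  calc (1 + ‖z‖ ^ 2) * rho z ≤ 5 * Real.exp (1/4 * qd z) * rho z := by
        gcongr; exact (rho_pos z).le
    _ = 5 * Real.exp (-(1/4) * qd z) * (Real.exp (1/4 * qd z) * Real.exp (-(1/4) * qd z)) := by
        rw [this]; ring
    _ = _ := by rw [← Real.exp_add]; ring_nf; simp
lemma integrable_sq : Integrable (fun z : Spc m => 1 + ‖z‖ ^ 2) (ga m) := by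
  rw [integrable_ga_iff]
  have := ((integrable_exp_qd (m := m) (1/4) (by norm_num)).const_mul 5).div_const (Z0 m)
  refine this.mono' (by have := continuous_rho (m := m); fun_prop) (ae_of_all _ fun z => ?_)
  have h := pow_mul_rho_le z
  have h0 := rho_pos z
  have hZ := Z0_pos (m := m)
  rw [Real.norm_of_nonneg (by positivity), smul_eq_mul]
  calc rho z / Z0 m * (1 + ‖z‖ ^ 2) = ((1 + ‖z‖ ^ 2) * rho z) / Z0 m := by ring
    _ ≤ _ := by gcongr
lemma integrable_of_le {f : Spc m → F} (hf : AEStronglyMeasurable f (ga m)) (C : ℝ)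
    (h : ∀ z, ‖f z‖ ≤ C * (1 + ‖z‖ ^ 2)) : Integrable f (ga m) :=
  (integrable_sq.const_mul C).mono' hf (ae_of_all _ h)
lemma hasFDerivAt_rho (z : Spc m) : HasFDerivAt rho (-(rho z) • ip m z) z := by
  have h1 : HasFDerivAt (fun z : Spc m => ip m z z) ((2:ℝ) • ip m z) z := by
    have := (ip m).hasFDerivAt.clm_apply (x := z) (hasFDerivAt_id z)
    refine this.congr_fderiv ?_
    ext v <;> simp [two_mul, ip_comm]
  have h2 := (h1.const_mul (-(1/2))).exp
  have : (rho (m := m)) = fun z => Real.exp (-(1/2) * ip m z z) := by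
    ext z; rw [rho, qd_eq]
  rw [this]
  refine h2.congr_fderiv ?_
  ext v <;> simp
lemma rho_rot (a b : ℝ) (hb : b ≠ 0) (hab : a ^ 2 + b ^ 2 = 1) (z y : Spc m) :
    rho z * rho (b⁻¹ • (y - a • z)) = rho y * rho (b⁻¹ • (z - a • y)) := by
  simp only [rho, ← Real.exp_add, qd_eq, map_sub, map_smul, _root_.sub_apply,
    smul_eq_mul, _root_.smul_apply, ip_comm y z]
  congr 1
  have : b ^ 2 = 1 - a ^ 2 := by linarith
  field_simp
  simp only [this]
  ring
instance : (volume : Measure (Spc m)).IsAddHaarMeasure := by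
  rw [Measure.volume_eq_prod]; infer_instance
lemma ga_rot [CompleteSpace F] (f : Spc m →ᵇ F) (a b : ℝ) (hb : 0 < b) (hab : a ^ 2 + b ^ 2 = 1) :
    ∫ z, ∫ w, f (a • z + b • w) ∂(ga m) ∂(ga m) = ∫ z, f z ∂(ga m) := by
  have hZ := Z0_pos (m := m)
  set n := Module.finrank ℝ (Spc m)
  have hbn : 0 < b ^ n := pow_pos hb n
  have key : ∀ z : Spc m, ∀ g : Spc m → F,
      ∫ w, g (a • z + b • w) = (b ^ n)⁻¹ • ∫ y, g y := by
    intro z g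
    rw [Measure.integral_comp_smul_of_nonneg volume (fun w => g (a • z + w)) b (hR := hb.le),
      integral_add_left_eq_self]
  have key2 : ∀ y : Spc m, Integrable (fun z => rho (b⁻¹ • (z - a • y))) volume := fun y =>
    (integrable_rho.comp_smul (inv_ne_zero hb.ne')).comp_sub_right (a • y)
  have key3 : ∀ y : Spc m, ∫ z, rho (b⁻¹ • (z - a • y)) = b ^ n * Z0 m := by
    intro y
    rw [integral_sub_right_eq_self (fun z => rho (b⁻¹ • z)) (a • y),
      Measure.integral_comp_smul_of_nonneg volume _ _ (hR := (inv_pos.2 hb).le)]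
    simp [Z0, n]
  have cr := continuous_rho (m := m)
  have e1 : ∀ z, ∫ w, f (a • z + b • w) ∂(ga m)
      = (b ^ n)⁻¹ • ∫ y, (rho (b⁻¹ • (y - a • z)) / Z0 m) • f y := by
    intro z
    rw [integral_ga, ← key z]
    congr 1; ext w
    simp [smul_smul, hb.ne']
  have hint : Integrable (fun q : Spc m × Spc m =>
      (rho q.2 * rho (b⁻¹ • (q.1 - a • q.2)) / Z0 m ^ 2) • f q.2) (volume.prod volume) := by
    rw [integrable_prod_iff' (by
      apply Continuous.aestronglyMeasurable; fun_prop)]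
    refine ⟨ae_of_all _ fun y => ?_, ?_⟩
    · exact (((key2 y).const_mul (rho y)).div_const (Z0 m ^ 2)).smul_const (f y)
    · have : ∀ y, ∫ z, ‖(rho y * rho (b⁻¹ • (z - a • y)) / Z0 m ^ 2) • f y‖
          = rho y * (b ^ n / Z0 m * ‖f y‖) := by
        intro y
        have : ∀ z, ‖(rho y * rho (b⁻¹ • (z - a • y)) / Z0 m ^ 2) • f y‖
           = rho (b⁻¹ • (z - a • y)) * (rho y / Z0 m ^ 2 * ‖f y‖) := by
          intro z
          have h1 := rho_pos y
          have h2 := rho_pos (b⁻¹ • (z - a • y))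
          rw [norm_smul, Real.norm_of_nonneg (by positivity)]; ring
        simp only [this]
        rw [integral_mul_const, key3]
        field_simp
      simp only [this]
      refine integrable_rho.mul_bdd (c := b ^ n / Z0 m * ‖f‖) (by fun_prop)
        (ae_of_all _ fun y => ?_)
      rw [Real.norm_of_nonneg (by positivity)]
      gcongr; exact f.norm_coe_le_norm y
  simp only [e1]
  rw [integral_ga]
  calc ∫ z, (rho z / Z0 m) • (b ^ n)⁻¹ • ∫ y, (rho (b⁻¹ • (y - a • z)) / Z0 m) • f y
      = (b ^ n)⁻¹ • ∫ z, ∫ y, (rho y * rho (b⁻¹ • (z - a • y)) / Z0 m ^ 2) • f y := by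
        rw [← integral_smul]
        congr 1; ext z
        rw [smul_comm, ← integral_smul]
        congr 2; ext y
        rw [← rho_rot a b hb.ne' hab, smul_smul]; congr 1; ring
    _ = (b ^ n)⁻¹ • ∫ y, ∫ z, (rho y * rho (b⁻¹ • (z - a • y)) / Z0 m ^ 2) • f y := by
        rw [integral_integral_swap hint]
    _ = (b ^ n)⁻¹ • ∫ y, b ^ n • (rho y / Z0 m) • f y := by
        congr 2; ext y
        rw [integral_smul_const, smul_smul, integral_div, integral_const_mul, key3]
        congr 1; field_simp
    _ = _ := by
        rw [integral_smul, smul_smul, inv_mul_cancel₀ hbn.ne', one_smul, integral_ga]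
def refl (i : Fin m) (z : Spc m) : Spc m := (z.1, Function.update z.2 i (-z.2 i))
lemma ga_refl (i : Fin m) (f : Spc m → F) : ∫ z, f (refl i z) ∂(ga m) = ∫ z, f z ∂(ga m) := by
  have hmp : MeasurePreserving (refl (m := m) i) volume volume := by
    have h2 : MeasurePreserving (fun y : Fin m → ℝ => Function.update y i (-y i)) volume volume := by
      have := volume_preserving_pi (f := fun j : Fin m => fun t : ℝ => if j = i then -t else t)
        (fun j => by
          by_cases h : j = i
          · simpa [h] using Measure.measurePreserving_neg (volume : Measure ℝ)
          · simp only [h, if_false]; exact MeasurePreserving.id (volume : Measure ℝ))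
      have e : (fun y : Fin m → ℝ => Function.update y i (-y i)) =
          fun y j => if j = i then -y j else y j := by
        ext y j
        by_cases h : j = i
        · subst h; simp
        · simp [h]
      rw [e]; exact this
    exact (MeasurePreserving.id (volume : Measure ℝ)).prod h2
  have hinv : Function.Involutive (refl (m := m) i) := fun z => by simp [refl]
  have hq : ∀ z : Spc m, rho (refl i z) = rho z := by
    intro z
    have : qd (refl i z) = qd z := by
      unfold qd refl; congr 1
      refine Finset.sum_congr rfl fun j _ => ?_
      by_cases h : j = i
      · subst h; simp
      · simp [h]
    rw [rho, this, rho]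
  have he : MeasurableEmbedding (refl (m := m) i) :=
    (MeasurableEquiv.mk hinv.toPerm hmp.measurable hmp.measurable).measurableEmbedding
  rw [integral_ga, integral_ga, ← hmp.integral_comp he (fun z => (rho z / Z0 m) • f z)]
  simp only [hq]
end FP
end
noncomputable section
namespace FP
open scoped Topology BoundedContinuousFunction
set_option linter.unusedSectionVars false
set_option maxSynthPendingDepth 3
class GS (E : Type) [NormedAddCommGroup E] [NormedSpace ℝ E] [MeasurableSpace E] where
  γ : Measure E
  B : E →L[ℝ] E →L[ℝ] ℝ
  ι : Type
  fin : Fintype ι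
  e0 : E
  e : ι → E
  prob : IsProbabilityMeasure γ
  int_sq : Integrable (fun z => 1 + ‖z‖ ^ 2) γ
  rot : ∀ {F : Type} [NormedAddCommGroup F] [NormedSpace ℝ F] [CompleteSpace F] (f : E →ᵇ F)
    (a b : ℝ), 0 < b → a ^ 2 + b ^ 2 = 1 → ∫ z, ∫ w, f (a • z + b • w) ∂γ ∂γ = ∫ z, f z ∂γ
  der : ∀ {F : Type} [NormedAddCommGroup F] [NormedSpace ℝ F] [CompleteSpace F] (f : E →ᵇ F)
    (s : ℝ), 0 < s → ∀ x0, HasFDerivAt (fun x => ∫ z, f (x + s • z) ∂γ)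
      (s⁻¹ • ∫ z, (B z).smulRight (f (x0 + s • z)) ∂γ) x0
  refl : ∀ {F : Type} [NormedAddCommGroup F] [NormedSpace ℝ F] (i : ι) (f : E → F),
    ∫ z, f (z - (2 * B z (e i)) • e i) ∂γ = ∫ z, f z ∂γ
  Be : ∀ i, B (e i) (e i) = 1
  frame : ∀ z, z = B z e0 • e0 + ∑ i, B z (e i) • e i
attribute [instance] GS.fin GS.prob
section inst
variable {m : ℕ} {F : Type} [NormedAddCommGroup F] [NormedSpace ℝ F] [CompleteSpace F]
lemma ga_der (f : Spc m →ᵇ F) (s : ℝ) (hs : 0 < s) (x0 : Spc m) :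
    HasFDerivAt (fun x => ∫ z, f (x + s • z) ∂(ga m))
      (s⁻¹ • ∫ z, (ip m z).smulRight (f (x0 + s • z)) ∂(ga m)) x0 := by
  have hZ := Z0_pos (m := m)
  have cr := continuous_rho (m := m)
  set w : Spc m → Spc m → Spc m := fun x z => z - s⁻¹ • (x - x0) with hw
  have e1 : (fun x => ∫ z, f (x + s • z) ∂(ga m)) = fun x => ∫ z, (rho (w x z) / Z0 m) • f (x0 + s • z) := by
    ext x
    rw [integral_ga, ← integral_sub_right_eq_self _ (s⁻¹ • (x - x0))]
    congr 1; ext z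
    congr 2
    rw [smul_sub, smul_smul, mul_inv_cancel₀ hs.ne', one_smul]; abel
  set F' : Spc m → Spc m → (Spc m →L[ℝ] F) := fun x z =>
    ((s⁻¹ * rho (w x z) / Z0 m) • ip m (w x z)).smulRight (f (x0 + s • z)) with hF'
  have e2 : s⁻¹ • ∫ z, (ip m z).smulRight (f (x0 + s • z)) ∂(ga m) = ∫ z, F' x0 z := by
    rw [integral_ga, ← integral_smul]
    congr 1; ext1 z
    refine ContinuousLinearMap.ext fun v => ?_
    simp [hF', hw, smul_smul]
    congr 1; ring
  rw [e1, e2]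
  set Q := ‖ip m‖ with hQ
  have hwc : Continuous fun q : Spc m × Spc m => w q.1 q.2 := by fun_prop
  refine hasFDerivAt_integral_of_dominated_of_fderiv_le (s := Metric.ball x0 s)
    (F' := F') (bound := fun z => (s⁻¹ / Z0 m * Q * ‖f‖ * 5 * Real.exp (Q / 4)) *
      Real.exp (-(1/8) * qd z)) (Metric.ball_mem_nhds x0 hs) ?_ ?_ ?_ ?_ ?_ ?_
  · refine Eventually.of_forall fun x => ?_
    have : Continuous (w x) := by fun_prop
    apply Continuous.aestronglyMeasurable; fun_prop
  · have := (integrable_ga_iff _).1 (integrable_of_le (f := fun z => f (x0 + s • z)) (C := ‖f‖)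
      (by apply Continuous.aestronglyMeasurable; fun_prop) fun z => by
        nlinarith [f.norm_coe_le_norm (x0 + s • z), sq_nonneg ‖z‖, norm_nonneg f])
    refine this.congr (ae_of_all _ fun z => ?_)
    simp [hw]
  · have : Continuous (w x0) := by fun_prop
    have h3 : Continuous fun z => (s⁻¹ * rho (w x0 z) / Z0 m) • ip m (w x0 z) := by fun_prop
    have h2 : Continuous (F' x0) :=
      ((ContinuousLinearMap.smulRightL ℝ (Spc m) F).continuous.comp h3).clm_apply
        (by fun_prop : Continuous fun z => f (x0 + s • z))
    exact h2.aestronglyMeasurable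
  · refine ae_of_all _ fun z x hx => ?_
    have ha : qd (s⁻¹ • (x - x0)) ≤ Q := by
      refine (qd_le _).trans ?_
      have : ‖s⁻¹ • (x - x0)‖ ≤ 1 := by
        rw [norm_smul, Real.norm_of_nonneg (by positivity), ← dist_eq_norm]
        rw [inv_mul_le_iff₀ hs, mul_one]; exact (Metric.mem_ball.1 hx).le
      have h2 : ‖s⁻¹ • (x - x0)‖ ^ 2 ≤ 1 := pow_le_one₀ (norm_nonneg _) this
      nlinarith [norm_nonneg (ip m)]
    have hr := rho_pos (w x z)
    have h1 : ‖w x z‖ * rho (w x z) ≤ 5 * (Real.exp (Q / 4) * Real.exp (-(1/8) * qd z)) := by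
      calc _ ≤ (1 + ‖w x z‖ ^ 2) * rho (w x z) := by
            gcongr; nlinarith [sq_nonneg (‖w x z‖ - 1)]
        _ ≤ 5 * Real.exp (-(1/4) * qd (w x z)) := pow_mul_rho_le _
        _ ≤ _ := by
            rw [← Real.exp_add]; gcongr
            have := qd_sub z (s⁻¹ • (x - x0))
            simp only [hw]; linarith
    simp only [hF']
    rw [ContinuousLinearMap.norm_smulRight_apply, norm_smul, Real.norm_of_nonneg (by positivity)]
    calc s⁻¹ * rho (w x z) / Z0 m * ‖ip m (w x z)‖ * ‖f (x0 + s • z)‖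
        ≤ s⁻¹ * rho (w x z) / Z0 m * (Q * ‖w x z‖) * ‖f‖ := by
          gcongr
          · exact (ip m).le_opNorm _
          · exact f.norm_coe_le_norm _
      _ = s⁻¹ / Z0 m * Q * ‖f‖ * (‖w x z‖ * rho (w x z)) := by ring
      _ ≤ s⁻¹ / Z0 m * Q * ‖f‖ * (5 * (Real.exp (Q / 4) * Real.exp (-(1/8) * qd z))) := by
          gcongr
      _ = _ := by ring
  · exact (integrable_exp_qd _ (by norm_num)).const_mul _
  · refine ae_of_all _ fun z x hx => ?_
    have h1 : HasFDerivAt (fun x => w x z) (-(s⁻¹ • ContinuousLinearMap.id ℝ (Spc m))) x :=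
      (((hasFDerivAt_id x).sub_const x0).const_smul s⁻¹).const_sub z
    have h2 : HasFDerivAt (fun x => rho (w x z)) _ x :=
      HasFDerivAt.comp (g := rho) x (hasFDerivAt_rho (w x z)) h1
    have h3 := (h2.mul_const (Z0 m)⁻¹).smul_const (f (x0 + s • z))
    simp only [div_eq_mul_inv]
    refine h3.congr_fderiv (ContinuousLinearMap.ext fun v => ?_)
    simp [hF', smul_smul]
    congr 1; ring
instance : GS (Spc m) where
  γ := ga m
  B := ip m
  ι := Fin m
  fin := inferInstance
  e0 := e1 m
  e := eC m
  prob := inferInstance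
  int_sq := integrable_sq
  rot := ga_rot
  der := ga_der
  refl := fun i f => by
    rw [← ga_refl i f]
    congr 1; ext1 z; congr 1
    refine Prod.ext ?_ ?_
    · simp [refl, eC]
    · ext j
      by_cases h : j = i
      · subst h; simp [refl, eC, ip_apply, Pi.single_apply]; ring
      · simp [refl, eC, ip_apply, Pi.single_apply, h]
  Be := fun i => by simp [eC, ip_apply, Pi.single_apply]
  frame := fun z => by
    refine Prod.ext ?_ ?_
    · simp [e1, eC, ip_apply, Prod.fst_sum]
    · ext j
      simp [e1, eC, ip_apply, Prod.snd_sum, Pi.single_apply]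
end inst
open GS
variable {E : Type} [NormedAddCommGroup E] [NormedSpace ℝ E] [MeasurableSpace E] [BorelSpace E]
  [SecondCountableTopology E] [GS E]
  {F : Type} [NormedAddCommGroup F] [NormedSpace ℝ F] [CompleteSpace F]
  {G : Type} [NormedAddCommGroup G] [NormedSpace ℝ G] [CompleteSpace G]
lemma integrable_of_le' {f : E → F} (hf : Continuous f) (C : ℝ)
    (h : ∀ z, ‖f z‖ ≤ C * (1 + ‖z‖ ^ 2)) : Integrable f (γ (E := E)) :=
  (int_sq.const_mul C).mono' hf.aestronglyMeasurable (ae_of_all _ h)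
lemma integrable_norm_γ : Integrable (fun z : E => ‖z‖) γ :=
  integrable_of_le' (by fun_prop) 1 fun z => by
    rw [norm_norm]; nlinarith [sq_nonneg (‖z‖ - 1)]
structure Adm (L : E → F →L[ℝ] G) : Prop where
  cont : Continuous L
  bd : ∃ C, ∀ z, ‖L z‖ ≤ C * (1 + ‖z‖ ^ 2)
lemma Adm.int {L : E → F →L[ℝ] G} (hL : Adm L) : Integrable (fun z => ‖L z‖) γ := by
  obtain ⟨C, hC⟩ := hL.bd
  exact (integrable_of_le' hL.cont C hC).norm
lemma Adm.bound {L : E → F →L[ℝ] G} (f : E →ᵇ F) (y z : E) :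
    ‖L z (f y)‖ ≤ ‖L z‖ * ‖f‖ :=
  (L z).le_opNorm_of_le (f.norm_coe_le_norm y)
lemma Adm.int2 {L : E → F →L[ℝ] G} (hL : Adm L) (f : E →ᵇ F) (s : ℝ) (x : E) :
    Integrable (fun z => L z (f (x + s • z))) γ := by
  have := hL.cont
  exact (hL.int.mul_const ‖f‖).mono' (by apply Continuous.aestronglyMeasurable; fun_prop)
    (ae_of_all _ fun z => Adm.bound f _ z)
def cv0 {L : E → F →L[ℝ] G} (hL : Adm L) (s : ℝ) (f : E →ᵇ F) : E →ᵇ G :=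
  BoundedContinuousFunction.ofNormedAddCommGroup
    (fun x => ∫ z, L z (f (x + s • z)) ∂γ)
    (by
      have := hL.cont
      exact continuous_of_dominated (bound := fun z => ‖L z‖ * ‖f‖)
        (fun x => by apply Continuous.aestronglyMeasurable; fun_prop)
        (fun x => ae_of_all _ fun z => Adm.bound f _ z) (hL.int.mul_const _)
        (ae_of_all _ fun z => by fun_prop))
    ((∫ z, ‖L z‖ ∂γ) * ‖f‖)
    (fun x => by
      rw [← integral_mul_const]
      exact norm_integral_le_of_norm_le (hL.int.mul_const _)
        (ae_of_all _ fun z => Adm.bound f _ z))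
lemma cv0_apply {L : E → F →L[ℝ] G} (hL : Adm L) (s : ℝ) (f : E →ᵇ F) (x : E) :
    cv0 hL s f x = ∫ z, L z (f (x + s • z)) ∂γ := rfl
lemma cv0_norm {L : E → F →L[ℝ] G} (hL : Adm L) (s : ℝ) (f : E →ᵇ F) :
    ‖cv0 hL s f‖ ≤ (∫ z, ‖L z‖ ∂γ) * ‖f‖ :=
  BoundedContinuousFunction.norm_ofNormedAddCommGroup_le _
    (mul_nonneg (integral_nonneg fun z => norm_nonneg (L z)) (norm_nonneg f)) _
def cv {L : E → F →L[ℝ] G} (hL : Adm L) (s : ℝ) : (E →ᵇ F) →L[ℝ] (E →ᵇ G) :=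
  LinearMap.mkContinuous
    { toFun := cv0 hL s
      map_add' := fun f g => by
        ext x
        simp only [cv0_apply, BoundedContinuousFunction.coe_add, Pi.add_apply, map_add]
        exact integral_add (hL.int2 f s x) (hL.int2 g s x)
      map_smul' := fun c f => by
        ext x
        simp only [cv0_apply, BoundedContinuousFunction.coe_smul, map_smul, RingHom.id_apply]
        exact integral_smul _ _ }
    (∫ z, ‖L z‖ ∂γ) (cv0_norm hL s)
lemma cv_norm {L : E → F →L[ℝ] G} (hL : Adm L) (s : ℝ) :
    ‖cv hL s‖ ≤ ∫ z, ‖L z‖ ∂γ :=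
  LinearMap.mkContinuous_norm_le _ (integral_nonneg fun z => norm_nonneg (L z)) _
lemma admId : Adm (fun _ : E => ContinuousLinearMap.id ℝ F) :=
  ⟨continuous_const, 1, fun z => by
    have := ContinuousLinearMap.norm_id_le (𝕜 := ℝ) (E := F)
    nlinarith [sq_nonneg ‖z‖]⟩
lemma admD : Adm (fun z : E => ContinuousLinearMap.smulRightL ℝ (E) F (B z)) := by
  set K := (ContinuousLinearMap.smulRightL ℝ (E) F).comp (B) with hK
  refine ⟨by fun_prop, ‖K‖, fun z => ?_⟩
  calc _ ≤ ‖K‖ * ‖z‖ := K.le_opNorm z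
    _ ≤ _ := by gcongr; nlinarith [sq_nonneg (‖z‖ - 1)]
def P (s : ℝ) : (E →ᵇ F) →L[ℝ] (E →ᵇ F) := cv admId s
def D (s : ℝ) : (E →ᵇ F) →L[ℝ] (E →ᵇ (E →L[ℝ] F)) := s⁻¹ • cv admD s
lemma P_apply (s : ℝ) (f : E →ᵇ F) (x : E) :
    P s f x = ∫ z, f (x + s • z) ∂γ := rfl
lemma D_apply (s : ℝ) (f : E →ᵇ F) (x v : E) :
    D s f x v = s⁻¹ • ∫ z, B z v • f (x + s • z) ∂γ := by
  have : D s f x v = s⁻¹ • (∫ z, ContinuousLinearMap.smulRightL ℝ (E) F (B z)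
    (f (x + s • z)) ∂γ) v := rfl
  rw [this, ContinuousLinearMap.integral_apply (admD.int2 f s x)]
  rfl
lemma P_norm (s : ℝ) : ‖P (E := E) (F := F) s‖ ≤ 1 := by
  refine (cv_norm (E := E) (F := F) admId s).trans ?_
  calc _ ≤ ∫ z : E, (1 : ℝ) ∂γ := by
        refine integral_mono admId.int (integrable_const _) fun z =>
          ContinuousLinearMap.norm_id_le
    _ = 1 := by simp
lemma P_norm_le (s : ℝ) (f : E →ᵇ F) : ‖P s f‖ ≤ ‖f‖ := by
  have h := (P (E := E) (F := F) s).le_opNorm f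
  have h2 := mul_le_mul_of_nonneg_right (P_norm (E := E) (F := F) s) (norm_nonneg f)
  rw [one_mul] at h2
  exact h.trans h2
lemma P_zero (f : E →ᵇ F) : P 0 f = f := by
  ext x; simp [P_apply]
def cD (E : Type) [NormedAddCommGroup E] [NormedSpace ℝ E] [MeasurableSpace E] [GS E] (F : Type) [NormedAddCommGroup F] [NormedSpace ℝ F] [CompleteSpace F] : ℝ :=
  ∫ z, ‖ContinuousLinearMap.smulRightL ℝ (E) F (B z)‖ ∂γ
lemma cD_nonneg : 0 ≤ cD E F := integral_nonneg fun z => norm_nonneg (ContinuousLinearMap.smulRightL ℝ E F (B z))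
lemma D_norm_le {s : ℝ} (hs : 0 < s) (f : E →ᵇ F) : ‖D s f‖ ≤ cD E F * s⁻¹ * ‖f‖ := by
  have := (cv (F := F) admD s).le_of_opNorm_le (cv_norm admD s) f
  have e : D s f = s⁻¹ • cv admD s f := rfl
  rw [e, norm_smul, Real.norm_of_nonneg (by positivity), mul_comm (cD E F), mul_assoc]
  gcongr
  exact this
def D1 (f : E →ᵇ F) (f' : E →ᵇ (E →L[ℝ] F)) : Prop := ∀ x, HasFDerivAt f (f' x) x
lemma D1.unique {f : E →ᵇ F} {a b} (ha : D1 f a) (hb : D1 f b) : a = b := by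
  ext1 x; exact (ha x).unique (hb x)
lemma D1.avg {f : E →ᵇ F} {f'} (h : D1 f f') (s : ℝ) : D1 (P s f) (P s f') := by
  intro x
  have := hasFDerivAt_integral_of_dominated_of_fderiv_le (μ := γ) (s := univ)
    (F := fun x z => f (x + s • z)) (F' := fun x z => f' (x + s • z)) (x₀ := x)
    (bound := fun _ => ‖f'‖) Filter.univ_mem
    (Eventually.of_forall fun x => by apply Continuous.aestronglyMeasurable; fun_prop)
    (admId.int2 f s x) (by apply Continuous.aestronglyMeasurable; fun_prop)
    (ae_of_all _ fun z y _ => f'.norm_coe_le_norm _) (integrable_const _)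
    (ae_of_all _ fun z y _ =>
      (hasFDerivAt_comp_add_right (s • z)).2 (h (y + s • z)))
  exact this
lemma D1_P {s : ℝ} (hs : 0 < s) (f : E →ᵇ F) : D1 (P s f) (D s f) :=
  fun x0 => der f s hs x0
lemma D_eq {s : ℝ} (hs : 0 < s) {f : E →ᵇ F} {f'} (h : D1 f f') : D s f = P s f' :=
  (D1_P hs f).unique (h.avg s)
lemma P_P (s t : ℝ) (ht : 0 < t) (f : E →ᵇ F) :
    P s (P t f) = P (Real.sqrt (s ^ 2 + t ^ 2)) f := by
  ext x
  set q := Real.sqrt (s ^ 2 + t ^ 2) with hq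
  have hq0 : 0 < q := Real.sqrt_pos.2 (by positivity)
  have hq2 : q ^ 2 = s ^ 2 + t ^ 2 := Real.sq_sqrt (by positivity)
  have := rot (f.compContinuous ⟨fun z => x + q • z, by fun_prop⟩) (s / q) (t / q)
    (by positivity) (by field_simp; linarith)
  simp only [P_apply]
  simp only [BoundedContinuousFunction.compContinuous_apply, ContinuousMap.coe_mk] at this
  rw [← this]
  congr 1; ext z; congr 1; ext w; congr 1
  rw [smul_add, smul_smul, smul_smul, mul_div_cancel₀ _ hq0.ne', mul_div_cancel₀ _ hq0.ne',
    add_assoc]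
lemma P_D (s t : ℝ) (ht : 0 < t) (f : E →ᵇ F) :
    P s (D t f) = D (Real.sqrt (s ^ 2 + t ^ 2)) f := by
  have h1 := (D1_P ht f).avg s
  rw [P_P s t ht] at h1
  exact h1.unique (D1_P (Real.sqrt_pos.2 (by positivity)) f)
lemma norm_sub_le {f : E →ᵇ F} {f'} (h : D1 f f') (x y : E) :
    ‖f x - f y‖ ≤ ‖f'‖ * ‖x - y‖ :=
  Convex.norm_image_sub_le_of_norm_hasFDerivWithin_le (s := univ)
    (fun x _ => (h x).hasFDerivWithinAt) (fun x _ => f'.norm_coe_le_norm x) convex_univ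
    (mem_univ _) (mem_univ _)
def m1 (E : Type) [NormedAddCommGroup E] [NormedSpace ℝ E] [MeasurableSpace E] [GS E] : ℝ := ∫ z : E, ‖z‖ ∂γ
lemma m1_nonneg : 0 ≤ m1 E := integral_nonneg fun _ : E => norm_nonneg _
lemma P_sub_le {s : ℝ} (hs : 0 ≤ s) {f : E →ᵇ F} {f'} (h : D1 f f') :
    ‖P s f - f‖ ≤ m1 E * s * ‖f'‖ := by
  have hm := m1_nonneg (E := E)
  refine (BoundedContinuousFunction.norm_le (by positivity)).2 fun x => ?_
  have e : P s f x - f x = ∫ z, (f (x + s • z) - f x) ∂γ := by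
    rw [integral_sub (f := fun z => f (x + s • z)) (admId.int2 f s x) (integrable_const _),
      P_apply]; simp
  have : m1 E * s * ‖f'‖ = ∫ z : E, ‖z‖ * (s * ‖f'‖) ∂γ := by
    rw [integral_mul_const, m1]; ring
  rw [BoundedContinuousFunction.coe_sub, Pi.sub_apply, e, this]
  refine norm_integral_le_of_norm_le (integrable_norm_γ.mul_const _) (ae_of_all _ fun z => ?_)
  refine (norm_sub_le h _ _).trans (le_of_eq ?_)
  rw [add_sub_cancel_left, norm_smul, Real.norm_of_nonneg hs]; ring
lemma P_tendsto {f : E →ᵇ F} (hf : UniformContinuous f) :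
    Tendsto (fun s => P s f) (𝓝 0) (𝓝 f) := by
  rw [Metric.tendsto_nhds]
  intro ε hε
  obtain ⟨δ, hδ, h⟩ := Metric.uniformContinuous_iff.1 hf (ε / 4) (by positivity)
  have hm := m1_nonneg (E := E)
  have h0 : ∀ᶠ s : ℝ in 𝓝 0, 2 * ‖f‖ * |s| / δ * m1 E < ε / 4 := by
    have : Tendsto (fun s : ℝ => 2 * ‖f‖ * |s| / δ * m1 E) (𝓝 0) (𝓝 (2 * ‖f‖ * |0| / δ * m1 E)) := by
      apply Continuous.tendsto; fun_prop
    exact this.eventually_lt_const (by simpa using by positivity)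
  filter_upwards [h0] with s hs
  rw [dist_eq_norm]
  refine lt_of_le_of_lt ((BoundedContinuousFunction.norm_le (C := ε / 2) (by positivity)).2
    fun x => ?_) (by linarith)
  have e : P s f x - f x = ∫ z, (f (x + s • z) - f x) ∂γ := by
    rw [integral_sub (f := fun z => f (x + s • z)) (admId.int2 f s x) (integrable_const _),
      P_apply]; simp
  rw [BoundedContinuousFunction.coe_sub, Pi.sub_apply, e]
  have hi : Integrable (fun z : E => ε / 4 + 2 * ‖f‖ * |s| / δ * ‖z‖) γ :=
    (integrable_const _).add (integrable_norm_γ.const_mul _)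
  refine (norm_integral_le_of_norm_le hi (ae_of_all _ fun z => ?_)).trans ?_
  · by_cases hz : |s| * ‖z‖ < δ
    · have := h (a := x + s • z) (b := x) (by
        rw [dist_eq_norm, add_sub_cancel_left, norm_smul]; exact hz)
      rw [dist_eq_norm] at this
      have : 0 ≤ 2 * ‖f‖ * |s| / δ * ‖z‖ := by positivity
      linarith
    · have h2 : 1 ≤ |s| * ‖z‖ / δ := (one_le_div hδ).2 (not_lt.1 hz)
      calc _ ≤ ‖f (x + s • z)‖ + ‖f x‖ := _root_.norm_sub_le _ _
        _ ≤ 2 * ‖f‖ * 1 := by linarith [f.norm_coe_le_norm (x + s • z), f.norm_coe_le_norm x]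
        _ ≤ 2 * ‖f‖ * (|s| * ‖z‖ / δ) := by gcongr
        _ ≤ _ := by
          have : 2 * ‖f‖ * (|s| * ‖z‖ / δ) = 2 * ‖f‖ * |s| / δ * ‖z‖ := by ring
          linarith
  · rw [integral_add (integrable_const _) (integrable_norm_γ.const_mul _), integral_const_mul]
    simp only [integral_const, probReal_univ, one_smul]
    rw [← m1]; linarith
end FP
end
noncomputable section
namespace FP
open scoped Topology BoundedContinuousFunction
set_option linter.unusedSectionVars false
set_option maxSynthPendingDepth 3
open GS
attribute [local irreducible] P D
variable {E : Type} [NormedAddCommGroup E] [NormedSpace ℝ E] [MeasurableSpace E] [BorelSpace E]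
  [SecondCountableTopology E] [GS E]
  {F : Type} [NormedAddCommGroup F] [NormedSpace ℝ F] [CompleteSpace F]
def H (κ r : ℝ) : (E →ᵇ F) →L[ℝ] (E →ᵇ F) := P (Real.sqrt (2 * κ * r))
def HD (κ r : ℝ) : (E →ᵇ F) →L[ℝ] (E →ᵇ (E →L[ℝ] F)) := D (Real.sqrt (2 * κ * r))
def HA (κ r : ℝ) (f : E →ᵇ F) : E →ᵇ (E →L[ℝ] E →L[ℝ] F) := HD κ (r / 2) (HD κ (r / 2) f)
section
variable {κ : ℝ} (hκ : 0 < κ)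
include hκ
lemma sc_pos {r : ℝ} (hr : 0 < r) : 0 < Real.sqrt (2 * κ * r) := Real.sqrt_pos.2 (by positivity)
lemma sc_add {r t : ℝ} (hr : 0 ≤ r) (ht : 0 ≤ t) :
    Real.sqrt (Real.sqrt (2 * κ * r) ^ 2 + Real.sqrt (2 * κ * t) ^ 2) =
      Real.sqrt (2 * κ * (r + t)) := by
  rw [Real.sq_sqrt (by positivity), Real.sq_sqrt (by positivity)]; ring_nf
omit hκ in
lemma H_norm_le (r : ℝ) (f : E →ᵇ F) : ‖H κ r f‖ ≤ ‖f‖ := P_norm_le _ f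
omit hκ in
lemma H_zero (f : E →ᵇ F) : H κ 0 f = f := by
  rw [H, mul_zero, Real.sqrt_zero, P_zero]
lemma D1_H {r : ℝ} (hr : 0 < r) (f : E →ᵇ F) : D1 (H κ r f) (HD κ r f) := D1_P (sc_pos hκ hr) f
omit hκ in
lemma D1.H {f : E →ᵇ F} {f'} (h : D1 f f') (r : ℝ) : D1 (H κ r f) (H κ r f') := h.avg _
lemma HD_eq {r : ℝ} (hr : 0 < r) {f : E →ᵇ F} {f'} (h : D1 f f') : HD κ r f = H κ r f' :=
  D_eq (sc_pos hκ hr) h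
lemma H_H {r t : ℝ} (hr : 0 ≤ r) (ht : 0 ≤ t) (f : E →ᵇ F) : H κ r (H κ t f) = H κ (r + t) f := by
  rcases ht.eq_or_lt with rfl | ht
  · rw [H_zero, add_zero]
  · rw [H, H, P_P _ _ (sc_pos hκ ht), sc_add hκ hr ht.le, H]
lemma H_HD {r t : ℝ} (hr : 0 ≤ r) (ht : 0 < t) (f : E →ᵇ F) :
    H κ r (HD κ t f) = HD κ (r + t) f := by
  rw [H, HD, P_D _ _ (sc_pos hκ ht), sc_add hκ hr ht.le, HD]
lemma D1_HD {r : ℝ} (hr : 0 < r) (f : E →ᵇ F) : D1 (HD κ r f) (HA κ r f) := by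
  have := D1_H hκ (half_pos hr) (HD κ (r / 2) f)
  rwa [H_HD hκ (half_pos hr).le (half_pos hr), add_halves] at this
lemma H_HA {r t : ℝ} (hr : 0 ≤ r) (ht : 0 < t) (f : E →ᵇ F) :
    H κ r (HA κ t f) = HA κ (r + t) f := by
  have := (D1_HD hκ ht f).H (κ := κ) r
  rw [H_HD hκ hr ht] at this
  exact this.unique (D1_HD hκ (by positivity) f)
lemma sc_inv {r : ℝ} (hr : 0 < r) :
    (Real.sqrt (2 * κ * r))⁻¹ = (Real.sqrt (2 * κ))⁻¹ * r ^ (-(1/2) : ℝ) := by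
  rw [Real.sqrt_mul (by positivity), mul_inv, Real.rpow_neg hr.le, Real.sqrt_eq_rpow r]
lemma HD_bound : ∃ C, 0 ≤ C ∧ ∀ r, 0 < r → ∀ f : E →ᵇ F,
    ‖HD κ r f‖ ≤ C * r ^ (-(1/2) : ℝ) * ‖f‖ := by
  refine ⟨cD E F * (Real.sqrt (2 * κ))⁻¹, mul_nonneg cD_nonneg (by positivity), fun r hr f => ?_⟩
  have := D_norm_le (sc_pos hκ hr) f
  rwa [sc_inv hκ hr, ← mul_assoc] at this
lemma HA_bound : ∃ C, 0 ≤ C ∧ ∀ r, 0 < r → ∀ f : E →ᵇ F, ‖HA κ r f‖ ≤ C * r⁻¹ * ‖f‖ := by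
  obtain ⟨C, hC, h⟩ := HD_bound (E := E) (F := F) hκ
  obtain ⟨C', hC', h'⟩ := HD_bound (E := E) (F := E →L[ℝ] F) hκ
  refine ⟨2 * C' * C, by positivity, fun r hr f => ?_⟩
  have e : (r / 2) ^ (-(1/2) : ℝ) * (r / 2) ^ (-(1/2) : ℝ) = 2 * r⁻¹ := by
    rw [← Real.rpow_add (by positivity)]; norm_num [Real.rpow_neg_one]; ring
  have hp : 0 ≤ (r / 2) ^ (-(1/2) : ℝ) := by positivity
  calc ‖HA κ r f‖ ≤ C' * (r / 2) ^ (-(1/2) : ℝ) * ‖HD κ (r / 2) f‖ := h' _ (by positivity) _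
    _ ≤ C' * (r / 2) ^ (-(1/2) : ℝ) * (C * (r / 2) ^ (-(1/2) : ℝ) * ‖f‖) := by
        gcongr; exact h _ (by positivity) _
    _ = C' * C * ((r / 2) ^ (-(1/2) : ℝ) * (r / 2) ^ (-(1/2) : ℝ)) * ‖f‖ := by ring
    _ = _ := by rw [e]; ring
omit hκ in
lemma H_sub_le {h : ℝ} {f : E →ᵇ F} {f'} (hf : D1 f f') :
    ‖H κ h f - f‖ ≤ m1 E * Real.sqrt (2 * κ * h) * ‖f'‖ := P_sub_le (Real.sqrt_nonneg _) hf
lemma cont_family {Y : Type} [NormedAddCommGroup Y] [NormedSpace ℝ Y] (S : ℝ → Y →L[ℝ] (E →ᵇ F))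
    (hS : ∀ r t, 0 ≤ r → 0 < t → ∀ f, H κ r (S t f) = S (r + t) f)
    (b : ℝ → ℝ) (hb : ∀ r, 0 < r → ∀ f, ‖S r f‖ ≤ b r * ‖f‖) : ContinuousOn S (Ioi 0) := by
  obtain ⟨C, hC, hCb⟩ := HD_bound (E := E) (F := F) hκ
  have key : ∀ a, 0 < a → ∃ K, 0 ≤ K ∧ ∀ r, a ≤ r → ∀ h, 0 ≤ h → ‖S (h + r) - S r‖
      ≤ K * Real.sqrt (2 * κ * h) := by
    intro a ha
    refine ⟨m1 E * (C * a ^ (-(1/2) : ℝ) * |b (a / 2)|) * 2, by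
      have := m1_nonneg (E := E); positivity, fun r hr h hh => ?_⟩
    have hm := m1_nonneg (E := E)
    refine ContinuousLinearMap.opNorm_le_bound _ (by positivity) fun f => ?_
    have e1 : S r f = H κ (r - a / 2) (S (a / 2) f) := by
      rw [hS _ _ (by linarith) (by positivity)]; congr 2; ring
    have d1 := D1_H hκ (show 0 < r - a / 2 by linarith) (S (a / 2) f)
    rw [← e1] at d1
    have := H_sub_le (κ := κ) (h := h) d1
    rw [hS h r hh (ha.trans_le hr)] at this
    refine this.trans ?_
    have h2 := hCb (r - a / 2) (by linarith) (S (a / 2) f)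
    have h3 := (hb (a / 2) (by positivity) f).trans
      (mul_le_mul_of_nonneg_right (le_abs_self _) (norm_nonneg f))
    have h4 : (r - a / 2) ^ (-(1/2) : ℝ) ≤ 2 * a ^ (-(1/2) : ℝ) := by
      calc (r - a / 2) ^ (-(1/2) : ℝ) ≤ (a / 2) ^ (-(1/2) : ℝ) :=
            Real.rpow_le_rpow_of_nonpos (by positivity) (by linarith) (by norm_num)
        _ = (2 : ℝ) ^ ((1/2) : ℝ) * a ^ (-(1/2) : ℝ) := by
            rw [Real.div_rpow ha.le (by norm_num), Real.rpow_neg (by norm_num : (0:ℝ) ≤ 2)]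
            field_simp
        _ ≤ (2 : ℝ) ^ (1 : ℝ) * a ^ (-(1/2) : ℝ) := by
            gcongr <;> norm_num
        _ = _ := by rw [Real.rpow_one]
    have hp : 0 ≤ (r - a / 2) ^ (-(1/2) : ℝ) := Real.rpow_nonneg (by linarith) _
    calc m1 E * Real.sqrt (2 * κ * h) * ‖HD κ (r - a / 2) (S (a / 2) f)‖
        ≤ m1 E * Real.sqrt (2 * κ * h) * (C * (2 * a ^ (-(1/2) : ℝ)) * (|b (a / 2)| * ‖f‖)) := by
          gcongr
          refine h2.trans ?_
          gcongr
      _ = _ := by ring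
  intro r hr
  have hr : 0 < r := hr
  refine ContinuousAt.continuousWithinAt ?_
  obtain ⟨K, hK, h⟩ := key (r / 2) (by positivity)
  rw [ContinuousAt, tendsto_iff_norm_sub_tendsto_zero]
  have hlim : Tendsto (fun r' => K * Real.sqrt (2 * κ * |r' - r|)) (𝓝 r) (𝓝 0) := by
    have : Continuous fun r' => K * Real.sqrt (2 * κ * |r' - r|) := by fun_prop
    simpa using this.tendsto r
  refine squeeze_zero' (Eventually.of_forall fun _ => norm_nonneg _) ?_ hlim
  filter_upwards [lt_mem_nhds (show r / 2 < r by linarith)] with r' hr'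
  rcases le_total r r' with hle | hle
  · have := h r (by linarith) (r' - r) (by linarith)
    rwa [sub_add_cancel, ← abs_of_nonneg (show 0 ≤ r' - r by linarith)] at this
  · have := h r' hr'.le (r - r') (by linarith)
    rwa [sub_add_cancel, norm_sub_rev, ← abs_of_nonneg (show 0 ≤ r - r' by linarith),
      abs_sub_comm] at this
lemma cont_H : ContinuousOn (H (E := E) (F := F) κ) (Ioi 0) :=
  cont_family hκ _ (fun r t hr ht f => H_H hκ hr ht.le f) (fun _ => 1) fun r _ f => by
    rw [one_mul]; exact H_norm_le r f
lemma cont_HD : ContinuousOn (HD (E := E) (F := F) κ) (Ioi 0) := by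
  obtain ⟨C, hC, h⟩ := HD_bound (E := E) (F := F) hκ
  exact cont_family hκ _ (fun r t hr ht f => H_HD hκ hr ht f) _ h
omit hκ in
def HAL (κ r : ℝ) : (E →ᵇ F) →L[ℝ] (E →ᵇ (E →L[ℝ] E →L[ℝ] F)) := (HD κ (r / 2)).comp (HD κ (r / 2))
lemma cont_HA : ContinuousOn (HAL (E := E) (F := F) κ) (Ioi 0) := by
  obtain ⟨C, hC, h⟩ := HA_bound (E := E) (F := F) hκ
  exact cont_family hκ _ (fun r t hr ht f => H_HA hκ hr ht f) _ h
omit hκ in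
lemma interp {a C δ r : ℝ} (hr : 0 < r) (hδ : 0 ≤ δ) (hC : 0 ≤ C) (h1 : a ≤ C * δ * r⁻¹)
    (h2 : a ≤ C * r ^ (-(1/2) : ℝ)) : a ≤ C * (δ ^ (1/2 : ℝ) * r ^ (-(3/4) : ℝ)) := by
  rcases le_total a 0 with ha | ha
  · exact ha.trans (by positivity)
  have e : C * (δ ^ (1/2 : ℝ) * r ^ (-(3/4) : ℝ)) =
      Real.sqrt ((C * δ * r⁻¹) * (C * r ^ (-(1/2) : ℝ))) := by
    symm
    rw [Real.sqrt_eq_iff_mul_self_eq (by positivity) (by positivity)]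
    have e1 : δ ^ (1/2 : ℝ) * δ ^ (1/2 : ℝ) = δ := by
      rw [← Real.sqrt_eq_rpow, Real.mul_self_sqrt hδ]
    have e2 : r ^ (-(3/4) : ℝ) * r ^ (-(3/4) : ℝ) = r⁻¹ * r ^ (-(1/2) : ℝ) := by
      rw [← Real.rpow_neg_one, ← Real.rpow_add hr, ← Real.rpow_add hr]; norm_num
    symm
    calc _ = C * C * (δ ^ (1/2 : ℝ) * δ ^ (1/2 : ℝ)) * (r ^ (-(3/4) : ℝ) * r ^ (-(3/4) : ℝ)) := by ring
      _ = _ := by rw [e1, e2]; ring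
  rw [e]
  exact Real.le_sqrt_of_sq_le (by rw [sq]; exact mul_le_mul h1 h2 ha (by positivity))
lemma HD_space : ∃ C, 0 ≤ C ∧ ∀ r, 0 < r → ∀ (f : E →ᵇ F) (x v : E),
    ‖HD κ r f (x + v) - HD κ r f x‖ ≤ C * ‖f‖ * (‖v‖ ^ (1/2 : ℝ) * r ^ (-(3/4) : ℝ)) := by
  obtain ⟨C, hC, h⟩ := HD_bound (E := E) (F := F) hκ
  obtain ⟨C', hC', h'⟩ := HA_bound (E := E) (F := F) hκ
  refine ⟨2 * C + C', by positivity, fun r hr f x v => ?_⟩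
  refine interp hr (norm_nonneg v) (by positivity) ?_ ?_
  · have := norm_sub_le (D1_HD hκ hr f) (x + v) x
    rw [add_sub_cancel_left] at this
    refine this.trans ?_
    calc _ ≤ (C' * r⁻¹ * ‖f‖) * ‖v‖ := by gcongr; exact h' r hr f
      _ ≤ ((2 * C + C') * r⁻¹ * ‖f‖) * ‖v‖ := by gcongr; linarith
      _ = _ := by ring
  · have h2 := h r hr f
    calc _ ≤ ‖HD κ r f (x + v)‖ + ‖HD κ r f x‖ := _root_.norm_sub_le _ _
      _ ≤ 2 * (C * r ^ (-(1/2) : ℝ) * ‖f‖) := by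
          linarith [(HD κ r f).norm_coe_le_norm (x + v), (HD κ r f).norm_coe_le_norm x]
      _ = (2 * C) * ‖f‖ * r ^ (-(1/2) : ℝ) := by ring
      _ ≤ _ := by gcongr; linarith
end
end FP
end
noncomputable section
namespace FP
open scoped Topology BoundedContinuousFunction
set_option linter.unusedSectionVars false
set_option maxSynthPendingDepth 3
open GS
attribute [local irreducible] P D
variable {E : Type} [NormedAddCommGroup E] [NormedSpace ℝ E] [MeasurableSpace E] [BorelSpace E]
  [SecondCountableTopology E] [GS E]
  {F : Type} [NormedAddCommGroup F] [NormedSpace ℝ F] [CompleteSpace F]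
def trL (E : Type) [NormedAddCommGroup E] [NormedSpace ℝ E] [MeasurableSpace E] [GS E] :
    (E →L[ℝ] E →L[ℝ] ℝ) →L[ℝ] ℝ :=
  (ContinuousLinearMap.apply ℝ ℝ (e0 : E)).comp (ContinuousLinearMap.apply ℝ (E →L[ℝ] ℝ) (e0 : E)) +
  ∑ i : ι E, (ContinuousLinearMap.apply ℝ ℝ (e i : E)).comp
    (ContinuousLinearMap.apply ℝ (E →L[ℝ] ℝ) (e i : E))
lemma trL_apply (A : E →L[ℝ] E →L[ℝ] ℝ) : trL E A = A e0 e0 + ∑ i : ι E, A (e i) (e i) := by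
  simp [trL]
lemma int_BD (f : E →ᵇ F) (s : ℝ) (x v : E) : Integrable (fun z => B z v • f (x + s • z)) γ := by
  refine integrable_of_le' (by fun_prop) (‖(B : E →L[ℝ] E →L[ℝ] ℝ)‖ * ‖v‖ * ‖f‖) fun z => ?_
  rw [norm_smul]
  have h1 := (B : E →L[ℝ] E →L[ℝ] ℝ).le_opNorm₂ z v
  have h2 := f.norm_coe_le_norm (x + s • z)
  have h3 : ‖z‖ ≤ 1 + ‖z‖ ^ 2 := by nlinarith [sq_nonneg (‖z‖ - 1)]
  calc _ ≤ (‖(B : E →L[ℝ] E →L[ℝ] ℝ)‖ * ‖z‖ * ‖v‖) * ‖f‖ := by gcongr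
    _ = ‖(B : E →L[ℝ] E →L[ℝ] ℝ)‖ * ‖v‖ * ‖f‖ * ‖z‖ := by ring
    _ ≤ _ := by gcongr
lemma P_hasDerivAt {g : E →ᵇ ℝ} {g'} (h : D1 g g') {s : ℝ} (hs : 0 < s) (x : E) :
    HasDerivAt (fun s => P s g x) (s * trL E (D s g' x)) s := by
  have key := hasDerivAt_integral_of_dominated_loc_of_deriv_le (μ := (γ : Measure E))
    (F := fun s z => g (x + s • z)) (F' := fun s z => g' (x + s • z) z) (x₀ := s)
    (bound := fun z => ‖g'‖ * ‖z‖) (s := univ) univ_mem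
    (Eventually.of_forall fun s => (by fun_prop : Continuous fun z => g (x + s • z)).aestronglyMeasurable)
    (by simpa using admId.int2 g s x)
    (by
      have : Continuous fun z => g' (x + s • z) z :=
        (g'.continuous.comp (by fun_prop)).clm_apply continuous_id
      exact this.aestronglyMeasurable)
    (Eventually.of_forall fun z s _ => (ContinuousLinearMap.le_opNorm _ _).trans (by
      gcongr; exact g'.norm_coe_le_norm _))
    (integrable_norm_γ.const_mul _)
    (Eventually.of_forall fun z s _ => by
      have h1 : HasDerivAt (fun s : ℝ => x + s • z) z s := by
        simpa using ((hasDerivAt_id s).smul_const z).const_add x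
      exact (h (x + s • z)).comp_hasDerivAt s h1)
  have e : ∫ z, g' (x + s • z) z ∂γ = s * trL E (D s g' x) := by
    have hv : ∀ v : E, ∫ z, B z v * g' (x + s • z) v ∂γ = s * D s g' x v v := by
      intro v
      rw [D_apply, _root_.smul_apply, smul_eq_mul, ← mul_assoc, mul_inv_cancel₀ hs.ne',
        one_mul, ContinuousLinearMap.integral_apply (int_BD g' s x v)]
      simp
    have hi : ∀ v : E, Integrable (fun z => B z v * g' (x + s • z) v) γ := fun v => by
      simpa using (int_BD g' s x v).apply_continuousLinearMap v
    rw [trL_apply, mul_add, Finset.mul_sum, ← hv, ← Finset.sum_congr rfl fun i _ => hv (e i),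
      ← integral_finsetSum _ fun i _ => hi _, ← integral_add (hi _) (integrable_finsetSum _ fun i _ => hi _)]
    refine integral_congr_ae (Eventually.of_forall fun z => ?_)
    conv_lhs =>
      simp only []
      rw [show g' (x + s • z) z = g' (x + s • z) (B z e0 • e0 + ∑ i, B z (e i) • e i) by rw [← frame z]]
    simp [map_add, map_sum, map_smul]
  rw [← e]
  simpa only [P_apply] using key.2
section
variable {κ : ℝ} (hκ : 0 < κ)
include hκ
lemma H_hasDerivAt (f : E →ᵇ ℝ) {r : ℝ} (hr : 0 < r) (x : E) :
    HasDerivAt (fun r => H κ r f x) (κ * trL E (HA κ r f x)) r := by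
  have hs := sc_pos hκ (half_pos hr)
  have h1 := P_hasDerivAt (D1_H hκ (half_pos hr) f) hs x
  have h2 : HasDerivAt (fun r' => Real.sqrt (2 * κ * (r' - r / 2)))
      (κ / Real.sqrt (2 * κ * (r / 2))) r := by
    have : HasDerivAt (fun r' => 2 * κ * (r' - r / 2)) (2 * κ) r := by
      simpa using ((hasDerivAt_id r).sub_const (r / 2)).const_mul (2 * κ)
    convert this.sqrt (by nlinarith) using 1
    rw [show r - r / 2 = r / 2 by ring]; field_simp
  have h3 := HasDerivAt.comp r (h₂ := fun s => P s (H κ (r / 2) f) x) (by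
    rw [show r - r / 2 = r / 2 by ring]; exact h1) h2
  have h4 := h3.congr_of_eventuallyEq (f₁ := fun r => H κ r f x) (by
    filter_upwards [lt_mem_nhds (show r / 2 < r by linarith)] with r' hr'
    have := H_H hκ (show 0 ≤ r' - r / 2 by linarith) (half_pos hr).le f
    rw [sub_add_cancel] at this
    rw [← this]; rfl)
  refine h4.congr_deriv ?_
  have e : HA κ r f x = D (Real.sqrt (2 * κ * (r / 2))) (HD κ (r / 2) f) x := rfl
  rw [e]
  field_simp
lemma HA_eq {f : E →ᵇ F} {f' f''} (h : D1 f f') (h' : D1 f' f'') {r : ℝ} (hr : 0 < r) :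
    HA κ r f = H κ r f'' := by
  rw [HA, HD_eq hκ (half_pos hr) h, HD_eq hκ (half_pos hr) (h'.H _),
    H_H hκ (half_pos hr).le (half_pos hr).le, add_halves]
omit hκ in
lemma P_tendsto_pt (f : E →ᵇ F) (x : E) : Tendsto (fun s => P s f x) (𝓝 0) (𝓝 (f x)) := by
  have : Tendsto (fun s : ℝ => ∫ z, f (x + s • z) ∂γ) (𝓝 0) (𝓝 (∫ z : E, f (x + (0:ℝ) • z) ∂γ)) := by
    refine tendsto_integral_filter_of_dominated_convergence (fun _ => ‖f‖)
      (Eventually.of_forall fun s => (by fun_prop : Continuous fun z => f (x + s • z)).aestronglyMeasurable)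
      (Eventually.of_forall fun s => Eventually.of_forall fun z => f.norm_coe_le_norm _)
      (integrable_const _) (Eventually.of_forall fun z => ?_)
    have : Continuous fun s : ℝ => f (x + s • z) := by fun_prop
    exact this.tendsto 0
  simp only [P_apply]
  simpa using this
omit hκ in
lemma H_tendsto_pt (f : E →ᵇ F) (x : E) : Tendsto (fun r => H κ r f x) (𝓝 0) (𝓝 (f x)) := by
  have : Tendsto (fun r => Real.sqrt (2 * κ * r)) (𝓝 0) (𝓝 0) := by
    have : Continuous fun r => Real.sqrt (2 * κ * r) := by fun_prop
    simpa using this.tendsto 0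
  exact (P_tendsto_pt f x).comp this
omit hκ in
lemma H_tendsto {f : E →ᵇ F} (hf : UniformContinuous f) : Tendsto (fun r => H κ r f) (𝓝 0) (𝓝 f) := by
  have : Tendsto (fun r => Real.sqrt (2 * κ * r)) (𝓝 0) (𝓝 0) := by
    have : Continuous fun r => Real.sqrt (2 * κ * r) := by fun_prop
    simpa using this.tendsto 0
  exact (P_tendsto hf).comp this
lemma H_gen {f : E →ᵇ ℝ} {f' f''} (h : D1 f f') (h' : D1 f' f'') (x : E) :
    HasDerivWithinAt (fun r => H κ r f x) (κ * trL E (f'' x)) (Ici 0) 0 := by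
  refine hasDerivWithinAt_Ici_of_tendsto_deriv (s := Ioi 0) (fun r hr => ?_) ?_
    self_mem_nhdsWithin ?_
  · exact (H_hasDerivAt hκ f hr x).differentiableAt.differentiableWithinAt
  · have := (H_tendsto_pt (κ := κ) f x)
    rw [ContinuousWithinAt, H_zero]
    exact this.mono_left nhdsWithin_le_nhds
  · have h1 : Tendsto (fun r => κ * trL E (H κ r f'' x)) (𝓝[>] 0) (𝓝 (κ * trL E (f'' x))) :=
      (((trL E).continuous.tendsto _).comp
        ((H_tendsto_pt (κ := κ) f'' x).mono_left nhdsWithin_le_nhds)).const_mul κ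
    refine h1.congr' ?_
    filter_upwards [self_mem_nhdsWithin] with r hr
    rw [(H_hasDerivAt hκ f hr x).deriv, HA_eq hκ h h' hr]
omit hκ in
lemma D_comp {G : Type} [NormedAddCommGroup G] [NormedSpace ℝ G] [CompleteSpace G] (L : F →L[ℝ] G)
    (s : ℝ) (f : E →ᵇ F) (x v : E) :
    D s (L.compLeftContinuousBounded E f) x v = L (D s f x v) := by
  rw [D_apply, D_apply, map_smul, ← L.integral_comp_comm (int_BD f s x v)]
  simp
lemma HA_symm (f : E →ᵇ F) {r : ℝ} (hr : 0 < r) (x v w : E) : HA κ r f x v w = HA κ r f x w v :=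
  second_derivative_symmetric (fun y => D1_H hκ hr f y) (D1_HD hκ hr f x) v w
omit hκ in
def Hol (v : E) (K : ℝ) (g : E → F) : Prop := ∀ x (h : ℝ), ‖g (x + h • v) - g x‖ ≤ K * |h| ^ (1/2 : ℝ)
omit hκ in
lemma D_hol (i : ι E) {g : E →ᵇ F} {K : ℝ} (hg : Hol (e i) K g) {s : ℝ} (hs : 0 < s)
    (hK : 0 ≤ K) (x : E) :
    ‖D s g x (e i)‖ ≤ (∫ z : E, (1 + |B z (e i)| ^ 2) ∂γ) * K * s ^ (-(1/2) : ℝ) := by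
  have hgc := g.continuous
  have hint : Integrable (fun z : E => 1 + |B z (e i)| ^ 2) γ := by
    refine integrable_of_le' (by fun_prop) (1 + (‖(B : E →L[ℝ] E →L[ℝ] ℝ)‖ * ‖(e i : E)‖) ^ 2) fun z => ?_
    rw [Real.norm_of_nonneg (by positivity)]
    have h1 := (B : E →L[ℝ] E →L[ℝ] ℝ).le_opNorm₂ z (e i)
    rw [Real.norm_eq_abs] at h1
    have h2 : |B z (e i)| ^ 2 ≤ (‖(B : E →L[ℝ] E →L[ℝ] ℝ)‖ * ‖z‖ * ‖(e i : E)‖) ^ 2 := by gcongr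
    nlinarith [sq_nonneg (‖(B : E →L[ℝ] E →L[ℝ] ℝ)‖ * ‖(e i : E)‖), sq_nonneg ‖z‖]
  have h1 : ∫ z, B z (e i) • g (x + s • z) ∂γ
      = - ∫ z, B z (e i) • g (x + s • (z - (2 * B z (e i)) • e i)) ∂γ := by
    rw [← GS.refl i, ← integral_neg]
    congr 1; ext z
    simp only [map_sub, map_smul, _root_.sub_apply, _root_.smul_apply,
      Be, smul_eq_mul, mul_one]
    rw [← neg_smul]; congr 1; ring
  have h0 : Integrable (fun z => B z (e i) • g (x + s • (z - (2 * B z (e i)) • e i))) γ := by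
    refine (int_sq.const_mul (‖(B : E →L[ℝ] E →L[ℝ] ℝ)‖ * ‖(e i : E)‖ * ‖g‖)).mono'
      (by apply Continuous.aestronglyMeasurable; fun_prop) (Eventually.of_forall fun z => ?_)
    rw [norm_smul]
    have h1 := (B : E →L[ℝ] E →L[ℝ] ℝ).le_opNorm₂ z (e i)
    have h2 := g.norm_coe_le_norm (x + s • (z - (2 * B z (e i)) • e i))
    have h3 : ‖z‖ ≤ 1 + ‖z‖ ^ 2 := by nlinarith [sq_nonneg (‖z‖ - 1)]
    calc _ ≤ (‖(B : E →L[ℝ] E →L[ℝ] ℝ)‖ * ‖z‖ * ‖(e i : E)‖) * ‖g‖ := by gcongr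
      _ = ‖(B : E →L[ℝ] E →L[ℝ] ℝ)‖ * ‖(e i : E)‖ * ‖g‖ * ‖z‖ := by ring
      _ ≤ _ := by gcongr
  have h2 : (2 : ℝ) • ∫ z, B z (e i) • g (x + s • z) ∂γ =
      ∫ z, (B z (e i) • g (x + s • z) - B z (e i) • g (x + s • (z - (2 * B z (e i)) • e i))) ∂γ := by
    rw [integral_sub (int_BD g s x (e i)) h0, two_smul]
    nth_rw 2 [h1]
    rw [sub_eq_add_neg]
  have h3 : ‖(2 : ℝ) • ∫ z, B z (e i) • g (x + s • z) ∂γ‖ ≤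
      ∫ z, 2 * s ^ (1/2 : ℝ) * K * (1 + |B z (e i)| ^ 2) ∂γ := by
    rw [h2]
    refine norm_integral_le_of_norm_le (hint.const_mul _) (Eventually.of_forall fun z => ?_)
    rw [← smul_sub, norm_smul]
    set b := B z (e i)
    have := hg (x + s • (z - (2 * b) • e i)) (2 * s * b)
    rw [show x + s • (z - (2 * b) • e i) + (2 * s * b) • (e i : E) = x + s • z by module] at this
    rw [Real.norm_eq_abs]
    have h4 : |2 * s * b| ^ (1/2 : ℝ) ≤ 2 * s ^ (1/2 : ℝ) * |b| ^ (1/2 : ℝ) := by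
      rw [abs_mul, abs_of_pos (by positivity : 0 < 2 * s), Real.mul_rpow (by positivity) (by positivity),
        Real.mul_rpow (by positivity) hs.le]
      gcongr
      calc (2 : ℝ) ^ (1/2 : ℝ) ≤ 2 ^ (1 : ℝ) := by gcongr <;> norm_num
        _ = 2 := by norm_num
    have h5 : |b| * |b| ^ (1/2 : ℝ) ≤ 1 + |b| ^ 2 := by
      rcases le_total |b| 1 with hb | hb
      · have : |b| ^ (1/2 : ℝ) ≤ 1 := Real.rpow_le_one (abs_nonneg b) hb (by norm_num)
        nlinarith [abs_nonneg b, Real.rpow_nonneg (abs_nonneg b) (1/2 : ℝ), sq_nonneg |b|]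
      · have : |b| ^ (1/2 : ℝ) ≤ |b| ^ (1 : ℝ) := by gcongr; norm_num
        rw [Real.rpow_one] at this
        nlinarith [abs_nonneg b]
    calc |b| * ‖_‖ ≤ |b| * (K * (2 * s ^ (1/2 : ℝ) * |b| ^ (1/2 : ℝ))) := by
          gcongr
          exact this.trans (by gcongr)
      _ = 2 * s ^ (1/2 : ℝ) * K * (|b| * |b| ^ (1/2 : ℝ)) := by ring
      _ ≤ _ := by gcongr
  rw [norm_smul, integral_const_mul] at h3
  norm_num at h3
  rw [D_apply, norm_smul, norm_inv, Real.norm_of_nonneg hs.le]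
  have h6 : s ^ (-(1/2) : ℝ) = s⁻¹ * s ^ (1/2 : ℝ) := by
    rw [← Real.rpow_neg_one, ← Real.rpow_add hs]; norm_num
  calc _ ≤ s⁻¹ * (s ^ (1/2 : ℝ) * K * ∫ z : E, (1 + |B z (e i)| ^ 2) ∂γ) := by
        gcongr; norm_num; linarith
    _ = _ := by rw [h6]; ring
lemma HA_row : ∃ C, 0 ≤ C ∧ ∀ (i : ι E) r, 0 < r → ∀ (g : E →ᵇ ℝ) (K : ℝ), 0 ≤ K → Hol (e i) K g →
    ∀ x v, ‖HA κ r g x v (e i)‖ ≤ C * K * r ^ (-(3/4) : ℝ) * ‖v‖ := by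
  obtain ⟨C, hC, h⟩ := HD_bound (E := E) (F := ℝ) hκ
  set S : ι E → ℝ := fun i => ∫ z : E, (1 + |B z (e i)| ^ 2) ∂γ with hS
  have hS0 : ∀ i, 0 ≤ S i := fun i => integral_nonneg fun z => by positivity
  refine ⟨2 * (C * (∑ i, S i) * (2 * κ) ^ (-(1/4) : ℝ)), by
    have := Finset.sum_nonneg fun i (_ : i ∈ Finset.univ) => hS0 i
    positivity, fun i r hr g K hK hg x v => ?_⟩
  set q : E →ᵇ ℝ := (ContinuousLinearMap.apply ℝ ℝ (e i : E)).compLeftContinuousBounded E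
    (HD κ (r / 2) g) with hq
  have e1 : HA κ r g x v (e i) = HD κ (r / 2) q x v := by
    rw [hq, HD, D_comp]; rfl
  have hSi : S i ≤ ∑ i, S i := Finset.single_le_sum (fun i _ => hS0 i) (Finset.mem_univ i)
  have e2 : (Real.sqrt (2 * κ * (r / 2))) ^ (-(1/2) : ℝ) = (2 * κ) ^ (-(1/4) : ℝ) * (r / 2) ^ (-(1/4) : ℝ) := by
    rw [Real.sqrt_eq_rpow, ← Real.rpow_mul (by positivity), Real.mul_rpow (by positivity) (by positivity)]
    norm_num
  have hq1 : ‖q‖ ≤ (∑ i, S i) * K * ((2 * κ) ^ (-(1/4) : ℝ) * (r / 2) ^ (-(1/4) : ℝ)) := by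
    refine (BoundedContinuousFunction.norm_le (by
      have := (hS0 i).trans hSi; positivity)).2 fun y => ?_
    have := D_hol i hg (sc_pos hκ (half_pos hr)) hK y
    rw [e2] at this
    refine this.trans ?_
    gcongr
  have e3 : (r / 2) ^ (-(1/2) : ℝ) * (r / 2) ^ (-(1/4) : ℝ) ≤ 2 * r ^ (-(3/4) : ℝ) := by
    rw [← Real.rpow_add (by positivity), Real.div_rpow hr.le (by norm_num),
      show (-(1/2) + -(1/4) : ℝ) = -(3/4) by norm_num, Real.rpow_neg (by norm_num : (0:ℝ) ≤ 2),
      div_inv_eq_mul, mul_comm]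
    gcongr
    calc (2 : ℝ) ^ (3/4 : ℝ) ≤ 2 ^ (1 : ℝ) := by gcongr <;> norm_num
        _ = 2 := by norm_num
  rw [e1]
  have hb := h (r / 2) (half_pos hr) q
  have hSS := (hS0 i).trans hSi
  calc _ ≤ ‖HD κ (r / 2) q x‖ * ‖v‖ := ContinuousLinearMap.le_opNorm _ _
    _ ≤ (C * (r / 2) ^ (-(1/2) : ℝ) * ((∑ i, S i) * K * ((2 * κ) ^ (-(1/4) : ℝ) * (r / 2) ^ (-(1/4) : ℝ)))) * ‖v‖ := by
        gcongr
        exact ((HD κ (r / 2) q).norm_coe_le_norm x).trans (hb.trans (by gcongr))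
    _ = C * (∑ i, S i) * (2 * κ) ^ (-(1/4) : ℝ) * K * ((r / 2) ^ (-(1/2) : ℝ) * (r / 2) ^ (-(1/4) : ℝ)) * ‖v‖ := by ring
    _ ≤ C * (∑ i, S i) * (2 * κ) ^ (-(1/4) : ℝ) * K * (2 * r ^ (-(3/4) : ℝ)) * ‖v‖ := by gcongr
    _ = _ := by ring
omit hκ in
lemma norm_symm_le : ∃ C, 0 ≤ C ∧ ∀ A : E →L[ℝ] E →L[ℝ] ℝ, (∀ v w, A v w = A w v) → ∀ R, 0 ≤ R →
    |trL E A| ≤ R → (∀ i v, ‖A v (e i)‖ ≤ R * ‖v‖) → ‖A‖ ≤ C * R := by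
  set b : ℝ := ‖(B : E →L[ℝ] E →L[ℝ] ℝ)‖
  set n0 : ℝ := ‖(e0 : E)‖
  set n : ℝ := ∑ i : ι E, ‖(e i : E)‖
  have hb : ∀ z v : E, |B z v| ≤ b * ‖z‖ * ‖v‖ := fun z v => (B : E →L[ℝ] E →L[ℝ] ℝ).le_opNorm₂ z v
  have hn : 0 ≤ n := Finset.sum_nonneg fun i _ => norm_nonneg _
  have hn0 : 0 ≤ n0 := norm_nonneg _
  have hb0 : 0 ≤ b := norm_nonneg _
  refine ⟨b * n0 * (b * n0 * (1 + n) + b * n * n0) + b * n, by positivity, fun A hA R hR ht hr => ?_⟩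
  refine ContinuousLinearMap.opNorm_le_bound₂ _ (by positivity) fun v w => ?_
  have h00 : |A e0 e0| ≤ R * (1 + n) := by
    have e1 : A e0 e0 = trL E A - ∑ i, A (e i) (e i) := by rw [trL_apply]; ring
    have e2 : |∑ i : ι E, A (e i) (e i)| ≤ R * n := by
      rw [Finset.mul_sum]
      exact (Finset.abs_sum_le_sum_abs _ _).trans (Finset.sum_le_sum fun i _ => hr i _)
    rw [e1]; linarith [abs_sub (trL E A) (∑ i : ι E, A (e i) (e i))]
  have hv0 : |A v e0| ≤ (b * n0 * (1 + n) + b * n * n0) * R * ‖v‖ := by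
    have e1 : A v e0 = B v e0 * A e0 e0 + ∑ i, B v (e i) * A e0 (e i) := by
      conv_lhs => rw [frame v]
      simp [map_add, map_sum, hA _ e0]
    have e2 : |∑ i : ι E, B v (e i) * A e0 (e i)| ≤ b * n * n0 * R * ‖v‖ := by
      calc _ ≤ ∑ i : ι E, (b * ‖v‖ * ‖(e i : E)‖) * (R * n0) := by
            refine (Finset.abs_sum_le_sum_abs _ _).trans (Finset.sum_le_sum fun i _ => ?_)
            rw [abs_mul]; gcongr
            · exact hb v _
            · exact hr i _
        _ = _ := by rw [← Finset.sum_mul, ← Finset.mul_sum]; ring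
    rw [e1]
    calc _ ≤ |B v e0| * |A e0 e0| + |∑ i : ι E, B v (e i) * A e0 (e i)| := by
          rw [← abs_mul]; exact abs_add_le _ _
      _ ≤ (b * ‖v‖ * n0) * (R * (1 + n)) + b * n * n0 * R * ‖v‖ := by
          gcongr; exact hb v _
      _ = _ := by ring
  have e1 : A v w = B w e0 * A v e0 + ∑ i, B w (e i) * A v (e i) := by
    conv_lhs => rw [frame w]
    simp [map_add, map_sum]
  have e2 : |∑ i : ι E, B w (e i) * A v (e i)| ≤ b * n * R * ‖v‖ * ‖w‖ := by
    calc _ ≤ ∑ i : ι E, (b * ‖w‖ * ‖(e i : E)‖) * (R * ‖v‖) := by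
          refine (Finset.abs_sum_le_sum_abs _ _).trans (Finset.sum_le_sum fun i _ => ?_)
          rw [abs_mul]; gcongr
          · exact hb w _
          · exact hr i _
      _ = _ := by rw [← Finset.sum_mul, ← Finset.mul_sum]; ring
  rw [e1, Real.norm_eq_abs]
  calc _ ≤ |B w e0| * |A v e0| + |∑ i : ι E, B w (e i) * A v (e i)| := by
        rw [← abs_mul]; exact abs_add_le _ _
    _ ≤ (b * ‖w‖ * n0) * ((b * n0 * (1 + n) + b * n * n0) * R * ‖v‖) + b * n * R * ‖v‖ * ‖w‖ := by
        gcongr; exact hb w _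
    _ = _ := by ring
end
end FP
end
noncomputable section
namespace FP
open scoped Topology BoundedContinuousFunction
set_option linter.unusedSectionVars false
section vol
variable {X Y : Type} [NormedAddCommGroup X] [NormedSpace ℝ X]
  [NormedAddCommGroup Y] [NormedSpace ℝ Y] [CompleteSpace Y]
lemma vol_cont {Φ : ℝ → ℝ → Y} {k : ℝ → ℝ} {t0 : ℝ}
    (hm : ∀ᶠ t in 𝓝 t0, AEStronglyMeasurable (Φ t) (volume.restrict (Ioc 0 t)))
    (hb : ∀ᶠ t in 𝓝 t0, ∀ r ∈ Ioc 0 t, ‖Φ t r‖ ≤ k r) (hk : IntegrableOn k (Ioc 0 (t0 + 1)))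
    (hk0 : ∀ r, 0 < r → 0 ≤ k r)
    (hc : ∀ r, 0 < r → r < t0 → ContinuousAt (fun t => Φ t r) t0) :
    ContinuousAt (fun t => ∫ r in Ioc 0 t, Φ t r) t0 := by
  have hlt : ∀ᶠ t in 𝓝 t0, t < t0 + 1 := gt_mem_nhds (by linarith)
  have : ContinuousAt (fun t => ∫ r, indicator (Ioc 0 t) (Φ t) r) t0 := by
    refine continuousAt_of_dominated (bound := indicator (Ioc 0 (t0 + 1)) k) ?_ ?_ ?_ ?_
    · filter_upwards [hm] with t h
      exact (aestronglyMeasurable_indicator_iff measurableSet_Ioc).2 h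
    · filter_upwards [hb, hlt] with t h ht
      refine Eventually.of_forall fun r => ?_
      by_cases hr : r ∈ Ioc 0 t
      · rw [indicator_of_mem hr, indicator_of_mem (show r ∈ Ioc 0 (t0 + 1) from ⟨hr.1, hr.2.trans ht.le⟩)]; exact h r hr
      · rw [indicator_of_notMem hr, norm_zero]
        exact indicator_nonneg (fun r hr => hk0 r hr.1) r
    · exact (integrable_indicator_iff measurableSet_Ioc).2 hk
    · have : ∀ᵐ r : ℝ, r ≠ t0 := by simp [ae_iff]
      filter_upwards [this] with r hr
      by_cases h0 : 0 < r
      · rcases lt_or_gt_of_ne hr with h | h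
        · refine (hc r h0 h).congr ?_
          filter_upwards [lt_mem_nhds h] with t ht
          rw [indicator_of_mem (show r ∈ Ioc 0 t from ⟨h0, ht.le⟩)]
        · refine (continuousAt_const (y := (0 : Y))).congr ?_
          filter_upwards [gt_mem_nhds h] with t ht
          rw [indicator_of_notMem (fun hh => absurd hh.2 (not_le.2 ht))]
      · refine (continuousAt_const (y := (0 : Y))).congr (Eventually.of_forall fun t => ?_)
        exact (indicator_of_notMem (fun hh : r ∈ Ioc 0 t => h0 hh.1) _).symm
  simpa only [integral_indicator measurableSet_Ioc] using this
lemma int_rpow (C : ℝ) {a : ℝ} (ha : -1 < a) (t : ℝ) : IntegrableOn (fun r : ℝ => C * r ^ a) (Ioc 0 t) := by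
  rcases le_total 0 t with h | h
  · exact (((intervalIntegrable_iff_integrableOn_Ioc_of_le h).1
      (intervalIntegral.intervalIntegrable_rpow' ha)).const_mul C)
  · rw [Ioc_eq_empty (not_lt.2 h)]; exact integrableOn_empty
lemma int_rpow_val {a : ℝ} (ha : -1 < a) {t : ℝ} (ht : 0 ≤ t) :
    ∫ r in Ioc 0 t, r ^ a = t ^ (a + 1) / (a + 1) := by
  rw [← intervalIntegral.integral_of_le ht, integral_rpow (Or.inl ha),
    Real.zero_rpow (by linarith), sub_zero]
def cvT (T : ℝ → X →L[ℝ] Y) (G : ℝ → X) (t : ℝ) : Y := ∫ r in Ioc 0 t, T r (G (t - r))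
variable {T : ℝ → X →L[ℝ] Y} (hT : ContinuousOn T (Ioi 0)) {C a : ℝ} (hC : 0 ≤ C) (ha : -1 < a)
  (hTb : ∀ r, 0 < r → ∀ f, ‖T r f‖ ≤ C * r ^ a * ‖f‖)
include hT
lemma cvT_meas {G : ℝ → X} (hG : Continuous G) (t : ℝ) (S : Set ℝ) (hS : MeasurableSet S) (hS0 : S ⊆ Ioi 0) :
    AEStronglyMeasurable (fun r => T r (G (t - r))) (volume.restrict S) := by
  refine ContinuousOn.aestronglyMeasurable ?_ hS
  exact (hT.mono hS0).clm_apply (by fun_prop)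
include hC ha hTb
lemma cvT_int {G : ℝ → X} (hG : Continuous G) (t : ℝ) :
    IntegrableOn (fun r => T r (G (t - r))) (Ioc 0 t) := by
  obtain ⟨K, hK⟩ := isCompact_Icc.exists_bound_of_continuousOn (s := Icc 0 t) hG.continuousOn
  refine Integrable.mono' (int_rpow (C * K) ha t)
    (cvT_meas hT hG t _ measurableSet_Ioc fun r hr => hr.1) ?_
  filter_upwards [ae_restrict_mem measurableSet_Ioc] with r hr
  have := hK (t - r) ⟨by linarith [hr.2], by linarith [hr.1]⟩
  calc _ ≤ C * r ^ a * ‖G (t - r)‖ := hTb r hr.1 _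
    _ ≤ C * r ^ a * K := by
      have : 0 ≤ r ^ a := Real.rpow_nonneg hr.1.le _
      gcongr
    _ = _ := by ring
lemma cvT_cont {G : ℝ → X} (hG : Continuous G) : Continuous (cvT T G) := by
  rw [continuous_iff_continuousAt]
  intro t0
  obtain ⟨K, hK⟩ := isCompact_Icc.exists_bound_of_continuousOn (s := Icc 0 (t0 + 1)) hG.continuousOn
  refine vol_cont (k := fun r => C * |K| * r ^ a)
    (Eventually.of_forall fun t => cvT_meas hT hG t _ measurableSet_Ioc fun r hr => hr.1) ?_
    (int_rpow _ ha _) (fun r hr => by positivity) ?_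
  · filter_upwards [gt_mem_nhds (show t0 < t0 + 1 by linarith)] with t ht r hr
    have h2 := (hK (t - r) ⟨by linarith [hr.2], by linarith [hr.1]⟩).trans (le_abs_self K)
    calc _ ≤ C * r ^ a * ‖G (t - r)‖ := hTb r hr.1 _
      _ ≤ C * r ^ a * |K| := by
        have : 0 ≤ r ^ a := Real.rpow_nonneg hr.1.le _
        gcongr
      _ = _ := by ring
  · intro r _ _
    have : Continuous fun t => T r (G (t - r)) := (T r).continuous.comp (hG.comp (by fun_prop))
    exact this.continuousAt
omit hT hC ha hTb in
lemma sub_integral_mem (S : Submodule ℝ Y) (hS : IsClosed (S : Set Y)) {α : Type} [MeasurableSpace α]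
    {μ : Measure α} {f : α → Y} (hf : ∀ᵐ a ∂μ, f a ∈ S) : ∫ a, f a ∂μ ∈ S := by
  by_cases hi : Integrable f μ
  · have : IsClosed (S : Set Y) := hS
    rw [← S.ker_mkQ, LinearMap.mem_ker]
    let Q : Y →L[ℝ] Y ⧸ S := ⟨S.mkQ, by exact continuous_quot_mk⟩
    have h1 : Q (∫ a, f a ∂μ) = ∫ a, Q (f a) ∂μ := (Q.integral_comp_comm hi).symm
    change Q (∫ a, f a ∂μ) = 0
    rw [h1]
    refine integral_eq_zero_of_ae ?_
    filter_upwards [hf] with a ha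
    exact (Submodule.Quotient.mk_eq_zero S).2 ha
  · rw [integral_undef hi]; exact S.zero_mem
omit hT hC ha hTb in
lemma exp_small (K : ℝ) (hK : 0 ≤ K) : ∃ l : ℝ, 0 < l ∧ ∀ t, IntegrableOn (fun r : ℝ => K * (r ^ (-(1/2) : ℝ) * Real.exp (-(l * r)))) (Ioc 0 t)
    ∧ ∫ r in Ioc 0 t, K * (r ^ (-(1/2) : ℝ) * Real.exp (-(l * r))) ≤ 1 / 2 := by
  have hG := Real.Gamma_pos_of_pos (show (0:ℝ) < 1/2 by norm_num)
  set g := Real.Gamma (1/2)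
  refine ⟨(2 * K * g + 1) ^ 2, by positivity, fun t => ?_⟩
  set l := (2 * K * g + 1) ^ 2
  have hl : 0 < l := by positivity
  have h1 := Real.integral_rpow_mul_exp_neg_mul_Ioi (show (0:ℝ) < 1/2 by norm_num) hl
  have h2 : IntegrableOn (fun r : ℝ => r ^ (-(1/2) : ℝ) * Real.exp (-(l * r))) (Ioi 0) := by
    have := integrableOn_rpow_mul_exp_neg_mul_rpow (s := -(1/2)) (p := 1) (by norm_num) one_pos hl
    simpa using this
  rw [show (1 / 2 - 1 : ℝ) = -(1/2) by norm_num] at h1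
  refine ⟨(h2.mono_set Ioc_subset_Ioi_self).const_mul K, ?_⟩
  rw [integral_const_mul]
  have h3 : ∫ r in Ioc 0 t, r ^ (-(1/2) : ℝ) * Real.exp (-(l * r)) ≤ (1 / l) ^ (1/2 : ℝ) * g := by
    rw [← h1]
    refine setIntegral_mono_set h2 ?_ Ioc_subset_Ioi_self.eventuallyLE
    filter_upwards [ae_restrict_mem measurableSet_Ioi] with r hr
    have : (0:ℝ) < r := hr
    simp only [Pi.zero_apply]; positivity
  have h4 : (1 / l) ^ (1/2 : ℝ) = (2 * K * g + 1)⁻¹ := by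
    rw [← Real.sqrt_eq_rpow, Real.sqrt_div (by norm_num), Real.sqrt_one, Real.sqrt_sq (by positivity), one_div]
  rw [h4] at h3
  calc _ ≤ K * ((2 * K * g + 1)⁻¹ * g) := by gcongr
    _ ≤ _ := by
      rw [show K * ((2 * K * g + 1)⁻¹ * g) = (K * g) / (2 * K * g + 1) by field_simp,
        div_le_iff₀ (by positivity)]
      linarith
omit hT hC ha hTb in
lemma gronwall (K L : ℝ) (hK : 0 ≤ K) : ∃ M, 0 ≤ M ∧ ∀ a, 0 ≤ a → ∀ y : ℝ → ℝ, ContinuousOn y (Icc 0 L) →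
    (∀ t ∈ Icc 0 L, 0 ≤ y t) →
    (∀ t ∈ Icc 0 L, y t ≤ a + ∫ r in Ioc 0 t, K * r ^ (-(1/2) : ℝ) * y (t - r)) →
    ∀ t ∈ Icc 0 L, y t ≤ M * a := by
  obtain ⟨l, hl, h⟩ := exp_small K hK
  refine ⟨2 * Real.exp (l * L), by positivity, fun a ha y hy hy0 hle t ht => ?_⟩
  obtain ⟨s, hs, hmax⟩ := isCompact_Icc.exists_isMaxOn (s := Icc 0 L) ⟨t, ht⟩
    (f := fun t => Real.exp (-(l * t)) * y t) (by fun_prop)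
  set S := Real.exp (-(l * s)) * y s
  have hS0 : 0 ≤ S := by have := hy0 s hs; positivity
  have hi : ∀ r ∈ Ioc 0 s, K * r ^ (-(1/2) : ℝ) * y (s - r) ≤
      Real.exp (l * s) * S * (K * (r ^ (-(1/2) : ℝ) * Real.exp (-(l * r)))) := by
    intro r hr
    have h0 : s - r ∈ Icc 0 L := ⟨by linarith [hr.2], by linarith [hr.1, hs.2]⟩
    have h1 : Real.exp (-(l * (s - r))) * y (s - r) ≤ S := hmax h0
    have h2 : y (s - r) ≤ Real.exp (l * (s - r)) * S := by
      rw [Real.exp_neg, inv_mul_le_iff₀ (Real.exp_pos _)] at h1; exact h1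
    have h3 : Real.exp (l * (s - r)) = Real.exp (l * s) * Real.exp (-(l * r)) := by
      rw [← Real.exp_add]; ring_nf
    rw [h3] at h2
    have : 0 ≤ r ^ (-(1/2) : ℝ) := Real.rpow_nonneg hr.1.le _
    calc _ ≤ K * r ^ (-(1/2) : ℝ) * (Real.exp (l * s) * Real.exp (-(l * r)) * S) := by gcongr
      _ = _ := by ring
  have hint : ∫ r in Ioc 0 s, K * r ^ (-(1/2) : ℝ) * y (s - r) ≤
      ∫ r in Ioc 0 s, Real.exp (l * s) * S * (K * (r ^ (-(1/2) : ℝ) * Real.exp (-(l * r)))) := by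
    refine setIntegral_mono_on ?_ ((h s).1.const_mul _) measurableSet_Ioc hi
    refine ((h s).1.const_mul (Real.exp (l * s) * S)).mono' ?_ ?_
    · refine ContinuousOn.aestronglyMeasurable ?_ measurableSet_Ioc
      refine ContinuousOn.mul (continuousOn_const.mul fun r hr =>
        (Real.continuousAt_rpow_const _ _ (Or.inl hr.1.ne')).continuousWithinAt) ?_
      exact hy.comp (by fun_prop) fun r hr => ⟨by linarith [hr.2], by linarith [hr.1, hs.2]⟩
    · filter_upwards [ae_restrict_mem measurableSet_Ioc] with r hr
      have h0 : s - r ∈ Icc 0 L := ⟨by linarith [hr.2], by linarith [hr.1, hs.2]⟩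
      have : 0 ≤ r ^ (-(1/2) : ℝ) := Real.rpow_nonneg hr.1.le _
      rw [Real.norm_of_nonneg (by have := hy0 _ h0; positivity)]
      exact hi r hr
  rw [integral_const_mul] at hint
  have h5 : y s ≤ a + Real.exp (l * s) * S * (1 / 2) := (hle s hs).trans (by
    gcongr
    exact hint.trans (by gcongr; exact (h s).2))
  have h6 : y s = Real.exp (l * s) * S := by
    simp only [S]; rw [← mul_assoc, ← Real.exp_add, add_neg_cancel, Real.exp_zero, one_mul]
  have h7 : S ≤ 2 * a := by
    have : 1 ≤ Real.exp (l * s) := Real.one_le_exp (mul_nonneg hl.le hs.1)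
    nlinarith
  have h8 : Real.exp (-(l * t)) * y t ≤ S := hmax ht
  rw [Real.exp_neg, inv_mul_le_iff₀ (Real.exp_pos _)] at h8
  calc y t ≤ Real.exp (l * t) * S := h8
    _ ≤ Real.exp (l * L) * (2 * a) := by
      gcongr; exact ht.2
    _ = _ := by ring
omit hT hC ha hTb in
lemma norm_set_le {f : ℝ → Y} {t : ℝ} {k : ℝ → ℝ} (hk : IntegrableOn k (Ioc 0 t))
    (h : ∀ r ∈ Ioc 0 t, ‖f r‖ ≤ k r) : ‖∫ r in Ioc 0 t, f r‖ ≤ ∫ r in Ioc 0 t, k r :=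
  norm_integral_le_of_norm_le hk ((ae_restrict_mem measurableSet_Ioc).mono h)
omit ha hTb in
theorem mild_exists (hTb : ∀ r, 0 < r → ∀ f, ‖T r f‖ ≤ C * r ^ (-(1/2) : ℝ) * ‖f‖)
    {N : Y → X} {K : ℝ} (hK : 0 ≤ K) (hN : ∀ a b, ‖N a - N b‖ ≤ K * ‖a - b‖)
    {U0 : ℝ → Y} (hU0 : Continuous U0) (S : Submodule ℝ Y) (hS : IsClosed (S : Set Y))
    (hUS : ∀ t, U0 t ∈ S) (SX : Set X) (hNS : ∀ z ∈ S, N z ∈ SX)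
    (hTS : ∀ r, 0 < r → ∀ f ∈ SX, T r f ∈ S) {L : ℝ} (hL : 0 ≤ L) :
    ∃ u : ℝ → Y, Continuous u ∧ (∀ t, u t ∈ S) ∧
      ∀ t ∈ Icc 0 L, u t = U0 t + cvT T (fun s => N (u s)) t := by
  obtain ⟨l, hl, h⟩ := exp_small (C * K) (by positivity)
  have hNc : Continuous N := (LipschitzWith.of_dist_le_mul (K := K.toNNReal) fun a b => by
    rw [dist_eq_norm, dist_eq_norm, Real.coe_toNNReal _ hK]; exact hN a b).continuous
  let τ : ℝ → Icc 0 L := projIcc 0 L hL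
  have hτ : Continuous τ := continuous_projIcc
  let ext : C(Icc 0 L, Y) → ℝ → Y := fun v s => Real.exp (l * τ s) • v (τ s)
  have hext : ∀ v, Continuous (ext v) := fun v => by
    have := v.continuous; fun_prop
  have hg : ∀ v, Continuous fun s => N (ext v s) := fun v => hNc.comp (hext v)
  have ha : (-1 : ℝ) < -(1/2) := by norm_num
  let Φ : C(Icc 0 L, Y) → C(Icc 0 L, Y) := fun v =>
    ⟨fun t => Real.exp (-(l * t)) • (U0 t + cvT T (fun s => N (ext v s)) t), by
      have := cvT_cont hT hC ha hTb (hg v); fun_prop⟩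
  have hΦ : LipschitzWith (1/2) Φ := by
    refine LipschitzWith.of_dist_le_mul fun v w => ?_
    rw [ContinuousMap.dist_le (by positivity)]
    intro t
    have h1 : Φ v t - Φ w t = Real.exp (-(l * t)) • ∫ r in Ioc 0 (t : ℝ),
        (T r (N (ext v (t - r))) - T r (N (ext w (t - r)))) := by
      rw [integral_sub (cvT_int hT hC ha hTb (hg v) t) (cvT_int hT hC ha hTb (hg w) t)]
      simp only [Φ, ContinuousMap.coe_mk, cvT]
      rw [← smul_sub, add_sub_add_left_eq_sub]
    rw [dist_eq_norm, h1, norm_smul, Real.norm_of_nonneg (Real.exp_pos _).le]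
    have h2 : ‖∫ r in Ioc 0 (t : ℝ), (T r (N (ext v (t - r))) - T r (N (ext w (t - r))))‖ ≤
        ∫ r in Ioc 0 (t : ℝ), Real.exp (l * t) * dist v w * (C * K * (r ^ (-(1/2) : ℝ) * Real.exp (-(l * r)))) := by
      refine norm_set_le ((h t).1.const_mul _) fun r hr => ?_
      have h3 : (τ (t - r) : ℝ) = t - r := by
        rw [show τ (t - r) = projIcc 0 L hL (t - r) from rfl,
          projIcc_of_mem hL (show (t - r : ℝ) ∈ Icc 0 L from ⟨by linarith [hr.2], by linarith [hr.1, t.2.2]⟩)]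
      have h4 : ‖ext v (t - r) - ext w (t - r)‖ ≤ Real.exp (l * (t - r)) * dist v w := by
        simp only [ext]
        rw [← smul_sub, norm_smul, Real.norm_of_nonneg (Real.exp_pos _).le, h3]
        gcongr
        rw [← dist_eq_norm]; exact ContinuousMap.dist_apply_le_dist _
      have h5 : Real.exp (l * (t - r)) = Real.exp (l * t) * Real.exp (-(l * r)) := by
        rw [← Real.exp_add]; ring_nf
      have : 0 ≤ r ^ (-(1/2) : ℝ) := Real.rpow_nonneg hr.1.le _
      rw [← map_sub]
      calc _ ≤ C * r ^ (-(1/2) : ℝ) * ‖N (ext v (t - r)) - N (ext w (t - r))‖ := hTb r hr.1 _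
        _ ≤ C * r ^ (-(1/2) : ℝ) * (K * (Real.exp (l * (t - r)) * dist v w)) := by
          gcongr; exact (hN _ _).trans (by gcongr)
        _ = _ := by rw [h5]; ring
    rw [integral_const_mul] at h2
    calc _ ≤ Real.exp (-(l * t)) * (Real.exp (l * t) * dist v w * (1/2)) := by
          gcongr; exact h2.trans (by gcongr; exact (h t).2)
      _ = (Real.exp (-(l * t)) * Real.exp (l * t)) * ((1/2) * dist v w) := by ring
      _ = _ := by rw [← Real.exp_add, neg_add_cancel, Real.exp_zero, one_mul]; norm_num
  let s : Set C(Icc 0 L, Y) := {v | ∀ t, v t ∈ S}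
  have hs : IsClosed s := by
    have : s = ⋂ t, (fun v : C(Icc 0 L, Y) => v t) ⁻¹' (S : Set Y) := by ext v; simp [s]
    rw [this]
    exact isClosed_iInter fun t => hS.preimage (by fun_prop)
  have hms : MapsTo Φ s s := by
    intro v hv t
    refine S.smul_mem _ (S.add_mem (hUS _) (sub_integral_mem S hS ?_))
    filter_upwards [ae_restrict_mem measurableSet_Ioc] with r hr
    exact hTS r hr.1 _ (hNS _ (S.smul_mem _ (hv _)))
  obtain ⟨v, hvs, hv, -⟩ := ContractingWith.exists_fixedPoint' (K := 1/2) hs.isComplete hms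
    ⟨by rw [← NNReal.coe_lt_coe]; norm_num, fun a b => hΦ a b⟩ (x := 0) (fun t => S.zero_mem) (edist_ne_top _ _)
  refine ⟨ext v, hext v, fun t => S.smul_mem _ (hvs _), fun t ht => ?_⟩
  have h1 : Φ v ⟨t, ht⟩ = v ⟨t, ht⟩ := by rw [hv]
  have h2 : τ t = ⟨t, ht⟩ := projIcc_of_mem hL ht
  change Real.exp (l * τ t) • v (τ t) = _
  rw [h2, ← h1]
  change Real.exp (l * t) • (Real.exp (-(l * t)) • (U0 t + cvT T (fun s => N (ext v s)) t)) = _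
  rw [smul_smul, ← Real.exp_add, add_neg_cancel, Real.exp_zero, one_smul]
end vol
end FP
end
noncomputable section
namespace FP
open scoped Topology BoundedContinuousFunction
set_option linter.unusedSectionVars false
set_option maxSynthPendingDepth 3
open GS
attribute [local irreducible] P D
variable {E : Type} [NormedAddCommGroup E] [NormedSpace ℝ E] [MeasurableSpace E] [BorelSpace E]
  [SecondCountableTopology E] [GS E]
  {F : Type} [NormedAddCommGroup F] [NormedSpace ℝ F] [CompleteSpace F]
def Per (Λ : Set E) (f : E → F) : Prop := ∀ k ∈ Λ, ∀ x, f (x + k) = f x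
structure NL (κ : ℝ) (Λ : Set E) (N : (E →ᵇ ℝ) × (E →ᵇ (E →L[ℝ] ℝ)) → (E →ᵇ ℝ)) : Prop where
  lip : ∀ R, ∃ K, 0 ≤ K ∧ ∀ a b, ‖a‖ ≤ R → ‖b‖ ≤ R → ‖N a - N b‖ ≤ K * ‖a - b‖
  sm : ∀ L, ∃ C, 0 ≤ C ∧ ∀ f f', D1 f f' → ∀ r ∈ Ioc 0 L,
    ‖H κ r (N (f, f'))‖ ≤ C * r ^ (-(1/2) : ℝ) * (1 + ‖f‖)
  gr : ∀ R, ∃ C, 0 ≤ C ∧ ∀ f f', D1 f f' → ‖f‖ ≤ R → ‖N (f, f')‖ ≤ C * (1 + ‖f'‖)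
  per : ∀ f f', D1 f f' → Per Λ f → Per Λ f' → Per Λ (N (f, f'))
  hol : ∀ R K, ∃ K', 0 ≤ K' ∧ ∀ i f f', D1 f f' → ‖f‖ ≤ R → ‖f'‖ ≤ R → Hol (e i) K f' →
    Hol (e i) K' (N (f, f'))
lemma D1.uc {f : E →ᵇ F} {f'} (h : D1 f f') : UniformContinuous f := by
  refine (LipschitzWith.of_dist_le_mul (K := ‖f'‖.toNNReal) fun a b => ?_).uniformContinuous
  rw [dist_eq_norm, dist_eq_norm, Real.coe_toNNReal _ (norm_nonneg _)]; exact norm_sub_le h a b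
def eta (R x : ℝ) : ℝ := max 0 (min 1 (R + 1 - x))
lemma eta_nonneg (R x : ℝ) : 0 ≤ eta R x := le_max_left _ _
lemma eta_le (R x : ℝ) : eta R x ≤ 1 := max_le zero_le_one (min_le_left _ _)
lemma eta_one {R x : ℝ} (h : x ≤ R) : eta R x = 1 := by
  rw [eta, min_eq_left (by linarith), max_eq_right zero_le_one]
lemma eta_zero {R x : ℝ} (h : R + 1 ≤ x) : eta R x = 0 := by
  rw [eta, max_eq_left ((min_le_right _ _).trans (by linarith))]
lemma eta_lip (R x y : ℝ) : |eta R x - eta R y| ≤ |x - y| := by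
  rw [eta, eta]
  refine (abs_max_sub_max_le_max _ _ _ _).trans (max_le (by simp) ?_)
  refine (abs_min_sub_min_le_max _ _ _ _).trans (max_le (by simp) ?_)
  rw [show R + 1 - x - (R + 1 - y) = -(x - y) by ring, abs_neg]
lemma trunc_lip {X Y : Type} [NormedAddCommGroup X] [NormedSpace ℝ X] [NormedAddCommGroup Y]
    {N : Y → X} {R K : ℝ} (hK : 0 ≤ K) (hR : 0 ≤ R)
    (h : ∀ a b, ‖a‖ ≤ R + 2 → ‖b‖ ≤ R + 2 → ‖N a - N b‖ ≤ K * ‖a - b‖) :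
    ∃ K', 0 ≤ K' ∧ ∀ a b, ‖eta R ‖a‖ • N a - eta R ‖b‖ • N b‖ ≤ K' * ‖a - b‖ := by
  set M := ‖N 0‖ + K * (R + 2)
  have hM0 : 0 ≤ M := by positivity
  have hM : ∀ a, ‖a‖ ≤ R + 2 → ‖N a‖ ≤ M := fun a ha => by
    have := h a 0 ha (by simpa using by linarith)
    rw [sub_zero] at this
    calc ‖N a‖ = ‖N 0 + (N a - N 0)‖ := by congr 1; abel
      _ ≤ ‖N 0‖ + ‖N a - N 0‖ := norm_add_le _ _
      _ ≤ ‖N 0‖ + K * (R + 2) := by gcongr; exact this.trans (by gcongr)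
  have key : ∀ a b, ‖a‖ ≤ R + 1 → ‖eta R ‖a‖ • N a - eta R ‖b‖ • N b‖ ≤ (K + M) * ‖a - b‖ := by
    intro a b ha
    by_cases hb : ‖b‖ ≤ R + 2
    · have e : eta R ‖a‖ • N a - eta R ‖b‖ • N b =
          eta R ‖a‖ • (N a - N b) + (eta R ‖a‖ - eta R ‖b‖) • N b := by module
      rw [e]
      have h1 := (eta_lip R ‖a‖ ‖b‖).trans (abs_norm_sub_norm_le a b)
      have h2 := h a b (by linarith) hb
      have h3 := hM b hb
      calc _ ≤ eta R ‖a‖ * ‖N a - N b‖ + |eta R ‖a‖ - eta R ‖b‖| * ‖N b‖ := by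
            refine (norm_add_le _ _).trans ?_
            rw [norm_smul, norm_smul, Real.norm_of_nonneg (eta_nonneg _ _), Real.norm_eq_abs]
        _ ≤ 1 * (K * ‖a - b‖) + ‖a - b‖ * M := by
            gcongr; exact eta_le _ _
        _ = _ := by ring
    · push Not at hb
      rw [eta_zero (x := ‖b‖) (by linarith), zero_smul, sub_zero, norm_smul,
        Real.norm_of_nonneg (eta_nonneg _ _)]
      have h1 : 1 ≤ ‖a - b‖ := by
        have := norm_sub_norm_le b a
        rw [norm_sub_rev] at this; linarith
      calc _ ≤ 1 * M := by
            gcongr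
            · exact eta_le _ _
            · exact hM a (by linarith)
        _ ≤ (K + M) * 1 := by linarith
        _ ≤ _ := by gcongr
  refine ⟨K + M, by positivity, fun a b => ?_⟩
  by_cases ha : ‖a‖ ≤ R + 1
  · exact key a b ha
  · by_cases hb : ‖b‖ ≤ R + 1
    · rw [norm_sub_rev, norm_sub_rev a b]; exact key b a hb
    · push Not at ha hb
      rw [eta_zero ha.le, eta_zero hb.le]; simp; positivity
def SD (Λ : Set E) : Submodule ℝ ((E →ᵇ ℝ) × (E →ᵇ (E →L[ℝ] ℝ))) where
  carrier := {z | D1 z.1 z.2 ∧ Per Λ z.1 ∧ Per Λ z.2}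
  add_mem' {a b} ha hb := ⟨fun x => (ha.1 x).add (hb.1 x),
    fun k hk x => by simp [ha.2.1 k hk x, hb.2.1 k hk x],
    fun k hk x => by simp [ha.2.2 k hk x, hb.2.2 k hk x]⟩
  zero_mem' := ⟨fun x => hasFDerivAt_const (0 : ℝ) x, fun _ _ _ => rfl, fun _ _ _ => rfl⟩
  smul_mem' c a ha := ⟨fun x => (ha.1 x).const_smul c,
    fun k hk x => by simp [ha.2.1 k hk x], fun k hk x => by simp [ha.2.2 k hk x]⟩
lemma D1_closed {f : ℕ → E →ᵇ F} {f' : ℕ → E →ᵇ (E →L[ℝ] F)} {g g'} (h : ∀ n, D1 (f n) (f' n))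
    (hf : Tendsto f atTop (𝓝 g)) (hf' : Tendsto f' atTop (𝓝 g')) : D1 g g' :=
  hasFDerivAt_of_tendstoUniformly (BoundedContinuousFunction.tendsto_iff_tendstoUniformly.1 hf')
    (fun n x => h n x)
    (fun x => (BoundedContinuousFunction.tendsto_iff_tendstoUniformly.1 hf).tendsto_at x)
lemma Per_closed {Λ : Set E} {f : ℕ → E →ᵇ F} {g} (h : ∀ n, Per Λ (f n))
    (hf : Tendsto f atTop (𝓝 g)) : Per Λ g := fun k hk x => by
  have hu := BoundedContinuousFunction.tendsto_iff_tendstoUniformly.1 hf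
  exact tendsto_nhds_unique (hu.tendsto_at (x + k)) (by
    simpa only [h _ k hk x] using hu.tendsto_at x)
lemma SD_closed (Λ : Set E) : IsClosed (SD Λ : Set ((E →ᵇ ℝ) × (E →ᵇ (E →L[ℝ] ℝ)))) := by
  refine IsSeqClosed.isClosed fun z w hz hw => ?_
  have h1 := (continuous_fst.tendsto w).comp hw
  have h2 := (continuous_snd.tendsto w).comp hw
  exact ⟨D1_closed (fun n => (hz n).1) h1 h2, Per_closed (fun n => (hz n).2.1) h1,
    Per_closed (fun n => (hz n).2.2) h2⟩
lemma Per.H {Λ : Set E} {f : E →ᵇ F} (h : Per Λ f) (κ r : ℝ) : Per Λ (H κ r f) := fun k hk x => by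
  simp only [FP.H, P_apply]
  congr 1; ext z
  rw [show x + k + Real.sqrt (2 * κ * r) • z = x + Real.sqrt (2 * κ * r) • z + k by abel, h k hk]
lemma Per.HD {Λ : Set E} {f : E →ᵇ F} (h : Per Λ f) (κ r : ℝ) : Per Λ (HD κ r f) := fun k hk x => by
  ext v
  simp only [FP.HD, D_apply]
  congr 2; ext z
  rw [show x + k + Real.sqrt (2 * κ * r) • z = x + Real.sqrt (2 * κ * r) • z + k by abel, h k hk]
lemma cont_H_uc {κ : ℝ} (hκ : 0 < κ) {f : E →ᵇ F} (hf : UniformContinuous f) :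
    Continuous fun t => H κ t f := by
  rw [continuous_iff_continuousAt]
  intro t
  rcases lt_or_ge 0 t with ht | ht
  · have := (cont_H (E := E) (F := F) hκ).continuousAt (Ioi_mem_nhds ht)
    exact this.clm_apply continuousAt_const
  · have e : Real.sqrt (2 * κ * t) = 0 := Real.sqrt_eq_zero_of_nonpos (by nlinarith)
    have h1 : ContinuousAt (fun s => P s f) (Real.sqrt (2 * κ * t)) := by
      rw [e, ContinuousAt, P_zero]; exact P_tendsto hf
    have h2 : ContinuousAt (fun t => Real.sqrt (2 * κ * t)) t := by fun_prop
    exact ContinuousAt.comp (f := fun t => Real.sqrt (2 * κ * t)) (g := fun s => P s f) h1 h2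
theorem mild_sol {κ : ℝ} (hκ : 0 < κ) {Λ : Set E} {N} (hN : NL κ Λ N) {u0 : E →ᵇ ℝ} {u0'}
    (h0 : D1 u0 u0') (hp : Per Λ u0) (hp' : Per Λ u0') (huc : UniformContinuous u0') {L : ℝ} (hL : 0 ≤ L) :
    ∃ (u : ℝ → E →ᵇ ℝ) (u' : ℝ → E →ᵇ (E →L[ℝ] ℝ)), Continuous u ∧ Continuous u' ∧
      (∀ t, D1 (u t) (u' t) ∧ Per Λ (u t) ∧ Per Λ (u' t)) ∧ (Continuous fun s => N (u s, u' s)) ∧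
      ∀ t ∈ Icc 0 L, u t = H κ t u0 + cvT (H κ) (fun s => N (u s, u' s)) t ∧
        u' t = H κ t u0' + cvT (HD κ) (fun s => N (u s, u' s)) t := by
  obtain ⟨C, hC, hCb⟩ := HD_bound (E := E) (F := ℝ) hκ
  obtain ⟨C0, hC0, hsm⟩ := hN.sm L
  obtain ⟨M1, hM1, hg1⟩ := gronwall C0 L hC0
  set R1 := M1 * (1 + ‖u0‖)
  obtain ⟨C1, hC1, hgr⟩ := hN.gr R1
  obtain ⟨M2, hM2, hg2⟩ := gronwall (C * C1) L (by positivity)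
  set R2 := M2 * (1 + ‖u0'‖)
  set R := max R1 R2
  have hR : 0 ≤ R := le_max_of_le_left (by positivity)
  obtain ⟨K0, hK0, hlip⟩ := hN.lip (R + 2)
  obtain ⟨K, hK, hNK⟩ := trunc_lip hK0 hR hlip
  let w : ℝ → ℝ := fun r => min 1 ((L + 1) / r)
  have hw0 : ∀ r, 0 < r → 0 ≤ w r := fun r hr => le_min zero_le_one (by positivity)
  have hwr : ∀ r, 0 < r → w r ≤ (L + 1) * r ^ (-(1/2) : ℝ) := fun r hr => by
    rcases le_total r 1 with h | h
    · have h3 : 1 ≤ r ^ (-(1/2) : ℝ) := Real.one_le_rpow_of_pos_of_le_one_of_nonpos hr h (by norm_num)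
      exact (min_le_left _ _).trans (by nlinarith)
    · have h3 : r ^ (-1 : ℝ) ≤ r ^ (-(1/2) : ℝ) := Real.rpow_le_rpow_of_exponent_le h (by norm_num)
      refine (min_le_right _ _).trans ?_
      rw [Real.rpow_neg_one] at h3
      rw [div_eq_mul_inv]; gcongr
  have hw1 : ∀ t ∈ Icc 0 L, ∀ r ∈ Ioc 0 t, w r = 1 := fun t ht r hr => by
    refine min_eq_left ?_
    rw [le_div_iff₀ hr.1]; linarith [hr.2, ht.2]
  let T : ℝ → (E →ᵇ ℝ) →L[ℝ] (E →ᵇ ℝ) × (E →ᵇ (E →L[ℝ] ℝ)) := fun r => w r • (H κ r).prod (HD κ r)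
  have hT : ContinuousOn T (Ioi 0) := by
    have : T = fun r => w r • ContinuousLinearMap.prodₗᵢ ℝ (H κ r, HD κ r) := rfl
    rw [this]
    refine ContinuousOn.smul (ContinuousOn.inf continuousOn_const (continuousOn_const.div continuousOn_id
      fun r hr => ne_of_gt hr)) ?_
    exact (LinearIsometryEquiv.continuous _).comp_continuousOn ((cont_H hκ).prodMk (cont_HD hκ))
  have hTb : ∀ r, 0 < r → ∀ f, ‖T r f‖ ≤ (L + 1 + C) * r ^ (-(1/2) : ℝ) * ‖f‖ := fun r hr f => by
    have e : T r f = (w r • H κ r f, w r • HD κ r f) := rfl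
    have hr' := Real.rpow_nonneg hr.le (-(1/2) : ℝ)
    have hn := norm_nonneg f
    rw [e]
    refine (Prod.norm_def _).trans_le (max_le ?_ ?_) <;> dsimp only <;>
      rw [norm_smul, Real.norm_of_nonneg (hw0 r hr)]
    · calc _ ≤ ((L + 1) * r ^ (-(1/2) : ℝ)) * ‖f‖ :=
            mul_le_mul (hwr r hr) (H_norm_le r f) (norm_nonneg _) (by positivity)
        _ ≤ _ := by
            refine mul_le_mul_of_nonneg_right (mul_le_mul_of_nonneg_right ?_ hr') hn; linarith
    · calc _ ≤ 1 * (C * r ^ (-(1/2) : ℝ) * ‖f‖) :=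
            mul_le_mul (min_le_left _ _) (hCb r hr f) (norm_nonneg _) zero_le_one
        _ ≤ _ := by rw [one_mul]; gcongr; linarith
  obtain ⟨z, hzc, hzS, hz⟩ := mild_exists hT (by positivity) hTb hK hNK
    (U0 := fun t => (H κ t u0, H κ t u0')) ((cont_H_uc hκ h0.uc).prodMk (cont_H_uc hκ huc))
    (SD Λ) (SD_closed Λ) (fun t => ⟨h0.H t, hp.H κ t, hp'.H κ t⟩) {g | Per Λ g}
    (fun a ha k hk x => by
      simp only [BoundedContinuousFunction.coe_smul, hN.per a.1 a.2 ha.1 ha.2.1 ha.2.2 k hk x])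
    (fun r hr f hf => (SD Λ).smul_mem _ ⟨D1_H hκ hr f, hf.H κ r, hf.HD κ r⟩) hL
  set g : ℝ → E →ᵇ ℝ := fun s => eta R ‖z s‖ • N (z s) with hg
  have hgc : Continuous g := by
    have := (LipschitzWith.of_dist_le_mul (K := K.toNNReal) (f := fun y => eta R ‖y‖ • N y) fun a b => by
      rw [dist_eq_norm, dist_eq_norm, Real.coe_toNNReal _ hK]; exact hNK a b).continuous
    exact this.comp hzc
  have hint := fun t => cvT_int hT (by positivity) (by norm_num) hTb hgc t
  have hz1 : ∀ t ∈ Icc 0 L, (z t).1 = H κ t u0 + cvT (H κ) g t := fun t ht => by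
    rw [hz t ht, Prod.fst_add]; congr 1
    rw [cvT, fst_integral (hint t)]
    exact setIntegral_congr_fun measurableSet_Ioc fun r hr => by
      change w r • H κ r (g (t - r)) = _; rw [hw1 t ht r hr, one_smul]
  have hz2 : ∀ t ∈ Icc 0 L, (z t).2 = H κ t u0' + cvT (HD κ) g t := fun t ht => by
    rw [hz t ht, Prod.snd_add]; congr 1
    rw [cvT, snd_integral (hint t)]
    exact setIntegral_congr_fun measurableSet_Ioc fun r hr => by
      change w r • HD κ r (g (t - r)) = _; rw [hw1 t ht r hr, one_smul]
  have hki : ∀ (c : ℝ) (y : ℝ → ℝ), Continuous y → ∀ t,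
      IntegrableOn (fun r => c * r ^ (-(1/2) : ℝ) * y (t - r)) (Ioc 0 t) := fun c y hy t => by
    rcases le_or_gt t 0 with h | h
    · rw [Ioc_eq_empty (not_lt.2 h)]; exact integrableOn_empty
    · have := ((intervalIntegrable_iff_integrableOn_Ioc_of_le h.le).2
        (int_rpow c (by norm_num : (-1:ℝ) < -(1/2)) t)).mul_continuousOn (g := fun r => y (t - r))
        (by fun_prop)
      exact (intervalIntegrable_iff_integrableOn_Ioc_of_le h.le).1 this
  have hb1 : ∀ t ∈ Icc 0 L, 1 + ‖(z t).1‖ ≤ R1 := by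
    refine hg1 (1 + ‖u0‖) (by positivity) (fun t => 1 + ‖(z t).1‖) (by fun_prop)
      (fun t _ => by positivity) fun t ht => ?_
    rw [hz1 t ht, add_assoc]
    refine add_le_add_right ((norm_add_le _ _).trans (add_le_add (H_norm_le _ _) ?_)) 1
    refine norm_set_le (hki C0 (fun t => 1 + ‖(z t).1‖) (by fun_prop) t) fun r hr => ?_
    rw [hg]; simp only [map_smul, norm_smul, Real.norm_of_nonneg (eta_nonneg _ _)]
    have := hsm (z (t - r)).1 (z (t - r)).2 (hzS _).1 r ⟨hr.1, hr.2.trans ht.2⟩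
    calc _ ≤ 1 * _ := mul_le_mul (eta_le _ _) this (norm_nonneg _) zero_le_one
      _ = _ := by rw [one_mul]
  have hb2 : ∀ t ∈ Icc 0 L, 1 + ‖(z t).2‖ ≤ R2 := by
    refine hg2 (1 + ‖u0'‖) (by positivity) (fun t => 1 + ‖(z t).2‖) (by fun_prop)
      (fun t _ => by positivity) fun t ht => ?_
    rw [hz2 t ht, add_assoc]
    refine add_le_add_right ((norm_add_le _ _).trans (add_le_add (H_norm_le _ _) ?_)) 1
    refine norm_set_le (hki (C * C1) (fun t => 1 + ‖(z t).2‖) (by fun_prop) t) fun r hr => ?_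
    have h5 := hgr (z (t - r)).1 (z (t - r)).2 (hzS _).1
      (by linarith [hb1 (t - r) ⟨by linarith [hr.2], by linarith [hr.1, ht.2]⟩])
    have h6 : ‖g (t - r)‖ ≤ C1 * (1 + ‖(z (t - r)).2‖) := by
      rw [hg]; simp only [norm_smul, Real.norm_of_nonneg (eta_nonneg _ _)]
      calc _ ≤ 1 * _ := mul_le_mul (eta_le _ _) h5 (norm_nonneg _) zero_le_one
        _ = _ := by rw [one_mul]
    refine (hCb r hr.1 _).trans ?_
    have hr' := Real.rpow_nonneg hr.1.le (-(1/2) : ℝ)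
    calc _ ≤ C * r ^ (-(1/2) : ℝ) * (C1 * (1 + ‖(z (t - r)).2‖)) := by gcongr
      _ = _ := by ring
  have hgN : ∀ t ∈ Icc 0 L, g t = N (z t) := fun t ht => by
    have : ‖z t‖ ≤ R := (Prod.norm_def _).trans_le (max_le
      (le_max_of_le_left (by linarith [hb1 t ht])) (le_max_of_le_right (by linarith [hb2 t ht])))
    simp only [hg, eta_one this, one_smul]
  let τ : ℝ → ℝ := fun t => projIcc 0 L hL t
  have hτ : Continuous τ := continuous_subtype_val.comp continuous_projIcc
  have hτm : ∀ t, τ t ∈ Icc 0 L := fun t => (projIcc 0 L hL t).2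
  have hτe : ∀ t ∈ Icc 0 L, τ t = t := fun t ht => by simp only [τ, projIcc_of_mem hL ht]
  have hcv : ∀ {Y : Type} [NormedAddCommGroup Y] [NormedSpace ℝ Y] (S : ℝ → (E →ᵇ ℝ) →L[ℝ] Y) (t),
      t ∈ Icc 0 L → cvT S g t = cvT S (fun s => N ((z (τ s)).1, (z (τ s)).2)) t := fun S t ht =>
    setIntegral_congr_fun measurableSet_Ioc fun r hr => by
      have : t - r ∈ Icc 0 L := ⟨by linarith [hr.2], by linarith [hr.1, ht.2]⟩
      simp only [hτe _ this, hgN _ this]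
  refine ⟨fun t => (z (τ t)).1, fun t => (z (τ t)).2, by fun_prop, by fun_prop, fun t => hzS _,
    ?_, fun t ht => ⟨?_, ?_⟩⟩
  · have : (fun s => N ((z (τ s)).1, (z (τ s)).2)) = g ∘ τ := funext fun s => (hgN _ (hτm s)).symm
    rw [this]; exact hgc.comp hτ
  · dsimp only; rw [hτe t ht, hz1 t ht, hcv _ t ht]
  · dsimp only; rw [hτe t ht, hz2 t ht, hcv _ t ht]
end FP
end
noncomputable section
namespace FP
open scoped Topology BoundedContinuousFunction
set_option linter.unusedSectionVars false
set_option maxSynthPendingDepth 3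
open GS
attribute [local irreducible] P D
variable {E : Type} [NormedAddCommGroup E] [NormedSpace ℝ E] [MeasurableSpace E] [BorelSpace E]
  [SecondCountableTopology E] [GS E]
  {F : Type} [NormedAddCommGroup F] [NormedSpace ℝ F] [CompleteSpace F]
lemma restart {κ : ℝ} {S : ℝ → (E →ᵇ ℝ) →L[ℝ] (E →ᵇ F)}
    (hS : ∀ h r, 0 ≤ h → 0 < r → ∀ f, H κ h (S r f) = S (h + r) f) {g : ℝ → E →ᵇ ℝ}
    (hi : ∀ t, IntegrableOn (fun r => S r (g (t - r))) (Ioc 0 t)) {t h : ℝ} (ht : 0 ≤ t) (hh : 0 ≤ h) :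
    cvT S g (t + h) = cvT S (fun s => g (t + s)) h + H κ h (cvT S g t) := by
  have hsub : Ioc 0 (t + h) = Ioc 0 h ∪ Ioc h (t + h) := (Ioc_union_Ioc_eq_Ioc hh (by linarith)).symm
  have hi' := hi (t + h)
  rw [hsub] at hi'
  rw [cvT, hsub, setIntegral_union (Ioc_disjoint_Ioc_of_le le_rfl) measurableSet_Ioc
    (hi'.mono_set subset_union_left) (hi'.mono_set subset_union_right)]
  congr 1
  · simp only [cvT]
    refine setIntegral_congr_fun measurableSet_Ioc fun r _ => ?_
    rw [add_sub_assoc]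
  · rw [cvT, ← (H κ h).integral_comp_comm (hi t), ← intervalIntegral.integral_of_le (by linarith),
      ← intervalIntegral.integral_of_le ht]
    have := intervalIntegral.integral_comp_add_right (a := 0) (b := t)
      (fun r => S r (g (t + h - r))) h
    rw [zero_add] at this
    rw [← this, intervalIntegral.integral_of_le ht, intervalIntegral.integral_of_le ht]
    refine setIntegral_congr_fun measurableSet_Ioc fun r hr => ?_
    rw [hS h r hh hr.1, add_comm h r]; congr 2; ring
structure Sol (κ : ℝ) (Λ : Set E) (N : (E →ᵇ ℝ) × (E →ᵇ (E →L[ℝ] ℝ)) → (E →ᵇ ℝ)) (L : ℝ)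
    (u0 : E →ᵇ ℝ) (u0' : E →ᵇ (E →L[ℝ] ℝ)) (u : ℝ → E →ᵇ ℝ) (u' : ℝ → E →ᵇ (E →L[ℝ] ℝ)) : Prop where
  hκ : 0 < κ
  hN : NL κ Λ N
  cu : Continuous u
  cu' : Continuous u'
  d1 : ∀ t, D1 (u t) (u' t)
  per : ∀ t, Per Λ (u t)
  per' : ∀ t, Per Λ (u' t)
  cg : Continuous fun s => N (u s, u' s)
  h1 : ∀ t ∈ Icc 0 L, u t = H κ t u0 + cvT (H κ) (fun s => N (u s, u' s)) t
  h2 : ∀ t ∈ Icc 0 L, u' t = H κ t u0' + cvT (HD κ) (fun s => N (u s, u' s)) t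
  d0 : D1 u0 u0'
section
variable {κ : ℝ} {Λ : Set E} {N : (E →ᵇ ℝ) × (E →ᵇ (E →L[ℝ] ℝ)) → (E →ᵇ ℝ)} {L : ℝ}
    {u0 : E →ᵇ ℝ} {u0' : E →ᵇ (E →L[ℝ] ℝ)} {u : ℝ → E →ᵇ ℝ} {u' : ℝ → E →ᵇ (E →L[ℝ] ℝ)}
lemma H_int (hκ : 0 < κ) {g : ℝ → E →ᵇ ℝ} (hg : Continuous g) (t : ℝ) :
    IntegrableOn (fun r => H κ r (g (t - r))) (Ioc 0 t) :=
  cvT_int (cont_H hκ) zero_le_one (by norm_num : (-1:ℝ) < 0)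
    (fun r _ f => by rw [Real.rpow_zero, one_mul, one_mul]; exact H_norm_le r f) hg t
lemma HD_int (hκ : 0 < κ) {g : ℝ → E →ᵇ ℝ} (hg : Continuous g) (t : ℝ) :
    IntegrableOn (fun r => HD κ r (g (t - r))) (Ioc 0 t) := by
  obtain ⟨C, hC, hCb⟩ := HD_bound (E := E) (F := ℝ) hκ
  exact cvT_int (cont_HD hκ) hC (by norm_num) hCb hg t
lemma Sol.restart1 (h : Sol κ Λ N L u0 u0' u u') {t r : ℝ} (ht : 0 ≤ t) (hr : 0 ≤ r) (hL : t + r ≤ L) :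
    u (t + r) = H κ r (u t) + cvT (H κ) (fun s => N (u (t + s), u' (t + s))) r := by
  rw [h.h1 _ ⟨by linarith, hL⟩, h.h1 t ⟨ht, by linarith⟩, map_add, H_H h.hκ hr ht, add_comm r t,
    restart (fun a b ha hb f => H_H h.hκ ha hb.le f) (H_int h.hκ h.cg) ht hr]
  abel
lemma Sol.restart2 (h : Sol κ Λ N L u0 u0' u u') {t r : ℝ} (ht : 0 ≤ t) (hr : 0 ≤ r) (hL : t + r ≤ L) :
    u' (t + r) = H κ r (u' t) + cvT (HD κ) (fun s => N (u (t + s), u' (t + s))) r := by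
  rw [h.h2 _ ⟨by linarith, hL⟩, h.h2 t ⟨ht, by linarith⟩, map_add, H_H h.hκ hr ht, add_comm r t,
    restart (fun a b ha hb f => H_HD h.hκ ha hb f) (HD_int h.hκ h.cg) ht hr]
  abel
lemma Sol.bdd (h : Sol κ Λ N L u0 u0' u u') : ∃ G, 0 ≤ G ∧ ∀ s ∈ Icc 0 L,
    ‖N (u s, u' s)‖ ≤ G ∧ ‖u s‖ ≤ G ∧ ‖u' s‖ ≤ G := by
  obtain ⟨a, ha⟩ := isCompact_Icc.exists_bound_of_continuousOn (s := Icc 0 L) h.cg.continuousOn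
  obtain ⟨b, hb⟩ := isCompact_Icc.exists_bound_of_continuousOn (s := Icc 0 L) h.cu.continuousOn
  obtain ⟨c, hc⟩ := isCompact_Icc.exists_bound_of_continuousOn (s := Icc 0 L) h.cu'.continuousOn
  have h1 := le_abs_self a
  have h2 := le_abs_self b
  have h3 := le_abs_self c
  have h4 := abs_nonneg a
  have h5 := abs_nonneg b
  have h6 := abs_nonneg c
  exact ⟨|a| + |b| + |c|, by positivity, fun s hs => ⟨(ha s hs).trans (by linarith),
    (hb s hs).trans (by linarith), (hc s hs).trans (by linarith)⟩⟩
lemma Sol.space (h : Sol κ Λ N L u0 u0' u u') {η : ℝ} (hη : 0 < η) : ∃ K, 0 ≤ K ∧ ∀ t ∈ Icc η L, ∀ x v,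
    ‖u' t (x + v) - u' t x‖ ≤ K * ‖v‖ ^ (1/2 : ℝ) := by
  obtain ⟨G, hG, hb⟩ := h.bdd
  obtain ⟨C, hC, hs⟩ := HD_space (E := E) (F := ℝ) h.hκ
  refine ⟨C * ‖u0‖ * η ^ (-(3/4) : ℝ) + C * G * (4 * |L| ^ (1/4 : ℝ)), by positivity, fun t ht x v => ?_⟩
  have ht0 : 0 < t := hη.trans_le ht.1
  let ev : (E →ᵇ (E →L[ℝ] ℝ)) →L[ℝ] (E →L[ℝ] ℝ) := BoundedContinuousFunction.evalCLM ℝ (x + v) -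
    BoundedContinuousFunction.evalCLM ℝ x
  have e : u' t (x + v) - u' t x = ev (HD κ t u0) +
      ∫ r in Ioc 0 t, ev (HD κ r (N (u (t - r), u' (t - r)))) := by
    rw [ev.integral_comp_comm (HD_int h.hκ h.cg t), HD_eq h.hκ ht0 h.d0, ← map_add,
      show (∫ r in Ioc 0 t, HD κ r (N (u (t - r), u' (t - r)))) =
        cvT (HD κ) (fun s => N (u s, u' s)) t from rfl, ← h.h2 t ⟨ht0.le, ht.2⟩]; rfl
  rw [e]
  have hev : ∀ r, 0 < r → ∀ f, ‖ev (HD κ r f)‖ ≤ C * ‖f‖ * (‖v‖ ^ (1/2 : ℝ) * r ^ (-(3/4) : ℝ)) :=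
    fun r hr f => hs r hr f x v
  have h1 : ‖∫ r in Ioc 0 t, ev (HD κ r (N (u (t - r), u' (t - r))))‖ ≤
      ∫ r in Ioc 0 t, C * G * ‖v‖ ^ (1/2 : ℝ) * r ^ (-(3/4) : ℝ) := by
    refine norm_set_le (int_rpow _ (by norm_num) t) fun r hr => ?_
    refine (hev r hr.1 _).trans ?_
    have h3 := (hb (t - r) ⟨by linarith [hr.2], by linarith [hr.1, ht.2]⟩).1
    have h4 : 0 ≤ ‖v‖ ^ (1/2 : ℝ) * r ^ (-(3/4) : ℝ) :=
      mul_nonneg (by positivity) (Real.rpow_nonneg hr.1.le _)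
    calc _ ≤ C * G * (‖v‖ ^ (1/2 : ℝ) * r ^ (-(3/4) : ℝ)) := by gcongr
      _ = _ := by ring
  rw [integral_const_mul, int_rpow_val (by norm_num) ht0.le] at h1
  have h2 : t ^ (-(3/4) + 1 : ℝ) / (-(3/4) + 1) ≤ 4 * |L| ^ (1/4 : ℝ) := by
    rw [show (-(3/4) + 1 : ℝ) = 1/4 by norm_num]
    have : t ^ (1/4 : ℝ) ≤ |L| ^ (1/4 : ℝ) := by gcongr; exact ht.2.trans (le_abs_self L)
    linarith
  have h5 : t ^ (-(3/4) : ℝ) ≤ η ^ (-(3/4) : ℝ) :=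
    Real.rpow_le_rpow_of_nonpos hη ht.1 (by norm_num)
  calc _ ≤ C * ‖u0‖ * (‖v‖ ^ (1/2 : ℝ) * η ^ (-(3/4) : ℝ)) +
        C * G * ‖v‖ ^ (1/2 : ℝ) * (4 * |L| ^ (1/4 : ℝ)) := by
        refine (norm_add_le _ _).trans (add_le_add ((hev t ht0 _).trans ?_) (h1.trans ?_)) <;> gcongr
    _ = _ := by ring
lemma H_sub_hol {f : E →ᵇ F} {K : ℝ} (hK : 0 ≤ K) (hκ : 0 < κ)
    (hf : ∀ x v, ‖f (x + v) - f x‖ ≤ K * ‖v‖ ^ (1/2 : ℝ)) {r : ℝ} (hr : 0 ≤ r) :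
    ‖H κ r f - f‖ ≤ K * (2 * κ) ^ (1/4 : ℝ) * (1 + m1 E) * r ^ (1/4 : ℝ) := by
  have hm := m1_nonneg (E := E)
  refine (BoundedContinuousFunction.norm_le (by positivity)).2 fun x => ?_
  rw [BoundedContinuousFunction.sub_apply, H, P_apply]
  have hfc := f.continuous
  set s := Real.sqrt (2 * κ * r)
  have hs : s ^ (1/2 : ℝ) = (2 * κ) ^ (1/4 : ℝ) * r ^ (1/4 : ℝ) := by
    rw [← Real.mul_rpow (by positivity) hr]
    simp only [s]
    rw [Real.sqrt_eq_rpow, ← Real.rpow_mul (by positivity)]; norm_num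
  have hi : Integrable (fun z : E => f (x + s • z)) γ := by
    refine integrable_of_le' (by fun_prop) ‖f‖ fun z => ?_
    have := f.norm_coe_le_norm (x + s • z)
    nlinarith [norm_nonneg f, sq_nonneg ‖z‖]
  have e : (∫ z, f (x + s • z) ∂γ) - f x = ∫ z, (f (x + s • z) - f x) ∂γ := by
    rw [integral_sub hi (integrable_const _)]; simp
  rw [e]
  calc _ ≤ ∫ z : E, K * s ^ (1/2 : ℝ) * (1 + ‖z‖) ∂γ := by
        refine norm_integral_le_of_norm_le (((integrable_const _).add integrable_norm_γ).const_mul _)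
          (Eventually.of_forall fun z => ?_)
        refine (hf x (s • z)).trans ?_
        rw [norm_smul, Real.norm_of_nonneg (Real.sqrt_nonneg _),
          Real.mul_rpow (Real.sqrt_nonneg _) (norm_nonneg _), ← mul_assoc]
        have : ‖z‖ ^ (1/2 : ℝ) ≤ 1 + ‖z‖ := by
          calc ‖z‖ ^ (1/2 : ℝ) ≤ (1 + ‖z‖) ^ (1/2 : ℝ) := by gcongr; linarith
            _ ≤ (1 + ‖z‖) ^ (1 : ℝ) := Real.rpow_le_rpow_of_exponent_le
              (by linarith [norm_nonneg z]) (by norm_num)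
            _ = _ := Real.rpow_one _
        gcongr
    _ = _ := by
        rw [integral_const_mul, integral_add (integrable_const _) integrable_norm_γ, hs]
        simp only [integral_const, probReal_univ, one_smul, m1]; ring
lemma Sol.time (h : Sol κ Λ N L u0 u0' u u') {η : ℝ} (hη : 0 < η) : ∃ K, 0 ≤ K ∧ ∀ t ∈ Icc η L, ∀ r,
    0 ≤ r → t + r ≤ L → ‖(u (t + r), u' (t + r)) - (u t, u' t)‖ ≤ K * r ^ (1/4 : ℝ) := by
  have hκ := h.hκ
  obtain ⟨G, hG, hb⟩ := h.bdd
  obtain ⟨K, hK, hs⟩ := h.space hη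
  obtain ⟨C, hC, hCb⟩ := HD_bound (E := E) (F := ℝ) h.hκ
  have hm := m1_nonneg (E := E)
  set K1 := m1 E * Real.sqrt (2 * κ) * G * |L| ^ (1/4 : ℝ) + G * |L| ^ (3/4 : ℝ)
  set K2 := K * (2 * κ) ^ (1/4 : ℝ) * (1 + m1 E) + C * G * 2 * |L| ^ (1/4 : ℝ)
  have hK1 : 0 ≤ K1 := by positivity
  have hK2 : 0 ≤ K2 := by positivity
  refine ⟨K1 + K2, by positivity, fun t ht r hr hL => ?_⟩
  have ht0 : 0 < t := hη.trans_le ht.1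
  have hrL : r ≤ |L| := by linarith [le_abs_self L]
  have hr4 : 0 ≤ r ^ (1/4 : ℝ) := by positivity
  have hp : ∀ a : ℝ, 0 < a → r ^ (1/4 + a) ≤ |L| ^ a * r ^ (1/4 : ℝ) := fun a ha => by
    rw [Real.rpow_add_of_nonneg hr (by norm_num) ha.le, mul_comm]; gcongr
  have hgb : ∀ s ∈ Ioc 0 r, ‖N (u (t + (r - s)), u' (t + (r - s)))‖ ≤ G := fun s hs' =>
    (hb _ ⟨by linarith [hs'.2], by linarith [hs'.1]⟩).1
  rw [Prod.mk_sub_mk]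
  refine (Prod.norm_def _).trans_le (max_le ?_ ?_) <;> dsimp only
  · rw [h.restart1 ht0.le hr hL, add_sub_right_comm]
    have i1 : ‖cvT (H κ) (fun s => N (u (t + s), u' (t + s))) r‖ ≤ G * r := by
      have := norm_set_le (k := fun _ => G) (by simp) fun s hs' =>
        (H_norm_le (κ := κ) s _).trans (hgb s hs')
      rw [cvT]; simpa [hr, mul_comm] using this
    have i2 := H_sub_le (κ := κ) (h := r) (h.d1 t)
    have i3 := (hb t ⟨ht0.le, by linarith⟩).2.2
    have i4 : Real.sqrt (2 * κ * r) = Real.sqrt (2 * κ) * r ^ (1/4 + 1/4 : ℝ) := by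
      rw [Real.sqrt_mul (by positivity), Real.sqrt_eq_rpow r]; norm_num
    have i5 : r ≤ |L| ^ (3/4 : ℝ) * r ^ (1/4 : ℝ) := by
      have := hp (3/4) (by norm_num); norm_num at this; exact this
    calc _ ≤ m1 E * (Real.sqrt (2 * κ) * (|L| ^ (1/4 : ℝ) * r ^ (1/4 : ℝ))) * G +
          G * (|L| ^ (3/4 : ℝ) * r ^ (1/4 : ℝ)) := by
          refine (norm_add_le _ _).trans (add_le_add (i2.trans ?_) (i1.trans ?_))
          · rw [i4]; gcongr; exact hp _ (by norm_num)
          · gcongr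
      _ = K1 * r ^ (1/4 : ℝ) := by ring
      _ ≤ _ := by gcongr; linarith
  · rw [h.restart2 ht0.le hr hL, add_sub_right_comm]
    have i1 : ‖cvT (HD κ) (fun s => N (u (t + s), u' (t + s))) r‖ ≤
        ∫ s in Ioc 0 r, C * G * s ^ (-(1/2) : ℝ) := by
      refine norm_set_le (int_rpow _ (by norm_num) r) fun s hs' => (hCb s hs'.1 _).trans ?_
      have := Real.rpow_nonneg hs'.1.le (-(1/2) : ℝ)
      rw [mul_right_comm]; gcongr; exact hgb s hs'
    rw [integral_const_mul, int_rpow_val (by norm_num) hr] at i1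
    have i2 := H_sub_hol hK hκ (hs t ⟨ht.1, by linarith⟩) hr
    have i3 : r ^ (-(1/2) + 1 : ℝ) / (-(1/2) + 1) ≤ 2 * (|L| ^ (1/4 : ℝ) * r ^ (1/4 : ℝ)) := by
      have := hp (1/4) (by norm_num); norm_num at this ⊢; linarith
    calc _ ≤ K * (2 * κ) ^ (1/4 : ℝ) * (1 + m1 E) * r ^ (1/4 : ℝ) +
          C * G * (2 * (|L| ^ (1/4 : ℝ) * r ^ (1/4 : ℝ))) := by
          refine (norm_add_le _ _).trans (add_le_add i2 (i1.trans ?_)); gcongr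
      _ = K2 * r ^ (1/4 : ℝ) := by ring
      _ ≤ _ := by gcongr; linarith
lemma rp_split {η r : ℝ} (hη : 0 < η) (hr : η ≤ r) : 1 ≤ η ^ (-(1/4) : ℝ) * r ^ (1/4 : ℝ) := by
  rw [Real.rpow_neg hη.le, inv_mul_eq_div, one_le_div (by positivity)]; gcongr
lemma Sol.gtime (h : Sol κ Λ N L u0 u0' u u') {η : ℝ} (hη : 0 < η) : ∃ K, 0 ≤ K ∧ ∀ t ∈ Icc η L,
    ∀ r ∈ Ioc 0 t, ‖N (u (t - r), u' (t - r)) - N (u t, u' t)‖ ≤ K * r ^ (1/4 : ℝ) := by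
  obtain ⟨G, hG, hb⟩ := h.bdd
  obtain ⟨K, hK, hs⟩ := h.time (half_pos hη)
  obtain ⟨K', hK', hl⟩ := h.hN.lip G
  refine ⟨K' * K + 2 * G * (η / 2) ^ (-(1/4) : ℝ), by positivity, fun t ht r hr => ?_⟩
  have ht0 : 0 < t := hη.trans_le ht.1
  have hr4 : 0 ≤ r ^ (1/4 : ℝ) := Real.rpow_nonneg hr.1.le _
  have b1 := hb (t - r) ⟨by linarith [hr.2], by linarith [hr.1, ht.2]⟩
  have b2 := hb t ⟨ht0.le, ht.2⟩
  rw [add_mul]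
  rcases le_total r (η / 2) with h1 | h1
  · have := hs (t - r) ⟨by linarith [ht.1], by linarith [hr.1, ht.2]⟩ r hr.1.le (by linarith [ht.2])
    rw [sub_add_cancel, norm_sub_rev] at this
    have h3 := hl (u (t - r), u' (t - r)) (u t, u' t) (norm_prod_le_iff.2 b1.2) (norm_prod_le_iff.2 b2.2)
    generalize ((u (t - r), u' (t - r)) : (E →ᵇ ℝ) × (E →ᵇ (E →L[ℝ] ℝ))) = a at this h3 ⊢
    generalize ((u t, u' t) : (E →ᵇ ℝ) × (E →ᵇ (E →L[ℝ] ℝ))) = b at this h3 ⊢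
    have h4 : K' * ‖a - b‖ ≤ K' * (K * r ^ (1/4 : ℝ)) := mul_le_mul_of_nonneg_left this hK'
    have h5 : 0 ≤ 2 * G * (η / 2) ^ (-(1/4) : ℝ) * r ^ (1/4 : ℝ) := by positivity
    linarith
  · have h2 := rp_split (half_pos hη) h1
    calc _ ≤ 2 * G * 1 := (_root_.norm_sub_le _ _).trans (by linarith [b1.1, b2.1])
      _ ≤ 2 * G * ((η / 2) ^ (-(1/4) : ℝ) * r ^ (1/4 : ℝ)) := by gcongr
      _ ≤ _ := by rw [← mul_assoc]; refine le_add_of_nonneg_left (by positivity)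
lemma Sol.row (h : Sol κ Λ N L u0 u0' u u') {η : ℝ} (hη : 0 < η) : ∃ K, 0 ≤ K ∧ ∀ t ∈ Icc η L,
    ∀ r ∈ Ioc 0 t, ∀ i x v,
      ‖HA κ r (N (u (t - r), u' (t - r))) x v (e i)‖ ≤ K * r ^ (-(3/4) : ℝ) * ‖v‖ := by
  obtain ⟨G, hG, hb⟩ := h.bdd
  obtain ⟨K, hK, hs⟩ := h.space (half_pos hη)
  set S : ℝ := ∑ i : ι E, ‖(e i : E)‖
  have hS : ∀ i : ι E, ‖(e i : E)‖ ≤ S := fun i =>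
    Finset.single_le_sum (f := fun i : ι E => ‖(e i : E)‖) (fun _ _ => norm_nonneg _) (Finset.mem_univ i)
  have hS0 : 0 ≤ S := Finset.sum_nonneg fun _ _ => norm_nonneg _
  obtain ⟨K', hK', hl⟩ := h.hN.hol G (K * S ^ (1/2 : ℝ))
  obtain ⟨C, hC, hrow⟩ := HA_row (E := E) h.hκ
  obtain ⟨C', hC', hbd⟩ := HA_bound (E := E) (F := ℝ) h.hκ
  refine ⟨C * K' + C' * G * S * (η / 2) ^ (-(1/4) : ℝ), by positivity, fun t ht r hr i x v => ?_⟩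
  have ht0 : 0 < t := hη.trans_le ht.1
  have hr4 : 0 ≤ r ^ (-(3/4) : ℝ) := Real.rpow_nonneg hr.1.le _
  have b1 := hb (t - r) ⟨by linarith [hr.2], by linarith [hr.1, ht.2]⟩
  have hv := norm_nonneg v
  rw [add_mul, add_mul]
  rcases le_total r (η / 2) with h1 | h1
  · have h3 : Hol (e i) (K * S ^ (1/2 : ℝ)) (u' (t - r)) := fun y a => by
      refine (hs (t - r) ⟨by linarith [ht.1], by linarith [hr.1, ht.2]⟩ y (a • e i)).trans ?_
      rw [norm_smul, Real.mul_rpow (norm_nonneg _) (norm_nonneg _), Real.norm_eq_abs, mul_assoc,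
        mul_comm (|a| ^ _)]
      gcongr; exact hS i
    refine (hrow i r hr.1 _ K' hK' (hl i _ _ (h.d1 _) b1.2.1 b1.2.2 h3) x v).trans ?_
    exact le_add_of_nonneg_right (by positivity)
  · have h2 := rp_split (half_pos hη) h1
    have h3 : r⁻¹ ≤ (η / 2) ^ (-(1/4) : ℝ) * r ^ (-(3/4) : ℝ) := by
      have : r ^ (1/4 : ℝ) * r⁻¹ = r ^ (-(3/4) : ℝ) := by
        rw [← Real.rpow_neg_one, ← Real.rpow_add hr.1]; norm_num
      have hri := inv_nonneg.2 hr.1.le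
      calc r⁻¹ = 1 * r⁻¹ := (one_mul _).symm
        _ ≤ ((η / 2) ^ (-(1/4) : ℝ) * r ^ (1/4 : ℝ)) * r⁻¹ := by gcongr
        _ = _ := by rw [mul_assoc, this]
    have h4 : ‖HA κ r (N (u (t - r), u' (t - r))) x‖ ≤ C' * r⁻¹ * G :=
      (BoundedContinuousFunction.norm_coe_le_norm _ x).trans ((hbd r hr.1 _).trans (by
        have := inv_nonneg.2 hr.1.le
        gcongr; exact b1.1))
    have hri := inv_nonneg.2 hr.1.le
    calc _ ≤ ‖HA κ r (N (u (t - r), u' (t - r))) x‖ * ‖v‖ * ‖(e i : E)‖ :=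
          ContinuousLinearMap.le_opNorm₂ _ _ _
      _ ≤ (C' * ((η / 2) ^ (-(1/4) : ℝ) * r ^ (-(3/4) : ℝ)) * G) * ‖v‖ * S := by
          gcongr
          · exact h4.trans (by gcongr)
          · exact hS i
      _ = C' * G * S * (η / 2) ^ (-(1/4) : ℝ) * r ^ (-(3/4) : ℝ) * ‖v‖ := by ring
      _ ≤ _ := le_add_of_nonneg_left (by positivity)
end
end FP
end
noncomputable section
namespace FP
open scoped Topology BoundedContinuousFunction
set_option linter.unusedSectionVars false
set_option maxSynthPendingDepth 3
open GS
attribute [local irreducible] P D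
variable {E : Type} [NormedAddCommGroup E] [NormedSpace ℝ E] [MeasurableSpace E] [BorelSpace E]
  [SecondCountableTopology E] [GS E]
  {F : Type} [NormedAddCommGroup F] [NormedSpace ℝ F] [CompleteSpace F]
def SG (E F : Type) [NormedAddCommGroup E] [NormedSpace ℝ E] [NormedAddCommGroup F] [NormedSpace ℝ F] :
    Submodule ℝ ((E →ᵇ F) × (E →ᵇ (E →L[ℝ] F))) where
  carrier := {z | D1 z.1 z.2}
  add_mem' {a b} ha hb := fun x => (ha x).add (hb x)
  zero_mem' := fun x => hasFDerivAt_const (0 : F) x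
  smul_mem' c a ha := fun x => (ha x).const_smul c
lemma SG_closed : IsClosed (SG E F : Set ((E →ᵇ F) × (E →ᵇ (E →L[ℝ] F)))) :=
  IsSeqClosed.isClosed fun z w hz hw => D1_closed (f := fun n => (z n).1) (f' := fun n => (z n).2) hz
    ((continuous_fst.tendsto w).comp hw) ((continuous_snd.tendsto w).comp hw)
lemma D1_int {f : ℝ → E →ᵇ F} {f' : ℝ → E →ᵇ (E →L[ℝ] F)} {S : Set ℝ} (hS : MeasurableSet S)
    (h : ∀ r ∈ S, D1 (f r) (f' r)) (hf : IntegrableOn f S) (hf' : IntegrableOn f' S) :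
    D1 (∫ r in S, f r) (∫ r in S, f' r) := by
  have := sub_integral_mem (SG E F) SG_closed (μ := volume.restrict S) (f := fun r => (f r, f' r))
    ((ae_restrict_mem hS).mono h)
  rw [integral_pair hf hf'] at this
  exact this
def trC (E : Type) [NormedAddCommGroup E] [NormedSpace ℝ E] [MeasurableSpace E] [GS E] :
    (E →ᵇ (E →L[ℝ] E →L[ℝ] ℝ)) →L[ℝ] (E →ᵇ ℝ) := (trL E).compLeftContinuousBounded E
lemma trC_apply (A : E →ᵇ (E →L[ℝ] E →L[ℝ] ℝ)) (x : E) : trC E A x = trL E (A x) := rfl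
section
variable {κ : ℝ}
lemma HAL_int (hκ : 0 < κ) {g : ℝ → E →ᵇ ℝ} (hg : Continuous g) (t : ℝ) {a b : ℝ} (ha : 0 < a) :
    IntegrableOn (fun r => HAL κ r (g (t - r))) (Ioc a b) := by
  refine (ContinuousOn.integrableOn_Icc ?_).mono_set Ioc_subset_Icc_self
  have h1 : ContinuousOn (HAL (E := E) (F := ℝ) κ) (Icc a b) :=
    (cont_HA hκ).mono fun r hr => ha.trans_le hr.1
  exact h1.clm_apply (by fun_prop)
lemma trC_FTC (hκ : 0 < κ) (b : E →ᵇ ℝ) {ε δ : ℝ} (hε : 0 < ε) (hεδ : ε ≤ δ) :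
    ∫ r in Ioc ε δ, κ • trC E (HAL κ r b) = H κ δ b - H κ ε b := by
  have hi : IntegrableOn (fun r => κ • trC E (HAL κ r b)) (Ioc ε δ) :=
    ((trC E).integrable_comp (HAL_int hκ (continuous_const (y := b)) 0 hε)).smul κ
  ext x
  rw [BoundedContinuousFunction.sub_apply]
  have e : (∫ r in Ioc ε δ, κ • trC E (HAL κ r b)) x = ∫ r in Ioc ε δ, κ * trL E (HA κ r b x) :=
    ((BoundedContinuousFunction.evalCLM ℝ x).integral_comp_comm hi).symm
  have hi' : IntegrableOn (fun r => κ * trL E (HA κ r b x)) (Ioc ε δ) :=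
    (BoundedContinuousFunction.evalCLM (β := ℝ) ℝ x).integrable_comp hi
  rw [e, ← intervalIntegral.integral_of_le hεδ]
  refine intervalIntegral.integral_eq_sub_of_hasDerivAt (f := fun r => H κ r b x) (fun r hr => ?_)
    ((intervalIntegrable_iff_integrableOn_Ioc_of_le hεδ).2 hi')
  rw [uIcc_of_le hεδ] at hr
  exact H_hasDerivAt hκ b (hε.trans_le hr.1) x
lemma tr_split (hκ : 0 < κ) {g : ℝ → E →ᵇ ℝ} (hg : Continuous g) (t : ℝ) {ε δ : ℝ} (hε : 0 < ε) (hεδ : ε ≤ δ) :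
    κ • trC E (∫ r in Ioc ε δ, HAL κ r (g (t - r))) =
      (∫ r in Ioc ε δ, κ • trC E (HAL κ r (g (t - r) - g t))) + (H κ δ (g t) - H κ ε (g t)) := by
  have i1 : IntegrableOn (fun r => κ • trC E (HAL κ r (g (t - r) - g t))) (Ioc ε δ) :=
    ((trC E).integrable_comp
      (HAL_int hκ (hg.sub (continuous_const (y := g t))) t (b := δ) hε)).smul κ
  have i2 : IntegrableOn (fun r => κ • trC E (HAL κ r (g t))) (Ioc ε δ) :=
    ((trC E).integrable_comp (HAL_int hκ (continuous_const (y := g t)) t (b := δ) hε)).smul κ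
  rw [← trC_FTC hκ (g t) hε hεδ, ← integral_add i1 i2, ← (trC E).integral_comp_comm (HAL_int hκ hg t hε),
    ← integral_smul]
  refine integral_congr_ae (Eventually.of_forall fun r => ?_)
  dsimp only
  rw [← smul_add, ← map_add, ← map_add, sub_add_cancel]
lemma int_le (K : ℝ) (hK : 0 ≤ K) {ε δ : ℝ} (hε : 0 ≤ ε) (hδ : 0 ≤ δ) :
    ∫ r in Ioc ε δ, K * r ^ (-(3/4) : ℝ) ≤ 4 * K * δ ^ (1/4 : ℝ) := by
  have h1 := int_rpow K (by norm_num : (-1:ℝ) < -(3/4)) δ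
  calc _ ≤ ∫ r in Ioc 0 δ, K * r ^ (-(3/4) : ℝ) := by
        refine setIntegral_mono_set h1 ((ae_restrict_mem measurableSet_Ioc).mono fun r hr => ?_)
          (Ioc_subset_Ioc_left hε).eventuallyLE
        exact mul_nonneg hK (Real.rpow_nonneg hr.1.le _)
    _ = _ := by
        rw [integral_const_mul, int_rpow_val (by norm_num) hδ]
        norm_num; ring
lemma norm_int_le {X : Type} [NormedAddCommGroup X] [NormedSpace ℝ X] {f : ℝ → X} {K : ℝ} (hK : 0 ≤ K)
    {ε δ : ℝ} (hε : 0 ≤ ε) (hδ : 0 ≤ δ) (h : ∀ r ∈ Ioc ε δ, ‖f r‖ ≤ K * r ^ (-(3/4) : ℝ)) :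
    ‖∫ r in Ioc ε δ, f r‖ ≤ 4 * K * δ ^ (1/4 : ℝ) :=
  (norm_integral_le_of_norm_le ((int_rpow K (by norm_num) δ).mono_set (Ioc_subset_Ioc_left hε))
    ((ae_restrict_mem measurableSet_Ioc).mono h)).trans (int_le K hK hε hδ)
lemma trb (hκ : 0 < κ) {g : ℝ → E →ᵇ ℝ} : ∃ C, 0 ≤ C ∧ ∀ K, 0 ≤ K → ∀ t r, 0 < r →
    ‖g (t - r) - g t‖ ≤ K * r ^ (1/4 : ℝ) →
    ‖κ • trC E (HAL κ r (g (t - r) - g t))‖ ≤ C * K * r ^ (-(3/4) : ℝ) := by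
  obtain ⟨C, hC, hb⟩ := HA_bound (E := E) (F := ℝ) hκ
  refine ⟨κ * ‖trC E‖ * C, by positivity, fun K hK t r hr h => ?_⟩
  have e : r⁻¹ * r ^ (1/4 : ℝ) = r ^ (-(3/4) : ℝ) := by
    rw [← Real.rpow_neg_one, ← Real.rpow_add hr]; norm_num
  have h1 : ‖HAL κ r (g (t - r) - g t)‖ ≤ C * r⁻¹ * (K * r ^ (1/4 : ℝ)) :=
    (hb r hr _).trans (mul_le_mul_of_nonneg_left h (by positivity))
  rw [norm_smul, Real.norm_of_nonneg hκ.le]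
  calc _ ≤ κ * (‖trC E‖ * (C * r⁻¹ * (K * r ^ (1/4 : ℝ)))) := by
        gcongr; exact (trC E).le_opNorm_of_le h1
    _ = κ * ‖trC E‖ * C * K * (r⁻¹ * r ^ (1/4 : ℝ)) := by ring
    _ = _ := by rw [e]
lemma int_A_le (hκ : 0 < κ) {g : ℝ → E →ᵇ ℝ} (hg : Continuous g) {t : ℝ} {K : ℝ} (hK : 0 ≤ K)
    (h1 : ∀ r ∈ Ioc 0 t, ‖g (t - r) - g t‖ ≤ K * r ^ (1/4 : ℝ))
    (h2 : ∀ r ∈ Ioc 0 t, ∀ i x v, ‖HA κ r (g (t - r)) x v (e i)‖ ≤ K * r ^ (-(3/4) : ℝ) * ‖v‖) :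
    ∃ C, 0 ≤ C ∧ ∀ ε δ, 0 < ε → ε ≤ δ → δ ≤ t → ‖∫ r in Ioc ε δ, HAL κ r (g (t - r))‖ ≤
      C * (δ ^ (1/4 : ℝ) + ‖H κ δ (g t) - H κ ε (g t)‖) := by
  obtain ⟨C, hC, hb⟩ := trb (E := E) (g := g) hκ
  obtain ⟨C', hC', hn⟩ := norm_symm_le (E := E)
  set M := 4 * K + κ⁻¹ * (4 * (C * K)) + κ⁻¹
  have hM : 0 ≤ M := by positivity
  refine ⟨C' * M, by positivity, fun ε δ hε hεδ hδ => ?_⟩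
  have hδ0 : 0 < δ := hε.trans_le hεδ
  have hp : 0 ≤ δ ^ (1/4 : ℝ) := by positivity
  set d := ‖H κ δ (g t) - H κ ε (g t)‖
  have hd : 0 ≤ d := norm_nonneg _
  rw [mul_assoc]
  have hi := HAL_int hκ hg t (b := δ) hε
  have hsub : ∀ r ∈ Ioc ε δ, r ∈ Ioc 0 t := fun r hr => ⟨hε.trans hr.1, hr.2.trans hδ⟩
  refine (BoundedContinuousFunction.norm_le (by positivity)).2 fun x => ?_
  have ev : ∀ v w, (∫ r in Ioc ε δ, HAL κ r (g (t - r))) x v w =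
      ∫ r in Ioc ε δ, HA κ r (g (t - r)) x v w := fun v w =>
    (((ContinuousLinearMap.apply ℝ ℝ w).comp ((ContinuousLinearMap.apply ℝ (E →L[ℝ] ℝ) v).comp
      (BoundedContinuousFunction.evalCLM ℝ x))).integral_comp_comm hi).symm
  have hk4 : 4 * K * δ ^ (1/4 : ℝ) ≤ M * (δ ^ (1/4 : ℝ) + d) := by
    have i1 : 4 * K ≤ M := by
      have : 0 ≤ κ⁻¹ * (4 * (C * K)) + κ⁻¹ := by positivity
      simp only [M]; linarith
    exact (mul_le_mul_of_nonneg_right i1 hp).trans (mul_le_mul_of_nonneg_left (by linarith) hM)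
  refine hn _ (fun v w => ?_) _ (by positivity) ?_ fun i v => ?_
  · rw [ev, ev]
    exact setIntegral_congr_fun measurableSet_Ioc fun r hr => HA_symm hκ _ (hsub r hr).1 x v w
  · have h3 := congrArg (fun f : E →ᵇ ℝ => f x) (tr_split hκ hg t hε hεδ)
    have h4 : ‖(∫ r in Ioc ε δ, κ • trC E (HAL κ r (g (t - r) - g t))) + (H κ δ (g t) - H κ ε (g t))‖
        ≤ 4 * (C * K) * δ ^ (1/4 : ℝ) + d :=
      (norm_add_le _ _).trans (add_le_add_left (norm_int_le (by positivity) hε.le hδ0.le fun r hr =>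
        hb K hK t r (hsub r hr).1 (h1 r (hsub r hr))) _)
    have h5 := (BoundedContinuousFunction.norm_coe_le_norm _ x).trans h4
    rw [← h3] at h5
    simp only [BoundedContinuousFunction.coe_smul, trC_apply, smul_eq_mul, norm_mul,
      Real.norm_of_nonneg hκ.le] at h5
    rw [← Real.norm_eq_abs]
    rw [mul_comm, ← le_div_iff₀ hκ] at h5
    refine h5.trans ?_
    have : 0 ≤ 4 * K * δ ^ (1/4 : ℝ) + κ⁻¹ * δ ^ (1/4 : ℝ) + (4 * K + κ⁻¹ * (4 * (C * K))) * d := by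
      positivity
    have e : M * (δ ^ (1/4 : ℝ) + d) = (4 * (C * K) * δ ^ (1/4 : ℝ) + d) / κ +
        (4 * K * δ ^ (1/4 : ℝ) + κ⁻¹ * δ ^ (1/4 : ℝ) + (4 * K + κ⁻¹ * (4 * (C * K))) * d) := by
      simp only [M]; ring
    rw [e]; linarith
  · rw [ev]
    have := norm_int_le (f := fun r => HA κ r (g (t - r)) x v (e i)) (K := K * ‖v‖) (by positivity)
      hε.le hδ0.le fun r hr => (h2 r (hsub r hr) i x v).trans_eq (by ring)
    refine this.trans ?_
    calc _ = 4 * K * δ ^ (1/4 : ℝ) * ‖v‖ := by ring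
      _ ≤ _ := by gcongr
end
end FP
end
noncomputable section
namespace FP
open scoped Topology BoundedContinuousFunction
set_option linter.unusedSectionVars false
set_option maxSynthPendingDepth 3
open GS
attribute [local irreducible] P D
variable {E : Type} [NormedAddCommGroup E] [NormedSpace ℝ E] [MeasurableSpace E] [BorelSpace E]
  [SecondCountableTopology E] [GS E]
  {F : Type} [NormedAddCommGroup F] [NormedSpace ℝ F] [CompleteSpace F]
section
variable {κ : ℝ} {Λ : Set E} {N : (E →ᵇ ℝ) × (E →ᵇ (E →L[ℝ] ℝ)) → (E →ᵇ ℝ)} {L : ℝ}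
    {u0 : E →ᵇ ℝ} {u0' : E →ᵇ (E →L[ℝ] ℝ)} {u : ℝ → E →ᵇ ℝ} {u' : ℝ → E →ᵇ (E →L[ℝ] ℝ)}
def Th (κ : ℝ) (u0 : E →ᵇ ℝ) (g : ℝ → E →ᵇ ℝ) (t : ℝ) : E →ᵇ ℝ :=
  κ • trC E (HAL κ t u0) + (∫ r in Ioc 0 t, κ • trC E (HAL κ r (g (t - r) - g t))) + (H κ t (g t) - g t)
lemma Th_meas (hκ : 0 < κ) {g : ℝ → E →ᵇ ℝ} (hg : Continuous g) (t : ℝ) :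
    AEStronglyMeasurable (fun r => κ • trC E (HAL κ r (g (t - r) - g t))) (volume.restrict (Ioc 0 t)) := by
  have h1 : ContinuousOn (HAL (E := E) (F := ℝ) κ) (Ioc 0 t) := (cont_HA hκ).mono fun r hr => hr.1
  have h2 : ContinuousOn (fun r => HAL κ r (g (t - r) - g t)) (Ioc 0 t) := h1.clm_apply (by fun_prop)
  exact (((trC E).continuous.comp_continuousOn h2).const_smul κ).aestronglyMeasurable measurableSet_Ioc
lemma Sol.bounds (h : Sol κ Λ N L u0 u0' u u') {η : ℝ} (hη : 0 < η) : ∃ K, 0 ≤ K ∧ ∀ t ∈ Icc η L,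
    ∀ r ∈ Ioc 0 t, ‖κ • trC E (HAL κ r (N (u (t - r), u' (t - r)) - N (u t, u' t)))‖ ≤ K * r ^ (-(3/4) : ℝ) := by
  obtain ⟨C, hC, hb⟩ := trb (E := E) (g := fun s => N (u s, u' s)) h.hκ
  obtain ⟨K, hK, h1⟩ := h.gtime hη
  exact ⟨C * K, by positivity, fun t ht r hr => hb K hK t r hr.1 (h1 t ht r hr)⟩
lemma Sol.second (h : Sol κ Λ N L u0 u0' u u') (hUC : ∀ f : E →ᵇ ℝ, Per Λ f → UniformContinuous f)
    {t : ℝ} (ht : t ∈ Ioc 0 L) :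
    ∃ A, D1 (u' t) A ∧ κ • trC E A = Th κ u0 (fun s => N (u s, u' s)) t := by
  have hκ := h.hκ
  have hg := h.cg
  obtain ⟨K1, hK1, hb1⟩ := h.gtime ht.1
  obtain ⟨K2, hK2, hb2⟩ := h.row ht.1
  obtain ⟨K3, hK3, hb3⟩ := h.bounds ht.1
  replace hb3 := hb3 t ⟨le_rfl, ht.2⟩
  have hp : Per Λ (N (u t, u' t)) := h.hN.per _ _ (h.d1 t) (h.per t) (h.per' t)
  have hd := HD_int hκ hg t
  have hu2 : u' t = HD κ t u0 + ∫ r in Ioc 0 t, HD κ r (N (u (t - r), u' (t - r))) := by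
    rw [HD_eq hκ ht.1 h.d0, h.h2 t ⟨ht.1.le, ht.2⟩]; rfl
  obtain ⟨C, hC, hI⟩ := int_A_le hκ hg (t := t) (K := K1 + K2) (by positivity)
    (fun r hr => (hb1 t ⟨le_rfl, ht.2⟩ r hr).trans (by
      have := Real.rpow_nonneg hr.1.le (1/4); gcongr; linarith))
    (fun r hr i x v => (hb2 t ⟨le_rfl, ht.2⟩ r hr i x v).trans (by
      have := Real.rpow_nonneg hr.1.le (-(3/4)); gcongr; linarith))
  set g : ℝ → E →ᵇ ℝ := fun s => N (u s, u' s) with hgd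
  have hHt : Tendsto (fun r => H κ r (g t)) (𝓝 0) (𝓝 (g t)) := H_tendsto (hUC _ hp)
  have ht1 := ht.1
  let ε : ℕ → ℝ := fun n => t * (1 / ((n : ℝ) + 1))
  have hε0 : ∀ n, 0 < ε n := fun n => mul_pos ht1 (by positivity)
  have hεt : ∀ n, ε n ≤ t := fun n => by
    have : 1 / ((n : ℝ) + 1) ≤ 1 := by rw [div_le_one (by positivity)]; linarith [n.cast_nonneg (α := ℝ)]
    exact mul_le_of_le_one_right ht1.le this
  have hεa : Antitone ε := fun a b hab => mul_le_mul_of_nonneg_left (Nat.one_div_le_one_div hab) ht1.le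
  have hεl : Tendsto ε atTop (𝓝 0) := by
    have := (tendsto_one_div_add_atTop_nhds_zero_nat (𝕜 := ℝ)).const_mul t
    rwa [mul_zero] at this
  have hmono : Monotone fun n => Ioc (ε n) t := fun a b hab => Ioc_subset_Ioc_left (hεa hab)
  have hUn : (⋃ n, Ioc (ε n) t) = Ioc 0 t := by
    refine Subset.antisymm (iUnion_subset fun n => Ioc_subset_Ioc_left (hε0 n).le) fun r hr => ?_
    obtain ⟨n, hn⟩ := (hεl.eventually_lt_const hr.1).exists
    exact mem_iUnion.2 ⟨n, hn, hr.2⟩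
  set A : ℕ → E →ᵇ (E →L[ℝ] E →L[ℝ] ℝ) := fun n => ∫ r in Ioc (ε n) t, HAL κ r (g (t - r)) with hA
  have hAs : ∀ a b, a ≤ b → A b - A a = ∫ r in Ioc (ε b) (ε a), HAL κ r (g (t - r)) := fun a b hab => by
    have e : Ioc (ε b) t = Ioc (ε b) (ε a) ∪ Ioc (ε a) t := (Ioc_union_Ioc_eq_Ioc (hεa hab) (hεt a)).symm
    rw [hA]; dsimp only
    rw [e, setIntegral_union (Ioc_disjoint_Ioc_of_le le_rfl) measurableSet_Ioc
      (HAL_int hκ hg t (hε0 b)) (HAL_int hκ hg t (hε0 a)), add_sub_cancel_right]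
  have hcau : CauchySeq A := by
    rw [Metric.cauchySeq_iff']
    intro δ hδ
    have hd' : 0 < δ / (4 * (C + 1)) := by positivity
    have l1 : Tendsto (fun n => (ε n) ^ (1/4 : ℝ)) atTop (𝓝 0) := by
      have := hεl.rpow_const (p := (1/4 : ℝ)) (Or.inr (by norm_num))
      rwa [Real.zero_rpow (by norm_num)] at this
    have l2 : Tendsto (fun n => ‖H κ (ε n) (g t) - g t‖) atTop (𝓝 0) :=
      tendsto_iff_norm_sub_tendsto_zero.1 (hHt.comp hεl)
    obtain ⟨n0, hn0⟩ := eventually_atTop.1 ((l1.eventually_lt_const hd').and (l2.eventually_lt_const hd'))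
    refine ⟨n0, fun n hn => ?_⟩
    rw [dist_eq_norm, hAs n0 n hn]
    refine (hI _ _ (hε0 n) (hεa hn) (hεt n0)).trans_lt ?_
    have h1 : ‖H κ (ε n0) (g t) - H κ (ε n) (g t)‖ ≤ ‖H κ (ε n0) (g t) - g t‖ + ‖H κ (ε n) (g t) - g t‖ := by
      rw [norm_sub_rev (H κ (ε n) (g t))]; exact norm_sub_le_norm_sub_add_norm_sub _ _ _
    have h2 := hn0 n0 le_rfl
    have h3 := hn0 n hn
    calc _ ≤ C * (3 * (δ / (4 * (C + 1)))) := by gcongr; linarith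
      _ < δ := by
        rw [show C * (3 * (δ / (4 * (C + 1)))) = δ * (C * 3 / (4 * (C + 1))) by ring]
        refine mul_lt_of_lt_one_right hδ ?_
        rw [div_lt_one (by positivity)]; linarith
  obtain ⟨A', hA'⟩ := cauchySeq_tendsto_of_complete hcau
  refine ⟨HAL κ t u0 + A', ?_, ?_⟩
  · rw [hu2]
    have l3 := tendsto_setIntegral_of_monotone (fun n => measurableSet_Ioc) hmono (by rw [hUn]; exact hd)
    rw [hUn] at l3
    exact D1_closed (fun n => fun x => (D1_HD hκ ht.1 u0 x).add ((D1_int measurableSet_Ioc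
      (fun r hr => D1_HD hκ ((hε0 n).trans hr.1) _)
      (hd.mono_set (Ioc_subset_Ioc_left (hε0 n).le)) (HAL_int hκ hg t (hε0 n))) x))
      (l3.const_add _) (hA'.const_add _)
  · have hti : IntegrableOn (fun r => κ • trC E (HAL κ r (g (t - r) - g t))) (Ioc 0 t) :=
      Integrable.mono' (int_rpow K3 (by norm_num) t) (Th_meas hκ hg t)
        ((ae_restrict_mem measurableSet_Ioc).mono hb3)
    have l4 := tendsto_setIntegral_of_monotone (fun n => measurableSet_Ioc) hmono (by rw [hUn]; exact hti)
    rw [hUn] at l4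
    have l5 := l4.add ((hHt.comp hεl).const_sub (H κ t (g t)))
    have l6 : Tendsto (fun n => κ • trC E (A n)) atTop (𝓝 (κ • trC E A')) :=
      (((trC E).continuous.tendsto A').comp hA').const_smul κ
    have l7 := tendsto_nhds_unique l6 (l5.congr fun n => (tr_split hκ hg t (hε0 n) (hεt n)).symm)
    rw [map_add, smul_add, l7, Th, add_assoc]
lemma Sol.Th_cont (h : Sol κ Λ N L u0 u0' u u') :
    ContinuousOn (Th κ u0 fun s => N (u s, u' s)) (Ioo 0 L) := by
  have hκ := h.hκ
  have hg := h.cg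
  intro t0 ht0
  refine ContinuousAt.continuousWithinAt ?_
  obtain ⟨K, hK, hb⟩ := h.bounds (half_pos ht0.1)
  set g : ℝ → E →ᵇ ℝ := fun s => N (u s, u' s) with hgd
  have c1 : ContinuousAt (HAL (E := E) (F := ℝ) κ) t0 := (cont_HA hκ).continuousAt (Ioi_mem_nhds ht0.1)
  have c2 : ContinuousAt (H (E := E) (F := ℝ) κ) t0 := (cont_H hκ).continuousAt (Ioi_mem_nhds ht0.1)
  have c3 : ContinuousAt (fun t => κ • trC E (HAL κ t u0)) t0 :=
    (((trC E).continuous.continuousAt).comp (c1.clm_apply continuousAt_const)).const_smul κ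
  have c4 : ContinuousAt (fun t => H κ t (g t) - g t) t0 :=
    (c2.clm_apply hg.continuousAt).sub hg.continuousAt
  refine (c3.add ?_).add c4
  refine vol_cont (Φ := fun t r => κ • trC E (HAL κ r (g (t - r) - g t))) (k := fun r => K * r ^ (-(3/4) : ℝ))
    (Eventually.of_forall fun t => Th_meas hκ hg t) ?_ (int_rpow _ (by norm_num) _)
    (fun r hr => mul_nonneg hK (Real.rpow_nonneg hr.le _)) fun r hr _ => ?_
  · filter_upwards [Ioo_mem_nhds (half_lt_self ht0.1) ht0.2] with t ht r hr
    exact hb t ⟨ht.1.le, ht.2.le⟩ r hr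
  · have : Continuous fun t => κ • trC E (HAL κ r (g (t - r) - g t)) := by fun_prop
    exact this.continuousAt
lemma Sol.right (h : Sol κ Λ N L u0 u0' u u') (hUC : ∀ f : E →ᵇ ℝ, Per Λ f → UniformContinuous f)
    {t : ℝ} (ht : t ∈ Ioo 0 L) (x : E) :
    HasDerivWithinAt (fun s => u s x) ((Th κ u0 (fun s => N (u s, u' s)) t + N (u t, u' t)) x) (Ici t) t := by
  have hκ := h.hκ
  obtain ⟨A, hA, hT⟩ := h.second hUC ⟨ht.1, ht.2.le⟩
  have hp : Per Λ (N (u t, u' t)) := h.hN.per _ _ (h.d1 t) (h.per t) (h.per' t)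
  have h1 := H_gen hκ (h.d1 t) hA x
  have e0 : κ * trL E (A x) = Th κ u0 (fun s => N (u s, u' s)) t x := by rw [← hT]; rfl
  rw [e0] at h1
  have hg := h.cg
  set g : ℝ → E →ᵇ ℝ := fun s => N (u s, u' s) with hgd
  have h2 : HasDerivWithinAt (fun r => cvT (H κ) (fun s => g (t + s)) r x) (g t x) (Ici 0) 0 := by
    rw [hasDerivWithinAt_iff_isLittleO, Asymptotics.isLittleO_iff]
    intro c hc
    have l1 : Tendsto (fun r => ‖H κ r (g t) - g t‖) (𝓝 0) (𝓝 0) :=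
      tendsto_iff_norm_sub_tendsto_zero.1 (H_tendsto (hUC _ hp))
    have l2 : Tendsto (fun r => ‖g (t + r) - g t‖) (𝓝 0) (𝓝 0) := by
      have : Continuous fun r => ‖g (t + r) - g t‖ := by fun_prop
      simpa using this.tendsto 0
    have hc2 := half_pos hc
    obtain ⟨δ, hδ, hb⟩ := Metric.eventually_nhds_iff.1
      ((l1.eventually_lt_const hc2).and (l2.eventually_lt_const hc2))
    filter_upwards [inter_mem_nhdsWithin (Ici 0) (Metric.ball_mem_nhds 0 hδ)] with r hr
    have hr0 : 0 ≤ r := hr.1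
    have hrd : r < δ := by have := hr.2; rwa [Metric.mem_ball, dist_zero_right, Real.norm_of_nonneg hr0] at this
    have z : cvT (H κ) (fun s => g (t + s)) 0 = 0 := by rw [cvT, Ioc_self, setIntegral_empty]
    have hi := H_int hκ (g := fun s => g (t + s)) (by fun_prop) r
    have e1 : cvT (H κ) (fun s => g (t + s)) r - r • g t =
        ∫ s in Ioc 0 r, (H κ s (g (t + (r - s))) - g t) := by
      rw [integral_sub hi (integrable_const _), cvT]; simp [hr0]
    have e2 : ‖cvT (H κ) (fun s => g (t + s)) r - r • g t‖ ≤ c * r := by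
      rw [e1]
      refine (norm_set_le (k := fun _ => c) (by simp) fun s hs => ?_).trans_eq (by simp [hr0, mul_comm])
      have b1 := (hb (y := s) (by rw [dist_zero_right, Real.norm_of_nonneg hs.1.le]; linarith [hs.2])).1
      have b2 := (hb (y := r - s) (by
        rw [dist_zero_right, Real.norm_of_nonneg (by linarith [hs.2])]; linarith [hs.1])).2
      calc _ = ‖H κ s (g (t + (r - s)) - g t) + (H κ s (g t) - g t)‖ := by rw [map_sub]; congr 1; abel
        _ ≤ c / 2 + c / 2 := (norm_add_le _ _).trans
          (add_le_add ((H_norm_le _ _).trans b2.le) b1.le)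
        _ = c := add_halves c
    have e3 := (BoundedContinuousFunction.norm_coe_le_norm _ x).trans e2
    simpa [z, abs_of_nonneg hr0] using e3
  have h3 := h1.add h2
  have h4 : HasDerivWithinAt (fun r => u (t + r) x)
      (Th κ u0 g t x + g t x) (Ici 0) 0 := by
    refine h3.congr_of_eventuallyEq ?_ ?_
    · filter_upwards [inter_mem_nhdsWithin (Ici 0) (Iio_mem_nhds (sub_pos.2 ht.2))] with r hr
      have := h.restart1 ht.1.le hr.1 (by have := hr.2; simp at this; linarith)
      rw [this]; rfl
    · have := h.restart1 ht.1.le le_rfl (by linarith [ht.2])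
      rw [this]; rfl
  have h5 := HasDerivWithinAt.scomp (h := fun s => s - t) (h' := 1) (s := Ici t) t
    (g₁ := fun r => u (t + r) x) (t' := Ici 0) (by simpa using h4)
    ((hasDerivWithinAt_id t _).sub_const t) (fun s hs => by simpa using hs)
  rw [one_smul] at h5
  have e5 : (fun s => u s x) = (fun r => u (t + r) x) ∘ fun s => s - t := by
    funext s; simp
  rw [e5]; exact h5
theorem Sol.reg (h : Sol κ Λ N L u0 u0' u u') (hUC : ∀ f : E →ᵇ ℝ, Per Λ f → UniformContinuous f) :
    ∃ u'' : ℝ → E →ᵇ (E →L[ℝ] E →L[ℝ] ℝ), (∀ t ∈ Ioo 0 L, D1 (u' t) (u'' t) ∧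
      HasDerivAt u (κ • trC E (u'' t) + N (u t, u' t)) t) ∧
      ContinuousOn (fun t => κ • trC E (u'' t) + N (u t, u' t)) (Ioo 0 L) := by
  choose! u'' hu using fun t (ht : t ∈ Ioc 0 L) => h.second hUC ht
  have hg := h.cg
  set g : ℝ → E →ᵇ ℝ := fun s => N (u s, u' s) with hgd
  have e : ∀ t ∈ Ioo 0 L, κ • trC E (u'' t) + N (u t, u' t) = Th κ u0 g t + g t :=
    fun t ht => by rw [(hu t ⟨ht.1, ht.2.le⟩).2]
  have hc : ContinuousOn (fun t => Th κ u0 g t + g t) (Ioo 0 L) := h.Th_cont.add hg.continuousOn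
  refine ⟨u'', fun t ht => ⟨(hu t ⟨ht.1, ht.2.le⟩).1, ?_⟩, hc.congr e⟩
  rw [e t ht]
  obtain ⟨a, ha0, hat⟩ := exists_between ht.1
  obtain ⟨b, htb, hbL⟩ := exists_between ht.2
  have hsub : Icc a b ⊆ Ioo 0 L := fun s hs => ⟨ha0.trans_le hs.1, hs.2.trans_lt hbL⟩
  have hcab := hc.mono hsub
  have hii : IntegrableOn (fun t => Th κ u0 g t + g t) (Icc a b) := hcab.integrableOn_Icc
  have key : ∀ s ∈ Icc a b, u s = u a + ∫ r in a..s, (Th κ u0 g r + g r) := by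
    intro s hs
    ext x
    have hcx : ContinuousOn (fun r => (Th κ u0 g r + g r) x) (Icc a b) :=
      (BoundedContinuousFunction.evalCLM (β := ℝ) ℝ x).continuous.comp_continuousOn hcab
    have e1 : ∀ s ∈ Icc a b, (u a + ∫ r in a..s, (Th κ u0 g r + g r)) x =
        u a x + ∫ r in a..s, (Th κ u0 g r + g r) x := fun s hs => by
      rw [BoundedContinuousFunction.add_apply]; congr 1
      exact ((BoundedContinuousFunction.evalCLM (β := ℝ) ℝ x).intervalIntegral_comp_comm
        ((intervalIntegrable_iff_integrableOn_Icc_of_le hs.1).2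
          (hii.mono_set (Icc_subset_Icc_right hs.2)))).symm
    rw [e1 s hs]
    refine eq_of_has_deriv_right_eq (f := fun s => u s x)
      (g := fun s => u a x + ∫ r in a..s, (Th κ u0 g r + g r) x) (f' := fun s => (Th κ u0 g s + g s) x)
      (fun s hs => h.right hUC (hsub ⟨hs.1, hs.2.le⟩) x) (fun s hs => ?_) ?_ ?_ (by simp) s hs
    · have hs' : Ioo 0 L ∈ 𝓝 s := isOpen_Ioo.mem_nhds (hsub ⟨hs.1, hs.2.le⟩)
      have c1 : ContinuousOn (fun r => (Th κ u0 g r + g r) x) (Ioo 0 L) :=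
        (BoundedContinuousFunction.evalCLM (β := ℝ) ℝ x).continuous.comp_continuousOn hc
      exact ((intervalIntegral.integral_hasDerivAt_right
        ((hcx.mono (Icc_subset_Icc_right hs.2.le)).intervalIntegrable_of_Icc hs.1)
        (c1.stronglyMeasurableAtFilter isOpen_Ioo s (hsub ⟨hs.1, hs.2.le⟩))
        (c1.continuousAt hs')).const_add _).hasDerivWithinAt
    · exact ((BoundedContinuousFunction.evalCLM (β := ℝ) ℝ x).continuous.comp h.cu).continuousOn
    · refine continuousOn_const.add ?_
      have := intervalIntegral.continuousOn_primitive_interval (μ := volume) (f := fun r => (Th κ u0 g r + g r) x)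
        (a := a) (b := b) (by rw [uIcc_of_le (hat.trans htb).le]; exact hcx.integrableOn_Icc)
      rwa [uIcc_of_le (hat.trans htb).le] at this
  have hd := (intervalIntegral.integral_hasDerivAt_right
    ((hcab.mono (Icc_subset_Icc_right htb.le)).intervalIntegrable_of_Icc hat.le)
    (hc.stronglyMeasurableAtFilter isOpen_Ioo t ht)
    (hc.continuousAt (isOpen_Ioo.mem_nhds ht))).const_add (u a)
  refine hd.congr_of_eventuallyEq ?_
  filter_upwards [Icc_mem_nhds hat htb] with s hs using key s hs
end
end FP
end
noncomputable section
namespace FP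
open scoped Topology BoundedContinuousFunction
set_option linter.unusedSectionVars false
set_option maxSynthPendingDepth 3
open GS
attribute [local irreducible] P D
variable {m : ℕ} {F : Type} [NormedAddCommGroup F] [NormedSpace ℝ F] [CompleteSpace F]
def La (m : ℕ) : AddSubgroup (Spc m) where
  carrier := {z | ∃ (k : ℤ) (j : Fin m → ℤ), z = ((k : ℝ), fun i => (j i : ℝ))}
  zero_mem' := ⟨0, 0, by ext <;> simp⟩
  add_mem' := by
    rintro _ _ ⟨k, j, rfl⟩ ⟨k', j', rfl⟩
    exact ⟨k + k', j + j', by ext <;> simp⟩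
  neg_mem' := by
    rintro _ ⟨k, j, rfl⟩
    exact ⟨-k, -j, by ext <;> simp⟩
lemma per_iff {f : Spc m → ℝ} : IsPeriodic f ↔ Per (La m : Set (Spc m)) f := by
  constructor
  · rintro h _ ⟨k, j, rfl⟩ x; exact h x k j
  · intro h x k j; exact h _ ⟨k, j, rfl⟩ x
lemma mem_cube {x : Spc m} : x ∈ cube m ↔ (0 ≤ x.1 ∧ x.1 < 1) ∧ ∀ i, 0 ≤ x.2 i ∧ x.2 i < 1 := by
  simp [cube, cube1, mem_prod, Set.mem_pi]
lemma shift_unique (x : Spc m) : ∃! g : La m, g +ᵥ x ∈ cube m := by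
  refine ⟨⟨(((-⌊x.1⌋ : ℤ) : ℝ), fun i => ((-⌊x.2 i⌋ : ℤ) : ℝ)), -⌊x.1⌋, fun i => -⌊x.2 i⌋, rfl⟩, ?_, ?_⟩
  · show (((-⌊x.1⌋ : ℤ) : ℝ), fun i => ((-⌊x.2 i⌋ : ℤ) : ℝ)) + x ∈ cube m
    rw [mem_cube]
    simp only [Prod.fst_add, Prod.snd_add, Pi.add_apply, Int.cast_neg]
    have h : ∀ y : ℝ, 0 ≤ -(⌊y⌋ : ℝ) + y ∧ -(⌊y⌋ : ℝ) + y < 1 := fun y =>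
      ⟨by linarith [Int.floor_le y], by linarith [Int.lt_floor_add_one y]⟩
    exact ⟨h _, fun i => h _⟩
  · rintro ⟨_, k, j, rfl⟩ h
    rw [AddSubgroup.vadd_def, vadd_eq_add, mem_cube] at h
    have e : ∀ (k : ℤ) (y : ℝ), 0 ≤ (k : ℝ) + y ∧ (k : ℝ) + y < 1 → k = -⌊y⌋ := fun k y h => by
      have : ⌊y⌋ = -k := Int.floor_eq_iff.2 ⟨by push_cast; linarith [h.1], by push_cast; linarith [h.2]⟩
      rw [this, neg_neg]
    ext
    · exact congrArg (Int.cast (R := ℝ)) (e k x.1 h.1)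
    · exact congrArg (Int.cast (R := ℝ)) (e (j _) _ (h.2 _))
lemma meas_cube1 : MeasurableSet (cube1 m) := MeasurableSet.univ_pi fun _ => measurableSet_Ico
lemma meas_cube : MeasurableSet (cube m) := measurableSet_Ico.prod meas_cube1
instance : IsProbabilityMeasure (volume.restrict (cube1 m)) :=
  ⟨by rw [Measure.restrict_apply_univ, cube1, Real.volume_pi_Ico]; simp⟩
lemma μT_eq : μT m = (volume.restrict (Ico (0 : ℝ) 1)).prod (volume.restrict (cube1 m)) := by
  rw [μT, cube, Measure.volume_eq_prod, Measure.prod_restrict]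
instance ico_prob : IsProbabilityMeasure (volume.restrict (Ico (0 : ℝ) 1)) :=
  ⟨by rw [Measure.restrict_apply_univ, Real.volume_Ico]; simp⟩
instance : IsProbabilityMeasure (μT m) := by rw [μT_eq]; infer_instance
instance : Countable (La m) := by
  have : (La m : Set (Spc m)) ⊆ range fun q : ℤ × (Fin m → ℤ) => (((q.1 : ℝ), fun i => (q.2 i : ℝ)) : Spc m) := by
    rintro _ ⟨k, j, rfl⟩; exact ⟨(k, j), rfl⟩
  exact ((countable_range _).mono this).to_subtype
instance : MeasurableConstVAdd (La m) (Spc m) :=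
  ⟨fun c => show Measurable fun x : Spc m => (c : Spc m) + x from measurable_const_add (c : Spc m)⟩
instance : VAddInvariantMeasure (La m) (Spc m) volume :=
  ⟨fun c s hs => by
    have : (fun x : Spc m => c +ᵥ x) = fun x => (c : Spc m) + x := rfl
    rw [this, measure_preimage_add]⟩
lemma fund (v : Spc m) : IsAddFundamentalDomain (La m) ((fun x => x + v) ⁻¹' cube m) volume := by
  refine IsAddFundamentalDomain.mk' ((measurable_add_const v meas_cube).nullMeasurableSet) fun x => ?_
  have := shift_unique (x + v)
  simpa only [mem_preimage, AddSubgroup.vadd_def, vadd_eq_add, add_assoc] using this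
lemma int_shift {f : Spc m → F} (hf : Per (La m : Set (Spc m)) f) (v : Spc m) :
    ∫ x, f (x + v) ∂(μT m) = ∫ x, f x ∂(μT m) := by
  have h1 := (fund (m := m) (-v)).setIntegral_eq (fund 0) (f := f) (fun g x => by
    rw [AddSubgroup.vadd_def, vadd_eq_add, add_comm]; exact hf _ g.2 x)
  have hp : MeasurePreserving (fun x : Spc m => x + v) volume volume := measurePreserving_add_right volume v
  have h2 := hp.setIntegral_preimage_emb (measurableEmbedding_addRight v) f ((fun x => x + -v) ⁻¹' cube m)
  simp only [preimage_preimage, add_neg_cancel_right, preimage_id', add_zero] at h1 h2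
  rw [μT, h2, h1]
lemma lint_shift {f : Spc m → ℝ≥0∞} (hf : Per (La m : Set (Spc m)) f) (v : Spc m) :
    ∫⁻ x, f (x + v) ∂(μT m) = ∫⁻ x, f x ∂(μT m) := by
  have h1 := (fund (m := m) (-v)).setLIntegral_eq (fund 0) f (fun g x => by
    rw [AddSubgroup.vadd_def, vadd_eq_add, add_comm]; exact hf _ g.2 x)
  have hp : MeasurePreserving (fun x : Spc m => x + v) volume volume := measurePreserving_add_right volume v
  have h2 := hp.setLIntegral_comp_preimage_emb (measurableEmbedding_addRight v) f ((fun x => x + -v) ⁻¹' cube m)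
  simp only [preimage_preimage, add_neg_cancel_right, preimage_id', add_zero] at h1 h2
  rw [μT, h2, h1]
lemma int_deriv {f g : Spc m → ℝ} {v : Spc m} (hv : v ∈ La m) (hf : Per (La m : Set (Spc m)) f)
    (hg : Per (La m : Set (Spc m)) g) (hd : ∀ x, HasLineDerivAt ℝ f (g x) x v)
    (hgm : Measurable g) (hi : Integrable g (μT m)) : ∫ x, g x ∂(μT m) = 0 := by
  have hper : ∀ s : ℝ, ∫ x, g (x + s • v) ∂(μT m) = ∫ x, g x ∂(μT m) := fun s => int_shift hg _
  have hI : Integrable (fun q : Spc m × ℝ => g (q.1 + q.2 • v)) ((μT m).prod (volume.restrict (Ioc (0 : ℝ) 1))) := by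
    have hm : Measurable fun q : Spc m × ℝ => g (q.1 + q.2 • v) := hgm.comp (by fun_prop)
    rw [integrable_prod_iff' hm.aestronglyMeasurable]
    refine ⟨ae_of_all _ fun s => ?_, ?_⟩
    · refine ⟨(hgm.comp (by fun_prop)).aestronglyMeasurable, ?_⟩
      have := lint_shift (f := fun x => ‖g x‖ₑ) (fun k hk x => by simp only [hg k hk x]) (s • v)
      rw [HasFiniteIntegral, this]; exact hi.2
    · have : ∀ s : ℝ, ∫ x, ‖g (x + s • v)‖ ∂(μT m) = ∫ x, ‖g x‖ ∂(μT m) := fun s =>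
        int_shift (f := fun x => ‖g x‖) (fun k hk x => by simp only [hg k hk x]) _
      simp only [this]; exact integrable_const _
  have h1 := integral_integral_swap (f := fun x s => g (x + s • v)) hI
  simp only [hper, integral_const, measureReal_restrict_apply_univ, Real.volume_real_Ioc, sub_zero, zero_le_one, max_eq_left, smul_eq_mul, one_mul] at h1
  rw [← h1, integral_congr_ae (g := fun _ => (0 : ℝ)) ?_, integral_zero]
  filter_upwards [hI.prod_right_ae] with x hx
  have := intervalIntegral.integral_eq_sub_of_hasDerivAt (f := fun s : ℝ => f (x + s • v))
    (f' := fun s => g (x + s • v)) (a := 0) (b := 1) (fun s _ => by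
      have := hd (x + s • v)
      rw [HasLineDerivAt] at this
      have h2 := HasDerivAt.comp_sub_const (f := fun t => f (x + s • v + t • v)) s s (by simpa using this)
      refine h2.congr_of_eventuallyEq (Eventually.of_forall fun r => ?_)
      simp only [sub_smul]; congr 1; abel) ((intervalIntegrable_iff_integrableOn_Ioc_of_le zero_le_one).2 hx)
  rw [intervalIntegral.integral_of_le zero_le_one] at this
  rw [this, one_smul, zero_smul, add_zero, hf v hv, sub_self]
lemma e1_mem : e1 m ∈ La m := ⟨1, 0, by ext <;> simp [e1]⟩
lemma eC_mem (i : Fin m) : eC m i ∈ La m :=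
  ⟨0, Pi.single i 1, by ext j <;> simp [eC, Pi.single_apply]⟩
lemma shift_ball (x : Spc m) : ∃ k ∈ La m, x + k ∈ Metric.closedBall (0 : Spc m) 1 := by
  obtain ⟨g, hg, -⟩ := shift_unique x
  refine ⟨g, g.2, ?_⟩
  rw [AddSubgroup.vadd_def, vadd_eq_add, add_comm, mem_cube] at hg
  rw [mem_closedBall_zero_iff, norm_prod_le_iff, pi_norm_le_iff_of_nonneg zero_le_one]
  exact ⟨abs_le.2 ⟨by linarith [hg.1.1], hg.1.2.le⟩, fun i => abs_le.2 ⟨by linarith [(hg.2 i).1], (hg.2 i).2.le⟩⟩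
lemma per_bdd {f : Spc m → F} (hf : Per (La m : Set (Spc m)) f) (hc : Continuous f) : ∃ C, ∀ x, ‖f x‖ ≤ C := by
  obtain ⟨C, hC⟩ := (isCompact_closedBall (0 : Spc m) 1).exists_bound_of_continuousOn hc.continuousOn
  refine ⟨C, fun x => ?_⟩
  obtain ⟨k, hk, hx⟩ := shift_ball x
  rw [← hf k hk x]; exact hC _ hx
def toB (f : Spc m → F) (hf : Per (La m : Set (Spc m)) f) (hc : Continuous f) : Spc m →ᵇ F :=
  BoundedContinuousFunction.ofNormedAddCommGroup f hc _ (per_bdd hf hc).choose_spec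
lemma per_uc {f : Spc m → F} (hf : Per (La m : Set (Spc m)) f) (hc : Continuous f) : UniformContinuous f := by
  have h := (isCompact_closedBall (0 : Spc m) 2).uniformContinuousOn_of_continuous hc.continuousOn
  rw [Metric.uniformContinuousOn_iff] at h
  rw [Metric.uniformContinuous_iff]
  intro ε hε
  obtain ⟨δ, hδ, h⟩ := h ε hε
  refine ⟨min δ 1, lt_min hδ one_pos, fun {x y} hxy => ?_⟩
  obtain ⟨k, hk, hx⟩ := shift_ball x
  rw [← hf k hk x, ← hf k hk y]
  have e : dist (x + k) (y + k) = dist x y := dist_add_right _ _ _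
  have e2 := dist_triangle (y + k) (x + k) 0
  rw [mem_closedBall_iff_norm, sub_zero, ← dist_zero_right] at hx
  rw [dist_comm (y + k) (x + k), e] at e2
  have h3 := min_le_right δ 1
  refine h _ ?_ _ ?_ (by rw [e]; exact hxy.trans_le (min_le_left _ _)) <;>
    rw [Metric.mem_closedBall] <;> linarith
lemma per_fderiv {f : Spc m → F} {Λ : Set (Spc m)} (hf : Per Λ f) : Per Λ (fderiv ℝ f) := fun k hk x => by
  rw [← fderiv_comp_add_right]; congr 1; ext y; exact hf k hk y
lemma avg0_le (f : Spc m →ᵇ F) (x : Spc m) : ‖∫ y in cube1 m, f (x.1, y)‖ ≤ ‖f‖ :=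
  (norm_integral_le_of_norm_le_const (ae_of_all _ fun y => f.norm_coe_le_norm _)).trans (by simp)
def avg0 (f : Spc m →ᵇ F) : Spc m →ᵇ F :=
  BoundedContinuousFunction.ofNormedAddCommGroup (fun x => ∫ y in cube1 m, f (x.1, y))
    (continuous_of_dominated (bound := fun _ => ‖f‖) (fun x => by apply Continuous.aestronglyMeasurable; fun_prop)
      (fun x => ae_of_all _ fun y => f.norm_coe_le_norm _) (integrable_const _)
      (ae_of_all _ fun y => by fun_prop)) ‖f‖
    (avg0_le f)
lemma avg0_int (f : Spc m →ᵇ F) (x : ℝ) : Integrable (fun y => f (x, y)) (volume.restrict (cube1 m)) :=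
  Integrable.of_bound (by apply Continuous.aestronglyMeasurable; fun_prop) ‖f‖
    (ae_of_all _ fun y => f.norm_coe_le_norm _)
def Avg : (Spc m →ᵇ F) →L[ℝ] (Spc m →ᵇ F) :=
  LinearMap.mkContinuous { toFun := avg0, map_add' := fun f g => by
                             ext x; exact integral_add (avg0_int f x.1) (avg0_int g x.1),
                           map_smul' := fun c f => by ext x; exact integral_smul c _ } 1
    (fun f => by
      rw [one_mul]
      exact BoundedContinuousFunction.norm_ofNormedAddCommGroup_le _ (norm_nonneg f) (avg0_le f))
lemma Avg_apply (f : Spc m →ᵇ F) (x : Spc m) : Avg f x = ∫ y in cube1 m, f (x.1, y) := rfl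
lemma Avg_norm (f : Spc m →ᵇ F) : ‖Avg f‖ ≤ ‖f‖ :=
  BoundedContinuousFunction.norm_ofNormedAddCommGroup_le _ (norm_nonneg f) (avg0_le f)
def P1 (m : ℕ) : Spc m →L[ℝ] Spc m := (ContinuousLinearMap.inl ℝ ℝ _).comp (ContinuousLinearMap.fst ℝ ℝ _)
def ev (v : Spc m) : (Spc m →ᵇ (Spc m →L[ℝ] F)) →L[ℝ] (Spc m →ᵇ F) :=
  (ContinuousLinearMap.apply ℝ F v).compLeftContinuousBounded (Spc m)
lemma ev_apply (v : Spc m) (f : Spc m →ᵇ (Spc m →L[ℝ] F)) (x : Spc m) : ev v f x = f x v := rfl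
lemma ev_norm (v : Spc m) (f : Spc m →ᵇ (Spc m →L[ℝ] F)) : ‖ev v f‖ ≤ ‖f‖ * ‖v‖ :=
  (BoundedContinuousFunction.norm_le (by positivity)).2 fun x =>
    ((f x).le_opNorm v).trans (by gcongr; exact f.norm_coe_le_norm x)
lemma Avg_D1 {f : Spc m →ᵇ F} {f'} (h : D1 f f') (x : Spc m) :
    HasFDerivAt (Avg f) ((ContinuousLinearMap.fst ℝ ℝ (Fin m → ℝ)).smulRight (Avg (ev (e1 m) f') x)) x := by
  have hP : ∀ y : Fin m → ℝ, Continuous fun x : Spc m => (f' (x.1, y)).comp (P1 m) := fun y => by fun_prop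
  have := hasFDerivAt_integral_of_dominated_of_fderiv_le (μ := volume.restrict (cube1 m)) (s := univ)
    (F := fun x y => f (x.1, y)) (F' := fun x y => (f' (x.1, y)).comp (P1 m)) (x₀ := x)
    (bound := fun _ => ‖f'‖ * ‖P1 m‖) Filter.univ_mem
    (Eventually.of_forall fun x => (avg0_int f x.1).1)
    (avg0_int f x.1) (by apply Continuous.aestronglyMeasurable; fun_prop)
    (ae_of_all _ fun y z _ => (ContinuousLinearMap.opNorm_comp_le _ _).trans
      (mul_le_mul_of_nonneg_right (f'.norm_coe_le_norm _) (norm_nonneg _))) (integrable_const _)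
    (ae_of_all _ fun y z _ => by
      have h2 : HasFDerivAt (fun x : Spc m => ((x.1, y) : Spc m)) (P1 m) z :=
        ((ContinuousLinearMap.fst ℝ ℝ (Fin m → ℝ)).hasFDerivAt.prodMk (hasFDerivAt_const y z)).congr_fderiv
          (by ext <;> simp [P1])
      exact (h (z.1, y)).comp z h2)
  have hint : Integrable (fun y => (f' (x.1, y)).comp (P1 m)) (volume.restrict (cube1 m)) :=
    Integrable.of_bound (by apply Continuous.aestronglyMeasurable; fun_prop) (‖f'‖ * ‖P1 m‖)
      (ae_of_all _ fun y => (ContinuousLinearMap.opNorm_comp_le _ _).trans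
      (mul_le_mul_of_nonneg_right (f'.norm_coe_le_norm _) (norm_nonneg _)))
  refine HasFDerivAt.congr_fderiv this ?_
  refine ContinuousLinearMap.ext fun v => ?_
  rw [ContinuousLinearMap.integral_apply hint, ContinuousLinearMap.smulRight_apply, Avg_apply, ← integral_smul]
  refine integral_congr_ae (ae_of_all _ fun y => ?_)
  have : P1 m v = v.1 • e1 m := by ext <;> simp [P1, e1]
  simp only [ContinuousLinearMap.comp_apply, this, map_smul]; rfl
end FP
end
noncomputable section
namespace FP
open scoped Topology BoundedContinuousFunction
set_option linter.unusedSectionVars false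
set_option maxSynthPendingDepth 3
open GS
attribute [local irreducible] P D
variable {m : ℕ} {F : Type} [NormedAddCommGroup F] [NormedSpace ℝ F] [CompleteSpace F]
def dir (m : ℕ) : Option (Fin m) → Spc m
  | none => e1 m
  | some i => eC m i
lemma D1.mul {f g : Spc m →ᵇ ℝ} {f' g'} (hf : D1 f f') (hg : D1 g g') : D1 (f * g) (f • g' + g • f') :=
  fun x => (hf x).mul (hg x)
def nem (h : (ℝ × ℝ) →ᵇ ℝ) (a b : Spc m →ᵇ ℝ) : Spc m →ᵇ ℝ :=
  BoundedContinuousFunction.ofNormedAddCommGroup (fun x => h (a x, b x)) (by fun_prop) ‖h‖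
    (fun x => h.norm_coe_le_norm _)
lemma nem_norm (h : (ℝ × ℝ) →ᵇ ℝ) (a b : Spc m →ᵇ ℝ) : ‖nem h a b‖ ≤ ‖h‖ :=
  BoundedContinuousFunction.norm_ofNormedAddCommGroup_le _ (norm_nonneg h) (fun x => h.norm_coe_le_norm _)
lemma nem_apply (h : (ℝ × ℝ) →ᵇ ℝ) (a b : Spc m →ᵇ ℝ) (x : Spc m) : nem h a b x = h (a x, b x) := rfl
abbrev X (m : ℕ) := Spc m →ᵇ ℝ
abbrev X' (m : ℕ) := Spc m →ᵇ (Spc m →L[ℝ] ℝ)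
structure Cf (m : ℕ) where
  g : Option (Fin m) → X m
  g' : Option (Fin m) → X' m
  ca : X m
  ca' : X' m
  cb : X m
  cb' : X' m
  bV : X m
  bV' : X' m
  h : (ℝ × ℝ) →ᵇ ℝ
  ha : (ℝ × ℝ) →ᵇ ℝ
  hb : (ℝ × ℝ) →ᵇ ℝ
  K : ℝ
  K0 : 0 ≤ K
  dg : ∀ o, D1 (g o) (g' o)
  dca : D1 ca ca'
  dcb : D1 cb cb'
  dbV : D1 bV bV'
  pg : ∀ o, Per (La m : Set (Spc m)) (g o)
  pca : Per (La m : Set (Spc m)) ca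
  pcb : Per (La m : Set (Spc m)) cb
  pca' : Per (La m : Set (Spc m)) ca'
  pcb' : Per (La m : Set (Spc m)) cb'
  pbV : Per (La m : Set (Spc m)) bV
  dh : ∀ p, HasFDerivAt h (ha p • ContinuousLinearMap.fst ℝ ℝ ℝ + hb p • ContinuousLinearMap.snd ℝ ℝ ℝ) p
  lh : ∀ p q, |h p - h q| ≤ K * ‖p - q‖
  lha : ∀ p q, |ha p - ha q| ≤ K * ‖p - q‖
  lhb : ∀ p q, |hb p - hb q| ≤ K * ‖p - q‖
namespace Cf
variable (c : Cf m)
def A (z : X m × X' m) : X m := Avg (c.ca * z.1)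
def B (z : X m × X' m) : X m := Avg (c.cb * z.1)
def A1 (z : X m × X' m) : X m := Avg (ev (e1 m) c.ca' * z.1 + c.ca * ev (e1 m) z.2)
def B1 (z : X m × X' m) : X m := Avg (ev (e1 m) c.cb' * z.1 + c.cb * ev (e1 m) z.2)
def ph (z : X m × X' m) : X m := nem c.h (c.A z) (c.B z)
def ph1 (z : X m × X' m) : X m := nem c.ha (c.A z) (c.B z) * c.A1 z + nem c.hb (c.A z) (c.B z) * c.B1 z
def N (z : X m × X' m) : X m :=
  -(∑ o, c.g o * ev (dir m o) z.2) - c.ph z * ev (e1 m) z.2 - c.ph1 z * z.1 + c.bV * c.ph z * z.1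
end Cf
section lip
variable {Z Y : Type} [NormedAddCommGroup Z] [NormedSpace ℝ Z] [NormedAddCommGroup Y] [NormedSpace ℝ Y]
def LB (T : Z → Y) : Prop := ∀ R, ∃ K, 0 ≤ K ∧ ∀ a b, ‖a‖ ≤ R → ‖b‖ ≤ R → ‖T a - T b‖ ≤ K * ‖a - b‖
lemma LB.add {S T : Z → Y} (hS : LB S) (hT : LB T) : LB fun z => S z + T z := fun R => by
  obtain ⟨K, h0, h⟩ := hS R
  obtain ⟨K', h0', h'⟩ := hT R
  refine ⟨K + K', by positivity, fun a b ha hb => ?_⟩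
  rw [add_sub_add_comm, add_mul]
  exact norm_add_le_of_le (h a b ha hb) (h' a b ha hb)
lemma LB.clm (T : Z →L[ℝ] Y) : LB T := fun R =>
  ⟨‖T‖, norm_nonneg _, fun a b _ _ => by rw [← map_sub]; exact T.le_opNorm _⟩
lemma LB.comp {T : Z → Y} (hT : LB T) {Y2 : Type} [NormedAddCommGroup Y2] [NormedSpace ℝ Y2]
    (S : Y →L[ℝ] Y2) : LB fun z => S (T z) := fun R => by
  obtain ⟨K, h0, h⟩ := hT R
  refine ⟨‖S‖ * K, by positivity, fun a b ha hb => ?_⟩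
  rw [← map_sub, mul_assoc]
  exact (S.le_opNorm _).trans (by gcongr; exact h a b ha hb)
lemma LB.neg {T : Z → Y} (hT : LB T) : LB fun z => -T z := fun R => by
  obtain ⟨K, h0, h⟩ := hT R
  exact ⟨K, h0, fun a b ha hb => by rw [neg_sub_neg, norm_sub_rev]; exact h a b ha hb⟩
lemma LB.sum {ι : Type} {s : Finset ι} {T : ι → Z → Y} (hT : ∀ i, LB (T i)) : LB fun z => ∑ i ∈ s, T i z := by
  classical
  induction s using Finset.induction_on with
  | empty => simp only [Finset.sum_empty]; exact fun R => ⟨0, le_rfl, fun a b _ _ => by simp⟩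
  | insert i s hi ih => simpa only [Finset.sum_insert hi] using (hT i).add ih
lemma LB.mul {S T : Z → X m} (hS : LB S) (hT : LB T) : LB fun z => S z * T z := fun R => by
  obtain ⟨K, h0, h⟩ := hS |R|
  obtain ⟨K', h0', h'⟩ := hT |R|
  have bd : ∀ {T : Z → X m} {K}, 0 ≤ K → (∀ a b, ‖a‖ ≤ |R| → ‖b‖ ≤ |R| → ‖T a - T b‖ ≤ K * ‖a - b‖) → ∀ a, ‖a‖ ≤ |R| →
      ‖T a‖ ≤ K * |R| + ‖T 0‖ := fun {T K} h0 h a ha => by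
    have h1 := h a 0 ha (by simp)
    rw [sub_zero] at h1
    have h2 := norm_add_le (T a - T 0) (T 0)
    rw [sub_add_cancel] at h2
    nlinarith [mul_le_mul_of_nonneg_left ha h0]
  refine ⟨(K * |R| + ‖S 0‖) * K' + K * (K' * |R| + ‖T 0‖), by positivity, fun a b ha hb => ?_⟩
  replace ha := ha.trans (le_abs_self R)
  replace hb := hb.trans (le_abs_self R)
  have e : S a * T a - S b * T b = S a * (T a - T b) + (S a - S b) * T b := by ring
  rw [e]
  calc _ ≤ ‖S a‖ * ‖T a - T b‖ + ‖S a - S b‖ * ‖T b‖ :=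
        (norm_add_le _ _).trans (add_le_add (norm_mul_le _ _) (norm_mul_le _ _))
    _ ≤ (K * |R| + ‖S 0‖) * (K' * ‖a - b‖) + (K * ‖a - b‖) * (K' * |R| + ‖T 0‖) :=
        add_le_add (mul_le_mul (bd h0 h a ha) (h' a b ha hb) (norm_nonneg _) (by positivity))
          (mul_le_mul (h a b ha hb) (bd h0' h' b hb) (norm_nonneg _) (by positivity))
    _ = _ := by ring
lemma LB.const (f : Y) : LB fun _ : Z => f := fun R => ⟨0, le_rfl, fun a b _ _ => by simp⟩
lemma LB.nem {h : (ℝ × ℝ) →ᵇ ℝ} {K : ℝ} (hK : 0 ≤ K) (lh : ∀ p q, |h p - h q| ≤ K * ‖p - q‖)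
    {S T : Z → X m} (hS : LB S) (hT : LB T) : LB fun z => nem h (S z) (T z) := fun R => by
  obtain ⟨K1, h0, h1⟩ := hS R
  obtain ⟨K2, h0', h2⟩ := hT R
  refine ⟨K * (K1 + K2), by positivity, fun a b ha hb => ?_⟩
  refine (BoundedContinuousFunction.norm_le (by positivity)).2 fun x => ?_
  refine (lh _ _).trans ?_
  rw [mul_assoc]
  refine mul_le_mul_of_nonneg_left ?_ hK
  have e1 := ((S a - S b).norm_coe_le_norm x).trans (h1 a b ha hb)
  have e2 := ((T a - T b).norm_coe_le_norm x).trans (h2 a b ha hb)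
  have : 0 ≤ ‖a - b‖ := norm_nonneg _
  rw [norm_prod_le_iff]
  constructor
  · refine (le_of_eq rfl).trans (e1.trans ?_); nlinarith
  · refine (le_of_eq rfl).trans (e2.trans ?_); nlinarith
end lip
namespace Cf
variable (c : Cf m)
lemma lbA : LB c.A := ((LB.const c.ca).mul (LB.clm (ContinuousLinearMap.fst ℝ (X m) (X' m)))).comp Avg
lemma lbB : LB c.B := ((LB.const c.cb).mul (LB.clm (ContinuousLinearMap.fst ℝ (X m) (X' m)))).comp Avg
lemma lbe (v : Spc m) : LB fun z : X m × X' m => ev v z.2 :=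
  LB.clm ((ev v).comp (ContinuousLinearMap.snd ℝ (X m) (X' m)))
lemma lbf : LB fun z : X m × X' m => z.1 := LB.clm (ContinuousLinearMap.fst ℝ (X m) (X' m))
lemma lbA1 : LB c.A1 := LB.comp (((LB.const _).mul (lbf (m := m))).add ((LB.const _).mul (lbe (m := m) _))) Avg
lemma lbB1 : LB c.B1 := LB.comp (((LB.const _).mul (lbf (m := m))).add ((LB.const _).mul (lbe (m := m) _))) Avg
lemma lbph : LB c.ph := LB.nem c.K0 c.lh c.lbA c.lbB
lemma lbph1 : LB c.ph1 :=
  ((LB.nem c.K0 c.lha c.lbA c.lbB).mul c.lbA1).add ((LB.nem c.K0 c.lhb c.lbA c.lbB).mul c.lbB1)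
lemma lbN : LB c.N := by
  have := ((((LB.sum (s := Finset.univ) fun o => (LB.const (c.g o)).mul (lbe (dir m o))).neg).add
    (c.lbph.mul (lbe (e1 m))).neg).add (c.lbph1.mul lbf).neg).add (((LB.const c.bV).mul c.lbph).mul lbf)
  simp only [← sub_eq_add_neg] at this
  exact this
def dx1 : X m →L[ℝ] X' m :=
  ContinuousLinearMap.compLeftContinuousBounded (Spc m)
    (ContinuousLinearMap.smulRightL ℝ (Spc m) ℝ (ContinuousLinearMap.fst ℝ ℝ (Fin m → ℝ)))
lemma dx1_apply (f : X m) (x v : Spc m) : dx1 f x v = v.1 * f x := rfl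
lemma ev_dx1 (f : X m) : ev (e1 m) (dx1 f) = f := by
  ext x; rw [ev_apply, dx1_apply]; simp [e1]
lemma dph {f : X m} {f'} (hf : D1 f f') : D1 (c.ph (f, f')) (dx1 (c.ph1 (f, f'))) := by
  have key : ∀ {q : X m} {q'}, D1 q q' → ∀ x, HasFDerivAt (Avg (q * f)) ((ContinuousLinearMap.fst ℝ ℝ (Fin m → ℝ)).smulRight
      (Avg (ev (e1 m) q' * f + q * ev (e1 m) f') x)) x := fun {q q'} hq x => by
    have := Avg_D1 (hq.mul hf) x
    have e : ev (e1 m) (q • f' + f • q') = ev (e1 m) q' * f + q * ev (e1 m) f' := by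
      ext y; show q y * f' y (e1 m) + f y * q' y (e1 m) = q' y (e1 m) * f y + q y * f' y (e1 m); ring
    rwa [e] at this
  intro x
  have h1 : HasFDerivAt (fun x => c.h (c.A (f, f') x, c.B (f, f') x)) _ x :=
    HasFDerivAt.comp x (c.dh (c.A (f, f') x, c.B (f, f') x))
      (HasFDerivAt.prodMk (f₁ := c.A (f, f')) (f₂ := c.B (f, f')) (key c.dca x) (key c.dcb x))
  refine HasFDerivAt.congr_fderiv h1 (ContinuousLinearMap.ext fun v => ?_)
  rw [dx1_apply]
  simp [ph1, A1, B1, nem_apply]; ring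
end Cf
end FP
end
noncomputable section
namespace FP
open scoped Topology BoundedContinuousFunction
set_option linter.unusedSectionVars false
set_option maxSynthPendingDepth 3
open GS
attribute [local irreducible] P D
variable {m : ℕ}
namespace Cf
variable (c : Cf m)
lemma Per_Avg {f : X m} (hf : Per (La m : Set (Spc m)) f) : Per (La m : Set (Spc m)) (Avg f) := by
  rintro _ ⟨k, j, rfl⟩ x
  rw [Avg_apply, Avg_apply]
  refine integral_congr_ae (ae_of_all _ fun y => ?_)
  have := hf ((k : ℝ), 0) ⟨k, 0, by ext <;> simp⟩ (x.1, y)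
  simpa using this
lemma Avg_const (f : X m) (x v : Spc m) (hv : v.1 = 0) (h : ℝ) : Avg f (x + h • v) = Avg f x := by
  rw [Avg_apply, Avg_apply]; simp [hv]
lemma norm_dir (o : Option (Fin m)) : ‖dir m o‖ ≤ 1 := by
  rw [norm_prod_le_iff, pi_norm_le_iff_of_nonneg zero_le_one]
  cases o with
  | none => simp [dir, e1]
  | some i =>
    refine ⟨by simp [dir, eC], fun j => ?_⟩
    by_cases h : j = i
    · subst h; simp [dir, eC]
    · simp [dir, eC, h]
lemma norm_e1 : ‖e1 m‖ ≤ 1 := norm_dir none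
lemma ev_le {v : Spc m} (hv : ‖v‖ ≤ 1) (f : X' m) : ‖ev v f‖ ≤ ‖f‖ :=
  (ev_norm v f).trans (mul_le_of_le_one_right (norm_nonneg _) hv)
lemma bdA1 {q f : X m} {q' f' : X' m} :
    ‖Avg (ev (e1 m) q' * f + q * ev (e1 m) f')‖ ≤ ‖q'‖ * ‖f‖ + ‖q‖ * ‖f'‖ := by
  refine (Avg_norm _).trans (norm_add_le_of_le ((norm_mul_le _ _).trans ?_) ((norm_mul_le _ _).trans ?_))
  · exact mul_le_mul_of_nonneg_right (ev_le norm_e1 _) (norm_nonneg _)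
  · exact mul_le_mul_of_nonneg_left (ev_le norm_e1 _) (norm_nonneg _)
lemma bd_ph (z : X m × X' m) : ‖c.ph z‖ ≤ ‖c.h‖ := nem_norm _ _ _
lemma bd_ph1 (z : X m × X' m) : ‖c.ph1 z‖ ≤ ‖c.ha‖ * (‖c.ca'‖ * ‖z.1‖ + ‖c.ca‖ * ‖z.2‖) +
    ‖c.hb‖ * (‖c.cb'‖ * ‖z.1‖ + ‖c.cb‖ * ‖z.2‖) :=
  norm_add_le_of_le
    ((norm_mul_le _ _).trans (mul_le_mul (nem_norm _ _ _) bdA1 (norm_nonneg _) (norm_nonneg _)))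
    ((norm_mul_le _ _).trans (mul_le_mul (nem_norm _ _ _) bdA1 (norm_nonneg _) (norm_nonneg _)))
lemma ev_HD {κ : ℝ} (hκ : 0 < κ) : ∃ C, 0 ≤ C ∧ ∀ (v : Spc m), ‖v‖ ≤ 1 → ∀ (f : X m) f', D1 f f' → ∀ r, 0 < r →
    ‖H κ r (ev v f')‖ ≤ C * r ^ (-(1/2) : ℝ) * ‖f‖ := by
  obtain ⟨C, hC, h⟩ := HD_bound (E := Spc m) (F := ℝ) hκ
  refine ⟨C, hC, fun v hv f f' hf r hr => ?_⟩
  have e : H κ r (ev v f') = ev v (HD κ r f) := by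
    rw [HD_eq hκ hr hf]
    ext x
    have hi : Integrable (fun z : Spc m => f' (x + √(2*κ*r) • z)) γ := admId.int2 f' _ x
    rw [ev_apply, H, H, P_apply, P_apply]
    exact (ContinuousLinearMap.integral_apply hi v).symm
  rw [e]
  exact (ev_le hv _).trans (h r hr f)
def UH (S : Set (Fin m × X m × X' m)) (T : X m × X' m → X m) : Prop :=
  ∃ C, 0 ≤ C ∧ ∀ q ∈ S, ‖T q.2‖ ≤ C ∧ Hol (eC m q.1) C (T q.2)
variable {S : Set (Fin m × X m × X' m)} {T T2 : X m × X' m → X m}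
lemma UH.add (h : UH S T) (h2 : UH S T2) : UH S fun z => T z + T2 z := by
  obtain ⟨C, hC, h⟩ := h
  obtain ⟨C2, hC2, h2⟩ := h2
  refine ⟨C + C2, by positivity, fun q hq => ⟨norm_add_le_of_le (h q hq).1 (h2 q hq).1, fun x r => ?_⟩⟩
  rw [BoundedContinuousFunction.add_apply, BoundedContinuousFunction.add_apply, add_sub_add_comm, add_mul]
  exact norm_add_le_of_le ((h q hq).2 x r) ((h2 q hq).2 x r)
lemma UH.neg (h : UH S T) : UH S fun z => -T z := by
  obtain ⟨C, hC, h⟩ := h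
  refine ⟨C, hC, fun q hq => ⟨by rw [norm_neg]; exact (h q hq).1, fun x r => ?_⟩⟩
  rw [BoundedContinuousFunction.neg_apply, BoundedContinuousFunction.neg_apply, neg_sub_neg, norm_sub_rev]
  exact (h q hq).2 x r
lemma UH.mul (h : UH S T) (h2 : UH S T2) : UH S fun z => T z * T2 z := by
  obtain ⟨C, hC, h⟩ := h
  obtain ⟨C2, hC2, h2⟩ := h2
  refine ⟨2 * (C * C2), by positivity, fun q hq => ⟨?_, fun x r => ?_⟩⟩
  · have := (norm_mul_le (T q.2) (T2 q.2)).trans (mul_le_mul (h q hq).1 (h2 q hq).1 (norm_nonneg _) hC)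
    nlinarith [mul_nonneg hC hC2]
  · rw [BoundedContinuousFunction.mul_apply, BoundedContinuousFunction.mul_apply]
    set y := x + r • eC m q.1
    have e : T q.2 y * T2 q.2 y - T q.2 x * T2 q.2 x = T q.2 y * (T2 q.2 y - T2 q.2 x) +
      (T q.2 y - T q.2 x) * T2 q.2 x := by ring
    rw [e]
    refine (norm_add_le_of_le (norm_mul_le _ _) (norm_mul_le _ _)).trans ?_
    have a1 := mul_le_mul (((T q.2).norm_coe_le_norm y).trans (h q hq).1) ((h2 q hq).2 x r) (norm_nonneg _) hC
    have a2 := mul_le_mul ((h q hq).2 x r) (((T2 q.2).norm_coe_le_norm x).trans (h2 q hq).1) (norm_nonneg _)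
      (by positivity)
    refine (add_le_add a1 a2).trans (le_of_eq (by ring))
lemma UH.sum {ι : Type} {s : Finset ι} {T : ι → X m × X' m → X m} (h : ∀ i, UH S (T i)) :
    UH S fun z => ∑ i ∈ s, T i z := by
  classical
  induction s using Finset.induction_on with
  | empty => exact ⟨0, le_rfl, fun q _ => ⟨by simp, fun x r => by simp⟩⟩
  | insert i s hi ih => simpa only [Finset.sum_insert hi] using (h i).add ih
lemma UH.const {C : ℝ} (h1 : ∀ q ∈ S, ‖T q.2‖ ≤ C)
    (h2 : ∀ q ∈ S, ∀ x (r : ℝ), T q.2 (x + r • eC m q.1) = T q.2 x) : UH S T :=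
  ⟨|C|, abs_nonneg _, fun q hq => ⟨(h1 q hq).trans (le_abs_self _), fun x r => by
    rw [h2 q hq, sub_self, norm_zero]; positivity⟩⟩
lemma UH.d1 {R : ℝ} (h : ∀ q ∈ S, ‖T q.2‖ ≤ R ∧ ∃ T' : X' m, D1 (T q.2) T' ∧ ‖T'‖ ≤ R) : UH S T := by
  refine ⟨2 * |R|, by positivity, fun q hq => ?_⟩
  obtain ⟨h1, T', hT, h2⟩ := h q hq
  have hR := le_abs_self R
  refine ⟨by linarith [abs_nonneg R], fun x r => ?_⟩
  rcases le_total |r| 1 with hr | hr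
  · have := norm_sub_le hT (x + r • eC m q.1) x
    rw [add_sub_cancel_left, norm_smul, Real.norm_eq_abs] at this
    have h3 : |r| ≤ |r| ^ (1/2 : ℝ) := by
      simpa using Real.rpow_le_rpow_of_exponent_ge' (abs_nonneg r) hr (by norm_num) (by norm_num : (1/2 : ℝ) ≤ 1)
    have h4 : |r| * ‖eC m q.1‖ ≤ |r| := mul_le_of_le_one_right (abs_nonneg _) (norm_dir (some q.1))
    refine this.trans ((mul_le_mul (h2.trans hR) (h4.trans h3) (by positivity) (abs_nonneg _)).trans ?_)
    nlinarith [mul_nonneg (abs_nonneg R) (Real.rpow_nonneg (abs_nonneg r) (1/2))]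
  · have h3 : (1 : ℝ) ≤ |r| ^ (1/2 : ℝ) := Real.one_le_rpow hr (by norm_num)
    have := (_root_.norm_sub_le (T q.2 (x + r • eC m q.1)) (T q.2 x)).trans (add_le_add
      (((T q.2).norm_coe_le_norm _).trans (h1.trans hR)) (((T q.2).norm_coe_le_norm _).trans (h1.trans hR)))
    refine this.trans ?_
    nlinarith [abs_nonneg R]
theorem NL {κ : ℝ} (hκ : 0 < κ) : NL κ (La m : Set (Spc m)) c.N where
  lip := c.lbN
  per f f' hd hf hf' := by
    intro k hk x
    have pA := Per_Avg (f := c.ca * f) (fun k hk x => by simp [c.pca k hk x, hf k hk x]) k hk x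
    have pB := Per_Avg (f := c.cb * f) (fun k hk x => by simp [c.pcb k hk x, hf k hk x]) k hk x
    have pA1 := Per_Avg (f := ev (e1 m) c.ca' * f + c.ca * ev (e1 m) f') (fun k hk x => by
      simp [ev_apply, c.pca k hk x, c.pca' k hk x, hf k hk x, hf' k hk x]) k hk x
    have pB1 := Per_Avg (f := ev (e1 m) c.cb' * f + c.cb * ev (e1 m) f') (fun k hk x => by
      simp [ev_apply, c.pcb k hk x, c.pcb' k hk x, hf k hk x, hf' k hk x]) k hk x
    have hs : ∀ y, (∑ o, c.g o * ev (dir m o) f') y = ∑ o, c.g o y * f' y (dir m o) := fun y => by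
      rw [BoundedContinuousFunction.sum_apply]; rfl
    simp only [N, ph, ph1, A, B, A1, B1, BoundedContinuousFunction.add_apply, BoundedContinuousFunction.sub_apply,
      BoundedContinuousFunction.neg_apply, BoundedContinuousFunction.mul_apply, hs, nem_apply, pA, pB, pA1, pB1,
      ev_apply, hf k hk x, hf' k hk x, c.pbV k hk x, c.pg _ k hk x]
  gr R := by
    set a := ‖c.ha‖ * ‖c.ca'‖ + ‖c.hb‖ * ‖c.cb'‖ with ha
    set b := ‖c.ha‖ * ‖c.ca‖ + ‖c.hb‖ * ‖c.cb‖ with hb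
    set s := ∑ o, ‖c.g o‖ with hs
    have s0 : 0 ≤ s := Finset.sum_nonneg fun _ _ => norm_nonneg _
    refine ⟨s + ‖c.h‖ + (a * |R| + b) * |R| + ‖c.bV‖ * ‖c.h‖ * |R|, by positivity, fun f f' _ hf => ?_⟩
    replace hf := hf.trans (le_abs_self R)
    have t1 : ‖∑ o, c.g o * ev (dir m o) f'‖ ≤ s * ‖f'‖ := by
      rw [hs, Finset.sum_mul]
      exact norm_sum_le_of_le _ fun o _ => (norm_mul_le _ _).trans
        (mul_le_mul_of_nonneg_left (ev_le (norm_dir o) _) (norm_nonneg _))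
    have t2 : ‖c.ph (f, f') * ev (e1 m) f'‖ ≤ ‖c.h‖ * ‖f'‖ := (norm_mul_le _ _).trans
      (mul_le_mul (c.bd_ph _) (ev_le norm_e1 _) (norm_nonneg _) (norm_nonneg _))
    have p1 : ‖c.ph1 (f, f')‖ ≤ a * |R| + b * ‖f'‖ := by
      refine (c.bd_ph1 (f, f')).trans ?_
      have : a * ‖f‖ ≤ a * |R| := mul_le_mul_of_nonneg_left hf (by positivity)
      simp only [ha, hb] at this ⊢; linarith
    have t3 : ‖c.ph1 (f, f') * f‖ ≤ (a * |R| + b * ‖f'‖) * |R| := (norm_mul_le _ _).trans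
      (mul_le_mul p1 hf (norm_nonneg _) (by positivity))
    have t4 : ‖c.bV * c.ph (f, f') * f‖ ≤ ‖c.bV‖ * ‖c.h‖ * |R| := (norm_mul_le _ _).trans
      (mul_le_mul ((norm_mul_le _ _).trans (mul_le_mul_of_nonneg_left (c.bd_ph _) (norm_nonneg _))) hf (norm_nonneg _)
        (by positivity))
    have := norm_add_le_of_le (norm_sub_le_of_le (norm_sub_le_of_le ((norm_neg _).trans_le t1) t2) t3) t4
    refine this.trans ?_
    have q1 : 0 ≤ ‖f'‖ * (a * |R| * |R| + ‖c.bV‖ * ‖c.h‖ * |R|) := by positivity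
    have q2 : 0 ≤ s + ‖c.h‖ + b * |R| := by positivity
    linarith
  sm L := by
    obtain ⟨C, hC, hev⟩ := ev_HD (m := m) hκ
    set s := ∑ o, ‖c.g o‖ with hs
    set s' := ∑ o, ‖c.g' o‖ with hs'
    have s0 : 0 ≤ s := Finset.sum_nonneg fun _ _ => norm_nonneg _
    have s0' : 0 ≤ s' := Finset.sum_nonneg fun _ _ => norm_nonneg _
    refine ⟨C * s + C * ‖c.h‖ + (s' + ‖c.bV‖ * ‖c.h‖) * |L| ^ (1/2 : ℝ), by positivity, fun f f' hf r hr => ?_⟩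
    have hr0 := hr.1
    have d2 := (c.dph hf).mul hf
    have e : c.N (f, f') = -(∑ o, ev (dir m o) (c.g o • f' + f • c.g' o)) -
        ev (e1 m) (c.ph (f, f') • f' + f • dx1 (c.ph1 (f, f'))) +
        ((∑ o, ev (dir m o) (c.g' o)) * f + c.bV * c.ph (f, f') * f) := by
      have e1' : ∀ (v : Spc m) (a : X m) (b b' : X' m), ev v (a • b + f • b') = a * ev v b + f * ev v b' :=
        fun v a b b' => by ext x; rfl
      rw [N]
      simp only [e1', ev_dx1, Finset.sum_add_distrib, ← Finset.mul_sum]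
      ring
    rw [e, map_add, map_sub, map_neg, map_sum]
    have t1 : ‖∑ o, H κ r (ev (dir m o) (c.g o • f' + f • c.g' o))‖ ≤ C * s * r ^ (-(1/2) : ℝ) * ‖f‖ := by
      rw [hs, Finset.mul_sum, Finset.sum_mul, Finset.sum_mul]
      refine norm_sum_le_of_le _ fun o _ => (hev _ (norm_dir o) _ _ ((c.dg o).mul hf) r hr0).trans ?_
      calc _ ≤ C * r ^ (-(1/2) : ℝ) * (‖c.g o‖ * ‖f‖) := by gcongr; exact norm_mul_le _ _
        _ = _ := by ring
    have t2 : ‖H κ r (ev (e1 m) (c.ph (f, f') • f' + f • dx1 (c.ph1 (f, f'))))‖ ≤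
        C * ‖c.h‖ * r ^ (-(1/2) : ℝ) * ‖f‖ := by
      refine (hev _ norm_e1 _ _ d2 r hr0).trans ?_
      calc _ ≤ C * r ^ (-(1/2) : ℝ) * (‖c.h‖ * ‖f‖) := by
            refine mul_le_mul_of_nonneg_left ((norm_mul_le _ _).trans ?_) (by positivity)
            exact mul_le_mul_of_nonneg_right (c.bd_ph _) (norm_nonneg _)
        _ = _ := by ring
    have t3 : ‖H κ r ((∑ o, ev (dir m o) (c.g' o)) * f + c.bV * c.ph (f, f') * f)‖ ≤
        (s' + ‖c.bV‖ * ‖c.h‖) * ‖f‖ := by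
      refine (P_norm_le _ _).trans ?_
      rw [← add_mul]
      refine (norm_mul_le _ _).trans (mul_le_mul_of_nonneg_right (norm_add_le_of_le ?_ ?_) (norm_nonneg _))
      · exact norm_sum_le_of_le _ fun o _ => ev_le (norm_dir o) _
      · exact (norm_mul_le _ _).trans (mul_le_mul_of_nonneg_left (c.bd_ph _) (norm_nonneg _))
    have hL : (1 : ℝ) ≤ |L| ^ (1/2 : ℝ) * r ^ (-(1/2) : ℝ) := by
      rw [Real.rpow_neg hr0.le, ← div_eq_mul_inv, one_le_div (by positivity)]
      exact Real.rpow_le_rpow hr0.le (hr.2.trans (le_abs_self _)) (by norm_num)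
    have t4 := mul_le_mul_of_nonneg_left hL (show 0 ≤ (s' + ‖c.bV‖ * ‖c.h‖) * ‖f‖ by positivity)
    have := norm_add_le_of_le (norm_sub_le_of_le ((norm_neg _).trans_le t1) t2) t3
    refine this.trans ?_
    have q : 0 ≤ (C * s + C * ‖c.h‖ + (s' + ‖c.bV‖ * ‖c.h‖) * |L| ^ (1/2 : ℝ)) * r ^ (-(1/2) : ℝ) := by positivity
    nlinarith
  hol R K := by
    let S : Set (Fin m × X m × X' m) := {q | D1 q.2.1 q.2.2 ∧ ‖q.2.1‖ ≤ R ∧ ‖q.2.2‖ ≤ R ∧ Hol (eC m q.1) K q.2.2}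
    have hv : ∀ i : Fin m, (eC m i).1 = 0 := fun i => rfl
    have uf : UH S fun z => z.1 := UH.d1 (R := R) fun q hq => ⟨hq.2.1, q.2.2, hq.1, hq.2.2.1⟩
    have ud : ∀ {g : X m} {g'}, D1 g g' → UH S fun _ => g := fun {g g'} hg =>
      UH.d1 (R := max ‖g‖ ‖g'‖) fun q _ => ⟨le_max_left _ _, g', hg, le_max_right _ _⟩
    have ue : ∀ {v : Spc m}, ‖v‖ ≤ 1 → UH S fun z => ev v z.2 := fun {v} hv => by
      refine ⟨|R| + |K|, by positivity, fun q hq => ⟨?_, fun x r => ?_⟩⟩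
      · linarith [ev_le hv q.2.2, hq.2.2.1, le_abs_self R, abs_nonneg K]
      · rw [ev_apply, ev_apply, ← _root_.sub_apply]
        refine (ContinuousLinearMap.le_opNorm _ _).trans ((mul_le_of_le_one_right (norm_nonneg _) hv).trans
          ((hq.2.2.2 x r).trans (mul_le_mul_of_nonneg_right ?_ (by positivity))))
        linarith [le_abs_self K, abs_nonneg R]
    have up : UH S c.ph := UH.const (C := ‖c.h‖) (fun q _ => c.bd_ph _) fun q _ x r => by
      simp only [ph, nem_apply, A, B, Avg_const _ _ _ (hv _)]
    have up1 : UH S c.ph1 := UH.const (C := ‖c.ha‖ * (‖c.ca'‖ * R + ‖c.ca‖ * R) +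
        ‖c.hb‖ * (‖c.cb'‖ * R + ‖c.cb‖ * R)) (fun q hq => (c.bd_ph1 _).trans (by
          have := hq.2.1; have := hq.2.2.1; gcongr)) fun q _ x r => by
      simp only [ph1, BoundedContinuousFunction.add_apply, BoundedContinuousFunction.mul_apply, nem_apply, A, B, A1,
        B1, Avg_const _ _ _ (hv _)]
    have := ((((UH.sum (s := Finset.univ) fun o => (ud (c.dg o)).mul (ue (norm_dir o))).neg).add
      (up.mul (ue norm_e1)).neg).add (up1.mul uf).neg).add (((ud c.dbV).mul up).mul uf)
    simp only [← sub_eq_add_neg] at this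
    obtain ⟨C, hC, h⟩ := this
    exact ⟨C, hC, fun i f f' h1 h2 h3 h4 => (h (i, f, f') ⟨h1, h2, h3, h4⟩).2⟩
end Cf
end FP
end
noncomputable section
namespace FP
open scoped Topology BoundedContinuousFunction
set_option linter.unusedSectionVars false
set_option maxSynthPendingDepth 3
open GS
attribute [local irreducible] P D
variable {m : ℕ} {f g η S : Spc m → ℝ} {v w : Spc m}
abbrev Pr (f : Spc m → ℝ) : Prop := Per (La m : Set (Spc m)) f
lemma Pr.op2 (hf : Pr f) (hg : Pr g) (G : ℝ → ℝ → ℝ) : Pr fun x => G (f x) (g x) := fun k hk x => by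
  simp only [hf k hk x, hg k hk x]
lemma Pr.pd (hf : Pr f) (v) : Pr (pd v f) := fun k hk x => by
  simp only [_root_.pd, per_fderiv hf k hk x]
lemma pd_meas : Measurable (pd v f) := measurable_fderiv_apply_const ℝ f v
lemma Pr.int (hf : Pr f) (hc : Continuous f) : Integrable f (μT m) := by
  obtain ⟨C, hC⟩ := per_bdd hf hc
  exact Integrable.of_bound hc.aestronglyMeasurable C (ae_of_all _ hC)
structure C1p (f : Spc m → ℝ) : Prop where
  p : Pr f
  c : ContDiff ℝ 1 f
structure D1p (f : Spc m → ℝ) : Prop where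
  p : Pr f
  d : Differentiable ℝ f
  i : ∀ v, Integrable (pd v f) (μT m)
structure C2p (f : Spc m → ℝ) : Prop where
  c1 : C1p f
  d2 : ∀ v, D1p (pd v f)
lemma C1p.d (h : C1p f) : Differentiable ℝ f := h.c.differentiable one_ne_zero
lemma C1p.cpd (h : C1p f) (v) : Continuous (pd v f) := (h.c.continuous_fderiv one_ne_zero).clm_apply continuous_const
lemma C1p.d1 (h : C1p f) : D1p f := ⟨h.p, h.d, fun v => (h.p.pd v).int (h.cpd v)⟩
lemma C1p.bd (h : C1p f) : ∃ C, 0 ≤ C ∧ ∀ x, |f x| ≤ C := by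
  obtain ⟨C, hC⟩ := per_bdd h.p h.c.continuous
  exact ⟨C, (norm_nonneg _).trans (hC 0), hC⟩
lemma C1p.int (h : C1p f) : Integrable f (μT m) := h.p.int h.c.continuous
lemma C1p.mul (hf : C1p f) (hg : C1p g) : C1p fun x => f x * g x := ⟨hf.p.op2 hg.p (· * ·), hf.c.mul hg.c⟩
lemma C1p.add (hf : C1p f) (hg : C1p g) : C1p fun x => f x + g x := ⟨hf.p.op2 hg.p (· + ·), hf.c.add hg.c⟩
lemma C1p.sub (hf : C1p f) (hg : C1p g) : C1p fun x => f x - g x := ⟨hf.p.op2 hg.p (· - ·), hf.c.sub hg.c⟩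
lemma C1p.const (k : ℝ) : C1p fun _ : Spc m => k := ⟨fun _ _ _ => rfl, contDiff_const⟩
lemma C1p.comp (hf : C1p f) {G : ℝ → ℝ} (hG : ContDiff ℝ 1 G) : C1p fun x => G (f x) :=
  ⟨hf.p.op2 hf.p fun a _ => G a, hG.comp hf.c⟩
lemma pd_add (hf : Differentiable ℝ f) (hg : Differentiable ℝ g) (x) : pd v (fun x => f x + g x) x = pd v f x + pd v g x := by
  rw [pd, fderiv_fun_add (hf x) (hg x)]; rfl
lemma pd_sub (hf : Differentiable ℝ f) (hg : Differentiable ℝ g) (x) : pd v (fun x => f x - g x) x = pd v f x - pd v g x := by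
  rw [pd, fderiv_fun_sub (hf x) (hg x)]; rfl
lemma pd_mul (hf : Differentiable ℝ f) (hg : Differentiable ℝ g) (x) :
    pd v (fun x => f x * g x) x = f x * pd v g x + g x * pd v f x := by
  rw [pd, fderiv_fun_mul (hf x) (hg x)]; rfl
lemma pd_cmul (k : ℝ) (hf : Differentiable ℝ f) (x) : pd v (fun x => k * f x) x = k * pd v f x := by
  rw [pd, fderiv_const_mul (hf x)]; rfl
lemma pd_const (k : ℝ) (x) : pd v (fun _ : Spc m => k) x = 0 := by simp [pd]
lemma pd_comp {G G' : ℝ → ℝ} (hG : ∀ s, HasDerivAt G (G' s) s) (hf : Differentiable ℝ f) (x) :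
    pd v (fun x => G (f x)) x = G' (f x) * pd v f x := by
  have : HasFDerivAt (fun x => G (f x)) _ x := (hG (f x)).comp_hasFDerivAt x (hf x).hasFDerivAt
  rw [pd, this.fderiv]; rfl
lemma dadd (hf : Differentiable ℝ f) (hg : Differentiable ℝ g) : Differentiable ℝ fun x => f x + g x := hf.add hg
lemma D1p.add (hf : D1p f) (hg : D1p g) : D1p fun x => f x + g x :=
  ⟨hf.p.op2 hg.p (· + ·), hf.d.add hg.d, fun v => by
    rw [show pd v (fun x => f x + g x) = fun x => pd v f x + pd v g x from funext (pd_add hf.d hg.d)]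
    exact (hf.i v).add (hg.i v)⟩
lemma D1p.sub (hf : D1p f) (hg : D1p g) : D1p fun x => f x - g x :=
  ⟨hf.p.op2 hg.p (· - ·), hf.d.sub hg.d, fun v => by
    rw [show pd v (fun x => f x - g x) = fun x => pd v f x - pd v g x from funext (pd_sub hf.d hg.d)]
    exact (hf.i v).sub (hg.i v)⟩
lemma D1p.cmul (k : ℝ) (hf : D1p f) : D1p fun x => k * f x :=
  ⟨hf.p.op2 hf.p fun a _ => k * a, hf.d.const_mul k, fun v => by
    rw [show pd v (fun x => k * f x) = fun x => k * pd v f x from funext (pd_cmul k hf.d)]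
    exact (hf.i v).const_mul k⟩
lemma C2p.sub (hf : C2p f) (hg : C2p g) : C2p fun x => f x - g x :=
  ⟨hf.c1.sub hg.c1, fun v => by
    rw [show pd v (fun x => f x - g x) = fun x => pd v f x - pd v g x from funext (pd_sub hf.c1.d hg.c1.d)]
    exact (hf.d2 v).sub (hg.d2 v)⟩
lemma C1p.bint (hη : C1p η) (hg : Integrable g (μT m)) : Integrable (fun x => η x * g x) (μT m) := by
  obtain ⟨C, -, hC⟩ := hη.bd
  exact hg.bdd_mul hη.c.continuous.aestronglyMeasurable (ae_of_all _ hC)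
lemma ibp (hη : C1p η) (hS : D1p S) (hv : v ∈ La m) :
    ∫ x, η x * pd v S x ∂(μT m) = -∫ x, S x * pd v η x ∂(μT m) := by
  have hi1 := hη.bint (hS.i v)
  have hi2 : Integrable (fun x => S x * pd v η x) (μT m) :=
    Pr.int (hS.p.op2 (hη.p.pd v) (· * ·)) (hS.d.continuous.mul (hη.cpd v))
  have h := int_deriv (f := fun x => η x * S x) (g := fun x => η x * pd v S x + S x * pd v η x) hv
    (hη.p.op2 hS.p (· * ·)) ((hη.p.op2 (hS.p.pd v) (· * ·)).op2 (hS.p.op2 (hη.p.pd v) (· * ·)) (· + ·))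
    (fun x => by
      have h1 := ((hη.d x).hasFDerivAt.mul (hS.d x).hasFDerivAt).hasLineDerivAt v
      exact h1)
    ((hη.c.continuous.measurable.mul pd_meas).add (hS.d.continuous.measurable.mul pd_meas)) (hi1.add hi2)
  rw [integral_add hi1 hi2] at h
  linarith
def av (f : Spc m → ℝ) (x : Spc m) : ℝ := ∫ y in cube1 m, f (x.1, y)
lemma C1p.D1 (h : C1p f) : D1 (toB f h.p h.c.continuous)
    (toB (fderiv ℝ f) (per_fderiv h.p) (h.c.continuous_fderiv one_ne_zero)) := fun x => (h.d x).hasFDerivAt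
lemma av_der (h : C1p f) (x : Spc m) : HasFDerivAt (av f)
    ((ContinuousLinearMap.fst ℝ ℝ (Fin m → ℝ)).smulRight (av (pd (e1 m) f) x)) x := Avg_D1 h.D1 x
lemma av_cont (hp : Pr f) (hc : Continuous f) : Continuous (av f) := (Avg (toB f hp hc)).continuous
lemma av_per (hp : Pr f) (hc : Continuous f) : Pr (av f) := by
  have := Cf.Per_Avg (m := m) (f := toB f hp hc) hp
  exact this
lemma C1p.av (h : C1p f) : C1p (av f) := by
  refine ⟨av_per h.p h.c.continuous, contDiff_one_iff_fderiv.2 ⟨fun x => (av_der h x).differentiableAt, ?_⟩⟩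
  rw [show fderiv ℝ (FP.av f) = fun x => _ from funext fun x => (av_der h x).fderiv]
  have := av_cont (h.p.pd (e1 m)) (h.cpd _)
  exact (ContinuousLinearMap.smulRightL ℝ _ _ (ContinuousLinearMap.fst ℝ ℝ (Fin m → ℝ))).continuous.comp this
lemma pd_av (h : C1p f) (x) : pd v (av f) x = v.1 * av (pd (e1 m) f) x := by
  rw [pd, (av_der h x).fderiv]; rfl
lemma sec_int (hp : Pr f) (hc : Continuous f) (x : ℝ) : Integrable (fun y => f (x, y)) (volume.restrict (cube1 m)) :=
  avg0_int (toB f hp hc) x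
lemma av_fub (hp : Pr f) (hc : Continuous f) (A : ℝ → ℝ) (hA : Measurable A) {C : ℝ} (hb : ∀ x, |A x| ≤ C) :
    ∫ x, A x.1 * f x ∂(μT m) = ∫ x, A x.1 * av f x ∂(μT m) := by
  have i1 : Integrable (fun x : Spc m => A x.1 * f x) (μT m) :=
    (hp.int hc).bdd_mul (hA.comp measurable_fst).aestronglyMeasurable (ae_of_all _ fun x => hb x.1)
  have i2 : Integrable (fun x : Spc m => A x.1 * av f x) (μT m) :=
    ((av_per hp hc).int (av_cont hp hc)).bdd_mul (hA.comp measurable_fst).aestronglyMeasurable (ae_of_all _ fun x => hb x.1)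
  rw [μT_eq] at *
  rw [integral_prod _ i1, integral_prod _ i2]
  refine integral_congr_ae (ae_of_all _ fun x => ?_)
  simp only [integral_const_mul]
  simp [av]
lemma av_int (hp : Pr f) (hc : Continuous f) : ∫ x, av f x ∂(μT m) = ∫ x, f x ∂(μT m) := by
  have := av_fub hp hc (fun _ => 1) measurable_const (C := 1) (by simp)
  simpa using this.symm
lemma per_int_zero (hp : Pr f) (hc : Continuous f) (h0 : ∀ x, 0 ≤ f x) (h : ∫ x, f x ∂(μT m) ≤ 0) (x) : f x = 0 := by
  by_contra hx
  have hx : 0 < f x := lt_of_le_of_ne (h0 x) (Ne.symm hx)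
  let c : Spc m := (1/2, fun _ => 1/2)
  have hs := int_shift hp (x - c)
  have hc' : Continuous fun y => f (y + (x - c)) := by fun_prop
  have hint : Integrable (fun y => f (y + (x - c))) (μT m) := by
    refine Pr.int (fun k hk y => ?_) hc'
    rw [add_right_comm]; exact hp k hk _
  have h1 := (integral_eq_zero_iff_of_nonneg (fun y => h0 _) hint).1
    (by rw [hs]; exact le_antisymm h (integral_nonneg h0))
  obtain ⟨r, hr, hb⟩ := Metric.isOpen_iff.1 (isOpen_lt continuous_const hc') c
    (show (0 : ℝ) < f (c + (x - c)) by rw [add_sub_cancel]; exact hx)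
  have hsub : Metric.ball c (min r (1/2)) ⊆ cube m := fun y hy => by
    have hy := (lt_min_iff.1 (Metric.mem_ball.1 hy)).2
    rw [Prod.dist_eq, max_lt_iff, dist_pi_lt_iff (by norm_num)] at hy
    simp only [Real.dist_eq, abs_lt, c] at hy
    exact mem_cube.2 ⟨⟨by linarith [hy.1.1], by linarith [hy.1.2]⟩, fun i => ⟨by linarith [(hy.2 i).1], by linarith [(hy.2 i).2]⟩⟩
  have h2 : μT m (Metric.ball c (min r (1/2))) = 0 := by
    refine measure_mono_null (fun y hy => ?_) h1
    exact (hb (Metric.ball_subset_ball (min_le_left _ _) hy)).ne'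
  rw [μT, Measure.restrict_apply Metric.isOpen_ball.measurableSet, inter_eq_left.2 hsub] at h2
  exact (Metric.measure_ball_pos volume c (lt_min hr (by norm_num))).ne' h2
def Sf (κ : ℝ) (V φ f : Spc m → ℝ) (o : Option (Fin m)) (x : Spc m) : ℝ :=
  pd (dir m o) V x * f x + κ * pd (dir m o) f x - (if o = none then 1 else 0) * (φ x * f x)
def Rf (κ : ℝ) (V φ f : Spc m → ℝ) (x : Spc m) : ℝ :=
  κ * lap f x + (gradDot V f x + lap V x * f x - pd (e1 m) (fun z => φ z * f z) x)
lemma dir_mem (o) : dir m o ∈ La m := by cases o; exacts [e1_mem, eC_mem _]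
variable {κ : ℝ} {V φ : Spc m → ℝ}
lemma D1p_Sf (hV : ∀ v, C1p (pd v V)) (hφ : C1p φ) (hf : C2p f) (o) : D1p (Sf κ V φ f o) :=
  (((hV _).mul hf.c1).d1.add ((hf.d2 _).cmul κ)).sub ((hφ.mul hf.c1).d1.cmul _)
lemma Rf_eq (hV : ∀ v, C1p (pd v V)) (hφ : C1p φ) (hf : C2p f) (x) :
    Rf κ V φ f x = ∑ o, pd (dir m o) (Sf κ V φ f o) x := by
  have : ∀ o, pd (dir m o) (Sf κ V φ f o) x = pd (dir m o) V x * pd (dir m o) f x +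
      f x * pd (dir m o) (pd (dir m o) V) x + κ * pd (dir m o) (pd (dir m o) f) x -
      (if o = none then 1 else 0) * pd (dir m o) (fun z => φ z * f z) x := fun o => by
    unfold Sf
    rw [pd_sub (dadd ((hV _).mul hf.c1).d ((hf.d2 _).d.const_mul κ)) ((hφ.mul hf.c1).d.const_mul _),
      pd_add ((hV _).mul hf.c1).d ((hf.d2 _).d.const_mul κ), pd_mul (hV _).d hf.c1.d, pd_cmul _ (hf.d2 _).d,
      pd_cmul _ (hφ.mul hf.c1).d]
  rw [Finset.sum_congr rfl fun o _ => this o]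
  simp only [Fintype.sum_option, Rf, lap, gradDot, dir]
  simp only [Finset.sum_add_distrib, Finset.sum_sub_distrib, ← Finset.mul_sum, if_true, reduceCtorEq, if_false,
    zero_mul, Finset.sum_const_zero]
  ring
lemma Rf_int (hV : ∀ v, C1p (pd v V)) (hφ : C1p φ) (hf : C2p f) : Integrable (Rf κ V φ f) (μT m) := by
  rw [show Rf κ V φ f = _ from funext (Rf_eq hV hφ hf)]
  exact integrable_finsetSum _ fun o _ => (D1p_Sf hV hφ hf o).i _
lemma weak (hV : ∀ v, C1p (pd v V)) (hφ : C1p φ) (hf : C2p f) (hη : C1p η) :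
    ∫ x, η x * Rf κ V φ f x ∂(μT m) = -∑ o, ∫ x, Sf κ V φ f o x * pd (dir m o) η x ∂(μT m) := by
  simp only [Rf_eq hV hφ hf, Finset.mul_sum]
  rw [integral_finsetSum _ fun o _ => hη.bint ((D1p_Sf hV hφ hf o).i _), ← Finset.sum_neg_distrib]
  exact Finset.sum_congr rfl fun o _ => ibp hη (D1p_Sf hV hφ hf o) (dir_mem o)
end FP
end
noncomputable section
namespace FP
open scoped Topology BoundedContinuousFunction
set_option linter.unusedSectionVars false
set_option maxSynthPendingDepth 3
open GS
attribute [local irreducible] P D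
variable {m : ℕ} {f g η S : Spc m → ℝ} {v w : Spc m}
def sg (s : ℝ) : ℝ := if 0 < s then 1 else if s < 0 then -1 else 0
lemma sg_meas : Measurable sg :=
  Measurable.ite measurableSet_Ioi measurable_const (Measurable.ite measurableSet_Iio measurable_const measurable_const)
lemma sg_abs (s) : |sg s| ≤ 1 := by unfold sg; split_ifs <;> simp
lemma sg_sub (s r) : |s| - |r| ≤ sg s * (s - r) := by
  unfold sg
  have := le_abs_self r; have := neg_abs_le r
  split_ifs with h h2
  · rw [abs_of_pos h]; linarith
  · rw [abs_of_neg h2]; linarith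
  · rw [show s = 0 by linarith]; simp
def Gs (ε s : ℝ) : ℝ := s / √(s ^ 2 + ε ^ 2)
def Gs' (ε s : ℝ) : ℝ := ε ^ 2 / √(s ^ 2 + ε ^ 2) ^ 3
lemma Gs_aux {ε : ℝ} (hε : 0 < ε) (s : ℝ) : 0 < s ^ 2 + ε ^ 2 := by positivity
lemma Gs_der {ε : ℝ} (hε : 0 < ε) (s : ℝ) : HasDerivAt (Gs ε) (Gs' ε s) s := by
  have h0 := Gs_aux hε s
  have h1 := (((hasDerivAt_pow 2 s).add_const (ε ^ 2)).sqrt h0.ne')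
  have hq := Real.sqrt_pos.2 h0
  refine ((hasDerivAt_id s).div h1 hq.ne').congr_deriv ?_
  have e := Real.sq_sqrt h0.le
  have := hq.ne'
  simp only [Gs', id]
  field_simp
  rw [e]; push_cast; ring
lemma Gs_cd {ε : ℝ} (hε : 0 < ε) : ContDiff ℝ 1 (Gs ε) := by
  have : ContDiff ℝ 1 fun s : ℝ => √(s ^ 2 + ε ^ 2) :=
    ContDiff.sqrt (by fun_prop) fun s => (Gs_aux hε s).ne'
  exact contDiff_id.div this fun s => (Real.sqrt_pos.2 (Gs_aux hε s)).ne'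
lemma Gs'_nn (ε s : ℝ) : 0 ≤ Gs' ε s := by unfold Gs'; positivity
lemma Gs'_sq {ε : ℝ} (hε : 0 < ε) (s : ℝ) : Gs' ε s * s ^ 2 ≤ ε := by
  have h0 := Gs_aux hε s
  have hq := Real.sqrt_pos.2 h0
  have e := Real.sq_sqrt h0.le
  have h1 : ε ≤ √(s ^ 2 + ε ^ 2) := Real.le_sqrt_of_sq_le (by nlinarith [sq_nonneg s])
  unfold Gs'
  rw [div_mul_eq_mul_div, div_le_iff₀ (by positivity)]
  have h2 : ε * ε * s ^ 2 ≤ ε * √(s ^ 2 + ε ^ 2) * √(s ^ 2 + ε ^ 2) ^ 2 :=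
    mul_le_mul (by nlinarith) (by rw [e]; nlinarith) (sq_nonneg _) (by positivity)
  nlinarith
lemma Gs_abs (ε s : ℝ) : |Gs ε s| ≤ 1 := by
  unfold Gs
  rw [abs_div, abs_of_nonneg (Real.sqrt_nonneg _)]
  exact div_le_one_of_le₀ (Real.abs_le_sqrt (by nlinarith [sq_nonneg ε])) (Real.sqrt_nonneg _)
lemma Gs_lim (s : ℝ) : Tendsto (fun n : ℕ => Gs (1 / ((n : ℝ) + 1)) s) atTop (𝓝 (sg s)) := by
  by_cases h : s = 0
  · subst h; simp [Gs, sg]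
  have h1 : Tendsto (fun n : ℕ => √(s ^ 2 + (1 / ((n : ℝ) + 1)) ^ 2)) atTop (𝓝 |s|) := by
    have := ((tendsto_one_div_add_atTop_nhds_zero_nat (𝕜 := ℝ)).pow 2).const_add (s ^ 2)
    have := this.sqrt
    simpa [Real.sqrt_sq_eq_abs] using this
  have h2 : sg s = s / |s| := by
    unfold sg
    rcases lt_or_gt_of_ne h with h' | h'
    · rw [if_neg h'.not_gt, if_pos h', abs_of_neg h', div_neg, div_self h]
    · rw [if_pos h', abs_of_pos h', div_self h]
  rw [h2]
  exact tendsto_const_nhds.div h1 (abs_ne_zero.2 h)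
lemma sg_lim {q : Spc m → ℝ} (hq : Continuous q) (hg : Integrable g (μT m)) {C : ℝ}
    (h : ∀ ε > 0, ∫ x, Gs ε (q x) * g x ∂(μT m) ≤ ε * C) : ∫ x, sg (q x) * g x ∂(μT m) ≤ 0 := by
  have h1 : Tendsto (fun n : ℕ => ∫ x, Gs (1 / ((n : ℝ) + 1)) (q x) * g x ∂(μT m)) atTop
      (𝓝 (∫ x, sg (q x) * g x ∂(μT m))) := by
    refine tendsto_integral_of_dominated_convergence (fun x => ‖g x‖) (fun n => ?_) hg.norm
      (fun n => ae_of_all _ fun x => ?_) (ae_of_all _ fun x => (Gs_lim _).mul_const _)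
    · have : Continuous (Gs (1 / ((n : ℝ) + 1))) := (Gs_cd (by positivity)).continuous
      exact (this.comp hq).aestronglyMeasurable.mul hg.1
    · rw [norm_mul]
      exact mul_le_of_le_one_left (norm_nonneg _) (Gs_abs _ _)
  have h2 : Tendsto (fun n : ℕ => 1 / ((n : ℝ) + 1) * C) atTop (𝓝 0) := by
    simpa using (tendsto_one_div_add_atTop_nhds_zero_nat (𝕜 := ℝ)).mul_const C
  exact le_of_tendsto_of_tendsto' h1 h2 fun n => h _ (by positivity)
lemma l1_lt {p δ : ℝ} (hp : 1 ≤ p) (hf : Integrable f (μT m)) (h : LpN p f < ENNReal.ofReal δ) : ∫ x, |f x| ∂(μT m) < δ := by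
  have h1 : eLpNorm f 1 (μT m) ≤ LpN p f :=
    eLpNorm_le_eLpNorm_of_exponent_le (by rw [← ENNReal.ofReal_one]; exact ENNReal.ofReal_le_ofReal hp) hf.1
  have h2 := h1.trans_lt h
  rw [eLpNorm_one_eq_lintegral_enorm, ← ofReal_integral_norm_eq_lintegral_enorm hf] at h2
  exact (ENNReal.ofReal_lt_ofReal_iff_of_nonneg (integral_nonneg fun x => norm_nonneg _)).1 h2
lemma l2_lt {p δ : ℝ} (hp : 2 ≤ p) (hf : AEStronglyMeasurable f (μT m)) (hδ : 0 < δ) (h : LpN p f < ENNReal.ofReal δ) :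
    ∫ x, f x ^ 2 ∂(μT m) ≤ δ ^ 2 := by
  have h1 : eLpNorm f 2 (μT m) ≤ LpN p f :=
    eLpNorm_le_eLpNorm_of_exponent_le (by
      rw [show (2 : ℝ≥0∞) = ENNReal.ofReal 2 by simp]; exact ENNReal.ofReal_le_ofReal hp) hf
  have h2 := h1.trans_lt h
  have hM : MemLp f 2 (μT m) := ⟨hf, h2.trans ENNReal.ofReal_lt_top⟩
  rw [hM.eLpNorm_eq_integral_rpow_norm (by simp) (by simp)] at h2
  have h3 := (ENNReal.ofReal_lt_ofReal_iff hδ).1 h2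
  simp only [toReal_ofNat, Real.rpow_two, Real.norm_eq_abs, sq_abs] at h3
  have h4 := Real.rpow_lt_rpow (by positivity) h3 (two_pos)
  rw [← Real.rpow_mul (integral_nonneg fun x => sq_nonneg _)] at h4
  simpa using h4.le
lemma Jcont {p : ℝ} (hp : 2 ≤ p) {s : Set ℝ} {w : ℝ → Spc m → ℝ} {J : ℝ → ℝ} (hw : ∀ t ∈ s, Integrable (w t) (μT m))
    (hc : ContW 0 p s w) (hJ : ∀ t ∈ s, ∃ C, 0 ≤ C ∧ ∀ t' ∈ s, |J t' - J t| ≤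
      C * (∫ x, |w t' x - w t x| ∂(μT m) + ∫ x, (w t' x - w t x) ^ 2 ∂(μT m))) : ContinuousOn J s := by
  rw [Metric.continuousOn_iff]
  intro t ht ε hε
  obtain ⟨C, hC, h⟩ := hJ t ht
  set e := min 1 (ε / (2 * C + 1)) with he
  have hpos : 0 < e := by positivity
  obtain ⟨δ, hδ, h2⟩ := hc t ht e hpos
  refine ⟨δ, hδ, fun t' ht' hd => ?_⟩
  have h3 := h2 t' ht' (by rwa [Real.dist_eq] at hd)
  simp only [WNorm, le_refl, if_true] at h3
  have hi := (hw t' ht').sub (hw t ht)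
  have h4 := l1_lt (by linarith) hi h3
  have h5 := l2_lt hp hi.1 hpos h3
  simp only [Pi.sub_apply] at h4 h5
  rw [Real.dist_eq]
  have h6 : e ^ 2 ≤ e := by nlinarith [min_le_left 1 (ε / (2 * C + 1))]
  have h7 : (2 * C + 1) * e ≤ ε := by
    have := min_le_right 1 (ε / (2 * C + 1))
    rw [← he, le_div_iff₀ (by positivity)] at this; linarith
  have h8 := h t' ht'
  have h9 := mul_le_mul_of_nonneg_left (add_le_add h4.le (h5.trans h6)) hC
  refine (h8.trans h9).trans_lt ?_
  linarith
lemma dini {J : ℝ → ℝ} {t0 t1 K : ℝ} (h01 : t0 ≤ t1) (hJ : ContinuousOn J (Icc t0 t1))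
    (h : ∀ t ∈ Ioc t0 t1, ∃ q : ℝ → ℝ, ∃ d ≤ K * J t, Tendsto q (𝓝[<] t) (𝓝 d) ∧
      ∀ s ∈ Ico t0 t, J t - J s ≤ (t - s) * q s) : J t1 ≤ J t0 * Real.exp (K * (t1 - t0)) := by
  have := le_gronwallBound_of_liminf_deriv_right_le (f := fun s => -J (t1 - s)) (f' := fun s => K * J (t1 - s))
    (δ := -J t1) (K := -K) (ε := 0) (a := 0) (b := t1 - t0)
    (ContinuousOn.neg (hJ.comp (by fun_prop) fun s hs => ⟨by linarith [hs.2], by linarith [hs.1]⟩))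
    (fun s hs r hr => by
      obtain ⟨q, d, hd, hq, hle⟩ := h (t1 - s) ⟨by linarith [hs.2], by linarith [hs.1]⟩
      have hm : Tendsto (fun z => t1 - z) (𝓝[>] s) (𝓝[<] (t1 - s)) :=
        tendsto_nhdsWithin_iff.2 ⟨((continuous_const.sub continuous_id).tendsto s).mono_left nhdsWithin_le_nhds,
          eventually_nhdsWithin_of_forall fun z hz => by simp only [mem_Iio]; linarith [mem_Ioi.1 hz]⟩
      have h1 := (hq.comp hm).eventually_lt_const (hd.trans_lt hr)
      have h2 : ∀ᶠ z in 𝓝[>] s, z ∈ Ioo s (t1 - t0) := Ioo_mem_nhdsGT hs.2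
      refine (h1.and h2).frequently.mono fun z hz => ?_
      have h3 := hle (t1 - z) ⟨by linarith [hz.2.2], by linarith [hz.2.1]⟩
      have h4 : 0 < z - s := by linarith [hz.2.1]
      refine lt_of_le_of_lt ?_ hz.1
      rw [inv_mul_le_iff₀ h4]
      simp only [Function.comp]
      have e : t1 - s - (t1 - z) = z - s := by ring
      rw [e] at h3; linarith) (by simp)
    (fun s _ => by simp) (t1 - t0) ⟨by linarith, le_rfl⟩
  rw [gronwallBound_ε0, sub_zero] at this
  have e : t1 - (t1 - t0) = t0 := by ring
  simp only [e] at this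
  have h2 := Real.exp_pos (K * (t1 - t0))
  have h3 : Real.exp (-K * (t1 - t0)) * Real.exp (K * (t1 - t0)) = 1 := by rw [← Real.exp_add]; simp
  have h4 := mul_le_mul_of_nonneg_right this h2.le
  rw [mul_assoc, h3] at h4; linarith
lemma EN {w gt : ℝ → Spc m → ℝ} {J : ℝ → ℝ} {t0 t1 K p : ℝ} (hp : 1 ≤ p) (h01 : t0 ≤ t1)
    (hw : ∀ t ∈ Icc t0 t1, Integrable (w t) (μT m)) (hg : ∀ t ∈ Ioc t0 t1, Integrable (gt t) (μT m))
    (hJ : ContinuousOn J (Icc t0 t1))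
    (hd : ∀ t ∈ Ioc t0 t1, Tendsto (fun h : ℝ => LpN p (fun x => (w (t + h) x - w t x) / h - gt t x))
      (𝓝[{h : ℝ | h ≠ 0}] 0) (𝓝 0))
    (hθ : ∀ t ∈ Ioc t0 t1, ∃ θ : Spc m → ℝ, ∃ C : ℝ, Measurable θ ∧ (∀ x, |θ x| ≤ C) ∧
      (∀ s ∈ Ico t0 t, J t - J s ≤ ∫ x, θ x * (w t x - w s x) ∂(μT m)) ∧ ∫ x, θ x * gt t x ∂(μT m) ≤ K * J t) :
    J t1 ≤ J t0 * Real.exp (K * (t1 - t0)) := by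
  refine dini h01 hJ fun t ht => ?_
  obtain ⟨θ, C, hm, hC, hle, hK⟩ := hθ t ht
  refine ⟨fun s => (t - s)⁻¹ * ∫ x, θ x * (w t x - w s x) ∂(μT m), _, hK, ?_, fun s hs => ?_⟩
  · have hC0 : 0 ≤ C := (abs_nonneg _).trans (hC 0)
    rw [Metric.tendsto_nhds]
    intro ε hε
    have hm2 : Tendsto (fun s => s - t) (𝓝[<] t) (𝓝[{h : ℝ | h ≠ 0}] 0) :=
      tendsto_nhdsWithin_iff.2 ⟨by
        have := ((continuous_id.sub continuous_const).tendsto t (f := fun s : ℝ => s - t)).mono_left (nhdsWithin_le_nhds (s := Iio t))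
        simpa using this, eventually_nhdsWithin_of_forall fun z hz => sub_ne_zero.2 (ne_of_lt hz)⟩
    have h1 := ((hd t ht).comp hm2).eventually_lt_const (u := ENNReal.ofReal (ε / (C + 1))) (by positivity)
    have h2 : ∀ᶠ z in 𝓝[<] t, z ∈ Ioo t0 t := Ioo_mem_nhdsLT ht.1
    filter_upwards [h1, h2] with s h1 hs
    simp only [Function.comp, add_sub_cancel] at h1
    have hws := hw s ⟨hs.1.le, hs.2.le.trans ht.2⟩
    have hwt := hw t ⟨ht.1.le, ht.2⟩
    have hi : Integrable (fun x => (w s x - w t x) / (s - t) - gt t x) (μT m) := ((hws.sub hwt).div_const _).sub (hg t ht)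
    have h3 := l1_lt hp hi h1
    have i1 : Integrable (fun x => θ x * (w t x - w s x)) (μT m) :=
      (hwt.sub hws).bdd_mul hm.aestronglyMeasurable (ae_of_all _ hC)
    have i2 : Integrable (fun x => θ x * gt t x) (μT m) := (hg t ht).bdd_mul hm.aestronglyMeasurable (ae_of_all _ hC)
    have ei : ∀ c : ℝ, c * ∫ x, θ x * (w t x - w s x) ∂(μT m) = ∫ x, c * (θ x * (w t x - w s x)) ∂(μT m) :=
      fun c => (integral_const_mul c _).symm
    rw [Real.dist_eq, ei, ← integral_sub (i1.const_mul _) i2]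
    have h4 : |∫ x, ((t - s)⁻¹ * (θ x * (w t x - w s x)) - θ x * gt t x) ∂(μT m)| ≤
        ∫ x, C * |(w s x - w t x) / (s - t) - gt t x| ∂(μT m) := by
      refine norm_integral_le_of_norm_le (f := fun x => (t - s)⁻¹ * (θ x * (w t x - w s x)) - θ x * gt t x) (hi.abs.const_mul C) (ae_of_all _ fun x => ?_)
      have : (t - s)⁻¹ * (θ x * (w t x - w s x)) - θ x * gt t x = θ x * ((w s x - w t x) / (s - t) - gt t x) := by
        rw [← neg_sub t s, ← neg_sub (w t x) (w s x), neg_div_neg_eq]; ring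
      rw [this, norm_mul]
      exact mul_le_mul_of_nonneg_right (hC x) (norm_nonneg _)
    rw [integral_const_mul] at h4
    rw [lt_div_iff₀ (by positivity)] at h3
    have : 0 ≤ ∫ x, |(w s x - w t x) / (s - t) - gt t x| ∂(μT m) := integral_nonneg fun x => abs_nonneg _
    nlinarith
  · rw [mul_inv_cancel_left₀ (sub_ne_zero.2 hs.2.ne')]; exact hle s hs
end FP
end
noncomputable section
namespace FP
open scoped Topology BoundedContinuousFunction
set_option linter.unusedSectionVars false
set_option maxSynthPendingDepth 3
open GS
attribute [local irreducible] P D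
variable {m : ℕ} {f g η S : Spc m → ℝ} {v w : Spc m} {κ : ℝ} {V : Spc m → ℝ}
def phf (V f : Spc m → ℝ) (x : Spc m) : ℝ := av (fun z => pd (e1 m) V z * f z) x / av f x
lemma phf_C1 (hV : ∀ v, C1p (pd v V)) (hf : C1p f) (h : ∀ x, 0 < av f x) : C1p (phf V f) :=
  ⟨((hV _).mul hf).av.p.op2 hf.av.p (· / ·), ((hV _).mul hf).av.c.div hf.av.c fun x => (h x).ne'⟩
lemma marg_flux (hV : ∀ v, C1p (pd v V)) (hf : C2p f) (h : ∀ x, 0 < av f x) (x) :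
    av (Sf κ V (phf V f) f none) x = κ * av (pd (e1 m) f) x := by
  have i1 := sec_int ((hV (e1 m)).mul hf.c1).p ((hV (e1 m)).mul hf.c1).c.continuous x.1
  have i2 := (sec_int (hf.d2 (e1 m)).p (hf.d2 (e1 m)).d.continuous x.1).const_mul κ
  have i3 := (sec_int hf.c1.p hf.c1.c.continuous x.1).const_mul (phf V f x)
  have e : av (Sf κ V (phf V f) f none) x = ∫ y in cube1 m,
      (pd (e1 m) V (x.1, y) * f (x.1, y) + κ * pd (e1 m) f (x.1, y) - phf V f x * f (x.1, y)) := by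
    simp only [av, Sf, if_true, one_mul]; rfl
  rw [e, integral_sub (by exact i1.add i2) i3, integral_add i1 i2, integral_const_mul, integral_const_mul]
  have : phf V f x * av f x = av (fun z => pd (e1 m) V z * f z) x := div_mul_cancel₀ _ (h x).ne'
  simp only [av] at *
  rw [this]; ring
lemma marg_sg (hκ : 0 < κ) (hV : ∀ v, C1p (pd v V)) (hf : C2p f) (h : ∀ x, 0 < av f x) (k : ℝ) :
    ∫ x, sg (av f x - k) * Rf κ V (phf V f) f x ∂(μT m) ≤ 0 := by
  have hφ := phf_C1 hV hf.c1 h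
  have hq : C1p fun x => av f x - k := hf.c1.av.sub (C1p.const k)
  refine sg_lim (C := 0) hq.c.continuous (Rf_int hV hφ hf) fun ε hε => ?_
  have hη := hq.comp (Gs_cd hε)
  rw [weak hV hφ hf hη, mul_zero, neg_nonpos]
  have hpd : ∀ o x, pd (dir m o) (fun x => Gs ε (av f x - k)) x =
      Gs' ε (av f x - k) * ((dir m o).1 * av (pd (e1 m) f) x) := fun o x => by
    rw [pd_comp (Gs_der hε) hq.d, pd_sub hf.c1.av.d (C1p.const k).d, pd_const, pd_av hf.c1, sub_zero]
  refine Finset.sum_nonneg fun o _ => ?_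
  cases o with
  | some i =>
    have : ∀ x, pd (dir m (some i)) (fun x => Gs ε (av f x - k)) x = 0 := fun x => by rw [hpd]; simp [dir, eC]
    simp [this]
  | none =>
    have hS := D1p_Sf (κ := κ) hV hφ hf none
    have hA := hη.cpd (e1 m)
    obtain ⟨C, hC⟩ := per_bdd (hη.p.pd (e1 m)) hA
    have h1 := av_fub hS.p hS.d.continuous (fun s => pd (e1 m) (fun x => Gs ε (av f x - k)) (s, 0))
      ((hA.comp (by fun_prop : Continuous fun s : ℝ => ((s, 0) : Spc m))).measurable) (fun s => hC _)
    have e0 : ∀ x : Spc m, pd (e1 m) (fun x => Gs ε (av f x - k)) (x.1, 0) = pd (e1 m) (fun x => Gs ε (av f x - k)) x :=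
      fun x => (hpd none _).trans (hpd none x).symm
    simp only [e0] at h1
    simp only [mul_comm (Sf κ V (phf V f) f none _)]
    refine le_of_le_of_eq (integral_nonneg fun x => ?_) h1.symm
    simp only [Pi.zero_apply]
    rw [marg_flux hV hf h, show pd (e1 m) (fun x => Gs ε (av f x - k)) x = _ from hpd none x]
    have : (dir m none).1 = 1 := rfl
    rw [this, show Gs' ε (av f x - k) * (1 * av (pd (e1 m) f) x) * (κ * av (pd (e1 m) f) x)
      = κ * (Gs' ε (av f x - k) * (av (pd (e1 m) f) x) ^ 2) by ring]
    exact mul_nonneg hκ.le (mul_nonneg (Gs'_nn _ _) (sq_nonneg _))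
lemma quad (hκ : 0 < κ) {C c a b : ℝ} (hc : |c| ≤ C) : -(C ^ 2 / (4 * κ) * b ^ 2) ≤ κ * a ^ 2 + c * b * a := by
  have h : c ^ 2 ≤ C ^ 2 := sq_le_sq' (by linarith [neg_abs_le c]) ((le_abs_self c).trans hc)
  have h2 : C ^ 2 / (4 * κ) * b ^ 2 - c ^ 2 / (4 * κ) * b ^ 2 ≥ 0 := by
    rw [← sub_mul, ← sub_div]; exact mul_nonneg (div_nonneg (by linarith) (by positivity)) (sq_nonneg _)
  have h3 : κ * a ^ 2 + c * b * a + c ^ 2 / (4 * κ) * b ^ 2 = κ * (a + c * b / (2 * κ)) ^ 2 := by field_simp; ring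
  have := mul_nonneg hκ.le (sq_nonneg (a + c * b / (2 * κ)))
  linarith
lemma pos_sg (hκ : 0 < κ) (hV : ∀ v, C1p (pd v V)) (hf : C2p f) {φ : Spc m → ℝ} (hφ : C1p φ) :
    ∫ x, sg (f x) * Rf κ V φ f x ∂(μT m) ≤ 0 := by
  choose C0 hC0 hCV using fun v => (hV v).bd
  obtain ⟨C1, hC1, hφb⟩ := hφ.bd
  refine sg_lim (C := ∑ o, (C0 (dir m o) + C1) ^ 2 / (4 * κ)) hf.c1.c.continuous (Rf_int hV hφ hf) fun ε hε => ?_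
  have hη := hf.c1.comp (Gs_cd hε)
  rw [weak hV hφ hf hη, Finset.mul_sum, ← Finset.sum_neg_distrib]
  refine Finset.sum_le_sum fun o _ => ?_
  set c := (C0 (dir m o) + C1) ^ 2 / (4 * κ)
  have hc : 0 ≤ c := by positivity
  have hi : Integrable (fun x => Sf κ V φ f o x * pd (dir m o) (fun x => Gs ε (f x)) x) (μT m) := by
    have hS := D1p_Sf (κ := κ) hV hφ hf o
    exact Pr.int (hS.p.op2 (hη.p.pd _) (· * ·)) (hS.d.continuous.mul (hη.cpd _))
  rw [← integral_neg]
  have := integral_mono (μ := μT m) hi.neg (integrable_const (ε * c)) fun x => ?_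
  · refine this.trans ?_
    simp
  simp only [Pi.neg_apply]
  rw [pd_comp (Gs_der hε) hf.c1.d]
  have h1 := Gs'_sq hε (f x)
  have h2 : |pd (dir m o) V x - (if o = none then 1 else 0) * φ x| ≤ C0 (dir m o) + C1 := by
    refine (abs_sub _ _).trans (add_le_add (hCV _ x) ?_)
    split_ifs
    · rw [one_mul]; exact hφb x
    · simpa using hC1
  have h3 := mul_le_mul_of_nonneg_left (quad hκ (a := pd (dir m o) f x) (b := f x) h2) (Gs'_nn ε (f x))
  have h4 := mul_le_mul_of_nonneg_left h1 hc
  have h5 : Sf κ V φ f o x * (Gs' ε (f x) * pd (dir m o) f x) = Gs' ε (f x) * (κ * pd (dir m o) f x ^ 2 +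
      (pd (dir m o) V x - (if o = none then 1 else 0) * φ x) * f x * pd (dir m o) f x) := by
    unfold Sf; ring
  rw [h5]
  nlinarith
structure AP (κ : ℝ) (V : Spc m → ℝ) (p T : ℝ) (ψ : ℝ → Spc m → ℝ) : Prop where
  hp : 2 ≤ p
  hκ : 0 < κ
  hV : ∀ v, C1p (pd v V)
  per : ∀ t ∈ Ico 0 T, Pr (ψ t)
  c : ∀ t ∈ Ico 0 T, Continuous (ψ t)
  c2 : ∀ t ∈ Ioo 0 T, C2p (ψ t)
  mpos : ∀ t ∈ Ico 0 T, ∀ x, 0 < av (ψ t) x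
  cont : ContW 0 p (Ico 0 T) ψ
  eqn : ∀ t ∈ Ioo 0 T, Tendsto (fun h : ℝ => LpN p
      (fun x => (ψ (t + h) x - ψ t x) / h - Rf κ V (phf V (ψ t)) (ψ t) x)) (𝓝[{h : ℝ | h ≠ 0}] 0) (𝓝 0)
namespace AP
variable {p T : ℝ} {ψ : ℝ → Spc m → ℝ} (h : AP κ V p T ψ)
include h
lemma int {t} (ht : t ∈ Ico 0 T) : Integrable (ψ t) (μT m) := (h.per t ht).int (h.c t ht)
lemma ph {t} (ht : t ∈ Ioo 0 T) : C1p (phf V (ψ t)) := phf_C1 h.hV (h.c2 t ht).c1 (h.mpos t ⟨ht.1.le, ht.2⟩)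
lemma mono {J : ℝ → ℝ} (hJ : ∀ t ∈ Ico 0 T, ∃ θ : Spc m → ℝ, Measurable θ ∧ (∀ x, |θ x| ≤ 1) ∧
    (∀ s ∈ Ico 0 T, J t - J s ≤ ∫ x, θ x * (ψ t x - ψ s x) ∂(μT m)) ∧
      (0 < t → ∫ x, θ x * Rf κ V (phf V (ψ t)) (ψ t) x ∂(μT m) ≤ 0)) {t} (ht : t ∈ Ico 0 T) : J t ≤ J 0 := by
  have hl : ∀ t ∈ Ico 0 T, ∀ s ∈ Ico 0 T, J t - J s ≤ ∫ x, |ψ t x - ψ s x| ∂(μT m) := fun t ht s hs => by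
    obtain ⟨θ, hm, hb, hθ, -⟩ := hJ t ht
    have hi := (h.int ht).sub (h.int hs)
    refine (hθ s hs).trans (integral_mono (hi.bdd_mul hm.aestronglyMeasurable (ae_of_all _ hb)) hi.abs fun x => ?_)
    refine (le_abs_self _).trans ?_
    rw [abs_mul]
    exact mul_le_of_le_one_left (abs_nonneg _) (hb x)
  have hsub : Icc 0 t ⊆ Ico 0 T := fun s hs => ⟨hs.1, hs.2.trans_lt ht.2⟩
  have hJc : ContinuousOn J (Ico 0 T) := by
    refine Jcont h.hp (fun t ht => h.int ht) h.cont fun t ht => ⟨1, zero_le_one, fun s hs => ?_⟩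
    have h1 := hl t ht s hs
    have h2 := hl s hs t ht
    have h3 : 0 ≤ ∫ x, (ψ s x - ψ t x) ^ 2 ∂(μT m) := integral_nonneg fun x => sq_nonneg _
    simp only [abs_sub_comm (ψ t _)] at h1
    rw [one_mul, abs_le]; constructor <;> linarith
  have := EN (K := 0) (J := J) (gt := fun t => Rf κ V (phf V (ψ t)) (ψ t)) (p := p) (by linarith [h.hp]) ht.1
    (fun s hs => h.int (hsub hs)) (fun s hs => Rf_int h.hV (h.ph ⟨hs.1, hs.2.trans_lt ht.2⟩) (h.c2 s ⟨hs.1, hs.2.trans_lt ht.2⟩))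
    (hJc.mono hsub) (fun s hs => h.eqn s ⟨hs.1, hs.2.trans_lt ht.2⟩) fun s hs => by
      obtain ⟨θ, hm, hb, hθ, h0⟩ := hJ s (hsub ⟨hs.1.le, hs.2⟩)
      refine ⟨θ, 1, hm, hb, fun r hr => hθ r ⟨hr.1, hr.2.trans_le (hs.2.trans ht.2.le)⟩, ?_⟩
      rw [zero_mul]; exact h0 hs.1
  simpa using this
lemma mass {t} (ht : t ∈ Ico 0 T) : ∫ x, ψ t x ∂(μT m) = ∫ x, ψ 0 x ∂(μT m) := by
  have key : ∀ c : ℝ, |c| ≤ 1 → c * ∫ x, ψ t x ∂(μT m) ≤ c * ∫ x, ψ 0 x ∂(μT m) := fun c hc => by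
    refine h.mono (J := fun t => c * ∫ x, ψ t x ∂(μT m)) (fun t ht => ⟨fun _ => c, measurable_const, fun _ => hc,
      fun s hs => ?_, fun h0 => ?_⟩) ht
    · rw [integral_const_mul, integral_sub (h.int ht) (h.int hs), mul_sub]
    · have ht : t ∈ Ioo 0 T := ⟨h0, ht.2⟩
      rw [weak h.hV (h.ph ht) (h.c2 t ht) (C1p.const c)]
      simp [pd_const]
  have h1 := key 1 (by simp); have h2 := key (-1) (by simp)
  linarith
lemma margm (k : ℝ) {t} (ht : t ∈ Ico 0 T) : ∫ x, |av (ψ t) x - k| ∂(μT m) ≤ ∫ x, |av (ψ 0) x - k| ∂(μT m) := by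
  have hc : ∀ t ∈ Ico 0 T, Continuous fun x => av (ψ t) x - k := fun t ht => (av_cont (h.per t ht) (h.c t ht)).sub continuous_const
  have hi : ∀ t ∈ Ico 0 T, Integrable (fun x => av (ψ t) x - k) (μT m) := fun t ht =>
    ((av_per (h.per t ht) (h.c t ht)).int (av_cont (h.per t ht) (h.c t ht))).sub (integrable_const _)
  refine h.mono (J := fun t => ∫ x, |av (ψ t) x - k| ∂(μT m)) (fun t ht => ⟨fun x => sg (av (ψ t) x - k),
    sg_meas.comp (hc t ht).measurable, fun _ => sg_abs _, fun s hs => ?_, fun h0 => ?_⟩) ht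
  · have hp : Pr fun x => ψ t x - ψ s x := (h.per t ht).op2 (h.per s hs) (· - ·)
    have hcc : Continuous fun x => ψ t x - ψ s x := (h.c t ht).sub (h.c s hs)
    have h1 := av_fub hp hcc (fun r => sg (av (ψ t) ((r, 0) : Spc m) - k))
      (sg_meas.comp ((hc t ht).comp (by fun_prop : Continuous fun s : ℝ => ((s, 0) : Spc m))).measurable) (fun r => sg_abs _)
    have e : ∀ x, av (fun x => ψ t x - ψ s x) x = (av (ψ t) x - k) - (av (ψ s) x - k) := fun x => by
      rw [sub_sub_sub_cancel_right]
      exact integral_sub (sec_int (h.per t ht) (h.c t ht) x.1) (sec_int (h.per s hs) (h.c s hs) x.1)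
    refine le_of_le_of_eq ?_ h1.symm
    rw [← integral_sub (hi t ht).abs (hi s hs).abs]
    refine integral_mono ((hi t ht).abs.sub (hi s hs).abs) ?_ fun x => ?_
    · refine Integrable.bdd_mul (c := 1) ?_ ?_ (ae_of_all _ fun x => sg_abs _)
      · rw [funext e]; exact (hi t ht).sub (hi s hs)
      · exact (sg_meas.comp ((hc t ht).comp (by fun_prop : Continuous fun x : Spc m => ((x.1, 0) : Spc m))).measurable).aestronglyMeasurable
    · show _ ≤ sg (av (ψ t) x - k) * _
      rw [e]; exact sg_sub _ _
  · have ht : t ∈ Ioo 0 T := ⟨h0, ht.2⟩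
    exact marg_sg h.hκ h.hV (h.c2 t ht) (h.mpos t ⟨ht.1.le, ht.2⟩) k
lemma posm {t} (ht : t ∈ Ico 0 T) : ∫ x, |ψ t x| ∂(μT m) ≤ ∫ x, |ψ 0 x| ∂(μT m) := by
  refine h.mono (J := fun t => ∫ x, |ψ t x| ∂(μT m)) (fun t ht => ⟨fun x => sg (ψ t x),
    sg_meas.comp (h.c t ht).measurable, fun _ => sg_abs _, fun s hs => ?_, fun h0 => ?_⟩) ht
  · rw [← integral_sub (h.int ht).abs (h.int hs).abs]
    refine integral_mono ((h.int ht).abs.sub (h.int hs).abs) ?_ fun x => sg_sub _ _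
    exact ((h.int ht).sub (h.int hs)).bdd_mul (sg_meas.comp (h.c t ht).measurable).aestronglyMeasurable
      (ae_of_all _ fun x => sg_abs _)
  · have ht : t ∈ Ioo 0 T := ⟨h0, ht.2⟩
    exact pos_sg h.hκ h.hV (h.c2 t ht) (h.ph ht)
lemma pos (h0 : ∀ x, 0 ≤ ψ 0 x) {t} (ht : t ∈ Ico 0 T) (x) : 0 ≤ ψ t x := by
  have h1 := h.posm ht
  simp only [abs_of_nonneg (h0 _)] at h1
  rw [← h.mass ht] at h1
  have := per_int_zero (f := fun x => |ψ t x| - ψ t x) ((h.per t ht).op2 (h.per t ht) fun a _ => |a| - a)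
    ((h.c t ht).abs.sub (h.c t ht)) (fun x => sub_nonneg.2 (le_abs_self _))
    (by rw [integral_sub (h.int ht).abs (h.int ht)]; linarith) x
  linarith [abs_nonneg (ψ t x)]
lemma mbd (s k : ℝ) (hs : |s| = 1) (h0 : ∀ x, 0 ≤ s * (av (ψ 0) x - k)) {t} (ht : t ∈ Ico 0 T) (x) : 0 ≤ s * (av (ψ t) x - k) := by
  have h00 : (0 : ℝ) ∈ Ico 0 T := ⟨le_rfl, ht.1.trans_lt ht.2⟩
  have hab : ∀ a : ℝ, |a| = |s * a| := fun a => by rw [abs_mul, hs, one_mul]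
  have hint : ∀ t ∈ Ico 0 T, ∫ x, s * (av (ψ t) x - k) ∂(μT m) = s * (∫ x, ψ 0 x ∂(μT m) - k) := fun t ht => by
    rw [integral_const_mul, integral_sub ((av_per (h.per t ht) (h.c t ht)).int (av_cont (h.per t ht) (h.c t ht)))
      (integrable_const _), av_int (h.per t ht) (h.c t ht), h.mass ht]; simp
  have h1 := h.margm k ht
  simp only [hab (_ - k), abs_of_nonneg (h0 _)] at h1
  rw [hint 0 h00, ← hint t ht] at h1
  have hp : Pr fun x => s * (av (ψ t) x - k) := (av_per (h.per t ht) (h.c t ht)).op2 (av_per (h.per t ht) (h.c t ht)) fun a _ => s * (a - k)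
  have hc : Continuous fun x => s * (av (ψ t) x - k) := continuous_const.mul ((av_cont (h.per t ht) (h.c t ht)).sub continuous_const)
  have := per_int_zero (f := fun x => |s * (av (ψ t) x - k)| - s * (av (ψ t) x - k)) (hp.op2 hp fun a _ => |a| - a)
    (hc.abs.sub hc) (fun x => sub_nonneg.2 (le_abs_self _))
    (by rw [integral_sub (hp.int hc).abs (hp.int hc)]; linarith) x
  linarith [abs_nonneg (s * (av (ψ t) x - k))]
end AP
end FP
end
noncomputable section
namespace FP
open scoped Topology BoundedContinuousFunction
set_option linter.unusedSectionVars false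
set_option maxSynthPendingDepth 3
open GS
attribute [local irreducible] P D
variable {m : ℕ} {f g η S : Spc m → ℝ} {v w : Spc m} {κ : ℝ} {V : Spc m → ℝ}
lemma av_jen (hp : Pr f) (hc : Continuous f) (x) : av (fun y => |f y|) x ^ 2 ≤ av (fun y => f y ^ 2) x := by
  have i1 := sec_int (f := fun y => |f y|) (hp.op2 hp fun a _ => |a|) hc.abs x.1
  have i2 := sec_int (f := fun y => f y ^ 2) (hp.op2 hp fun a _ => a ^ 2) (hc.pow 2) x.1
  set A := av (fun y => |f y|) x
  have h : 0 ≤ ∫ y in cube1 m, (f (x.1, y) ^ 2 - 2 * A * |f (x.1, y)| + A ^ 2) := integral_nonneg fun y => by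
    have := sq_nonneg (|f (x.1, y)| - A)
    have e := sq_abs (f (x.1, y))
    simp only [Pi.zero_apply]; nlinarith
  rw [integral_add (by exact i2.sub (i1.const_mul _)) (integrable_const _), integral_sub i2 (i1.const_mul _), integral_const_mul] at h
  simp only [integral_const, measureReal_restrict_apply_univ] at h
  have h1 : volume.real (cube1 m) = 1 := by
    rw [← measureReal_restrict_apply_univ]; exact probReal_univ
  rw [h1] at h
  have : (∫ y in cube1 m, |f (x.1, y)|) = A := rfl
  rw [this, one_smul] at h
  simp only [av]; nlinarith
lemma stab (hκ : 0 < κ) (hV : ∀ v, C1p (pd v V)) {M Hb K B : ℝ} (hM : ∀ o x, |pd (dir m o) V x| ≤ M) (hK : 0 ≤ K)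
    {f1 f2 φ1 φ2 : Spc m → ℝ} (h1 : C2p f1) (h2 : C2p f2) (p1 : C1p φ1) (p2 : C1p φ2) (hH : ∀ x, |φ1 x| ≤ Hb)
    (hφ : ∀ x, |φ1 x - φ2 x| ≤ K * av (fun y => |f1 y - f2 y|) x) (hB : ∀ x, |f2 x| ≤ B) :
    ∫ x, (2 * (f1 x - f2 x)) * (Rf κ V φ1 f1 x - Rf κ V φ2 f2 x) ∂(μT m) ≤
      (2 * (((m : ℝ) + 1) * ((M + Hb + K * B) ^ 2 / (2 * κ) * 2))) * ∫ x, (f1 x - f2 x) ^ 2 ∂(μT m) := by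
  have hw := (h1.sub h2).c1
  set w := fun x => f1 x - f2 x with hwd
  set c := (M + Hb + K * B) ^ 2 / (2 * κ)
  have hc : 0 ≤ c := by positivity
  have hsq := (hw.mul hw).int
  have hpa : Pr fun y => |w y| := hw.p.op2 hw.p fun a _ => |a|
  have hca : Continuous fun y => |w y| := hw.c.continuous.abs
  have hA2 : Integrable (fun x => av (fun y => |w y|) x ^ 2) (μT m) :=
    Pr.int ((av_per hpa hca).op2 (av_per hpa hca) fun a _ => a ^ 2) ((av_cont hpa hca).pow 2)
  have hps : Pr fun y => w y ^ 2 := hw.p.op2 hw.p fun a _ => a ^ 2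
  have hcs : Continuous fun y => w y ^ 2 := hw.c.continuous.pow 2
  have hAw : ∫ x, av (fun y => |w y|) x ^ 2 ∂(μT m) ≤ ∫ x, w x ^ 2 ∂(μT m) := by
    rw [← av_int hps hcs]
    exact integral_mono hA2 ((av_per hps hcs).int (av_cont hps hcs)) fun x => av_jen hw.p hw.c.continuous x
  have key : ∀ o, -∫ x, (Sf κ V φ1 f1 o x * pd (dir m o) w x - Sf κ V φ2 f2 o x * pd (dir m o) w x) ∂(μT m)
      ≤ c * 2 * ∫ x, w x ^ 2 ∂(μT m) := fun o => by
    have s1 := D1p_Sf (κ := κ) hV p1 h1 o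
    have s2 := D1p_Sf (κ := κ) hV p2 h2 o
    have i1 : Integrable (fun x => Sf κ V φ1 f1 o x * pd (dir m o) w x) (μT m) :=
      Pr.int (s1.p.op2 (hw.p.pd _) (· * ·)) (s1.d.continuous.mul (hw.cpd _))
    have i2 : Integrable (fun x => Sf κ V φ2 f2 o x * pd (dir m o) w x) (μT m) :=
      Pr.int (s2.p.op2 (hw.p.pd _) (· * ·)) (s2.d.continuous.mul (hw.cpd _))
    rw [← integral_neg]
    have i3 : Integrable (fun x => c * (w x ^ 2 + av (fun y => |w y|) x ^ 2)) (μT m) :=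
      ((hps.int hcs).add hA2).const_mul c
    refine (integral_mono (by exact (i1.sub i2).neg) i3 fun x => ?_).trans ?_
    · have hpd : pd (dir m o) w x = pd (dir m o) f1 x - pd (dir m o) f2 x := pd_sub h1.c1.d h2.c1.d x
      set A := av (fun y => |w y|) x
      have hA : 0 ≤ A := integral_nonneg fun y => abs_nonneg _
      set δ : ℝ := if o = none then 1 else 0
      have hδ : |δ| ≤ 1 := by simp only [δ]; split_ifs <;> simp
      set e := pd (dir m o) V x * w x - δ * (φ1 x * w x + (φ1 x - φ2 x) * f2 x) with he
      have hH0 := (abs_nonneg _).trans (hH x)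
      have hB0 := (abs_nonneg _).trans (hB x)
      have hM0 := (abs_nonneg _).trans (hM o x)
      have hw0 := abs_nonneg (w x)
      have heb : |e| ≤ (M + Hb + K * B) * (|w x| + A) := by
        have t1 : |pd (dir m o) V x * w x| ≤ M * |w x| := by
          rw [abs_mul]; exact mul_le_mul_of_nonneg_right (hM o x) hw0
        have t2 : |φ1 x * w x| ≤ Hb * |w x| := by rw [abs_mul]; exact mul_le_mul_of_nonneg_right (hH x) hw0
        have t3 : |(φ1 x - φ2 x) * f2 x| ≤ K * A * B := by
          rw [abs_mul]; exact mul_le_mul (hφ x) (hB x) (abs_nonneg _) (mul_nonneg hK hA)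
        have t4 : |δ * (φ1 x * w x + (φ1 x - φ2 x) * f2 x)| ≤ Hb * |w x| + K * A * B := by
          rw [abs_mul]
          exact (mul_le_of_le_one_left (abs_nonneg _) hδ).trans ((abs_add_le _ _).trans (add_le_add t2 t3))
        refine ((abs_sub _ _).trans (add_le_add t1 t4)).trans ?_
        have := mul_nonneg hM0 hA; have := mul_nonneg hH0 hA; have := mul_nonneg (mul_nonneg hK hB0) hw0
        nlinarith
      have e2 : Sf κ V φ1 f1 o x * pd (dir m o) w x - Sf κ V φ2 f2 o x * pd (dir m o) w x
          = κ * (pd (dir m o) w x) ^ 2 + e * 1 * pd (dir m o) w x := by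
        rw [he, hpd]; simp only [Sf, hwd]; ring
      have h3 := quad hκ (a := pd (dir m o) w x) (b := 1) heb
      have h4 : (|w x| + A) ^ 2 ≤ 2 * (w x ^ 2 + A ^ 2) := by
        have := sq_nonneg (|w x| - A); have := sq_abs (w x); nlinarith
      have h5 : ((M + Hb + K * B) * (|w x| + A)) ^ 2 / (4 * κ) = c / 2 * (|w x| + A) ^ 2 := by
        simp only [c]; field_simp; norm_num
      show -(Sf κ V φ1 f1 o x * pd (dir m o) w x - Sf κ V φ2 f2 o x * pd (dir m o) w x) ≤ _
      rw [e2]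
      have h6 := mul_le_mul_of_nonneg_left h4 (by positivity : 0 ≤ c / 2)
      rw [h5] at h3
      linarith
    · rw [integral_const_mul, integral_add (hps.int hcs) hA2, mul_assoc]
      exact mul_le_mul_of_nonneg_left (by linarith) hc
  have e3 : ∫ x, (2 * w x) * (Rf κ V φ1 f1 x - Rf κ V φ2 f2 x) ∂(μT m) =
      2 * ∑ o, -∫ x, (Sf κ V φ1 f1 o x * pd (dir m o) w x - Sf κ V φ2 f2 o x * pd (dir m o) w x) ∂(μT m) := by
    have e4 : ∀ x, (2 * w x) * (Rf κ V φ1 f1 x - Rf κ V φ2 f2 x) = 2 * (w x * Rf κ V φ1 f1 x - w x * Rf κ V φ2 f2 x) :=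
      fun x => by ring
    simp only [e4]
    rw [integral_const_mul, integral_sub (hw.bint (Rf_int hV p1 h1)) (hw.bint (Rf_int hV p2 h2)), weak hV p1 h1 hw,
      weak hV p2 h2 hw, ← Finset.sum_neg_distrib, ← Finset.sum_neg_distrib, ← Finset.sum_sub_distrib]
    congr 1
    refine Finset.sum_congr rfl fun o _ => ?_
    have s1 := D1p_Sf (κ := κ) hV p1 h1 o
    have s2 := D1p_Sf (κ := κ) hV p2 h2 o
    rw [integral_sub (Pr.int (s1.p.op2 (hw.p.pd _) (· * ·)) (s1.d.continuous.mul (hw.cpd _)))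
      (Pr.int (s2.p.op2 (hw.p.pd _) (· * ·)) (s2.d.continuous.mul (hw.cpd _)))]
    ring
  rw [e3]
  refine (mul_le_mul_of_nonneg_left (Finset.sum_le_sum fun o _ => key o) two_pos.le).trans (le_of_eq ?_)
  simp only [Finset.sum_const, Finset.card_univ, Fintype.card_option, Fintype.card_fin, nsmul_eq_mul]
  push_cast; ring
lemma uniq {ψ Ψ φ1 φ2 : ℝ → Spc m → ℝ} {t0 t1 p : ℝ} (hp : 2 ≤ p) (h01 : t0 ≤ t1) (hκ : 0 < κ) (hV : ∀ v, C1p (pd v V))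
    {Hb K B : ℝ} (hK : 0 ≤ K) (h1 : ∀ t ∈ Icc t0 t1, C2p (ψ t)) (h2 : ∀ t ∈ Icc t0 t1, C2p (Ψ t))
    (p1 : ∀ t ∈ Icc t0 t1, C1p (φ1 t)) (p2 : ∀ t ∈ Icc t0 t1, C1p (φ2 t)) (hH : ∀ t ∈ Icc t0 t1, ∀ x, |φ1 t x| ≤ Hb)
    (hφ : ∀ t ∈ Icc t0 t1, ∀ x, |φ1 t x - φ2 t x| ≤ K * av (fun y => |ψ t y - Ψ t y|) x)
    (hB : ∀ t ∈ Icc t0 t1, ∀ x, |Ψ t x| ≤ B) (hc : ContW 0 p (Icc t0 t1) fun t x => ψ t x - Ψ t x)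
    (hd : ∀ t ∈ Ioc t0 t1, Tendsto (fun h : ℝ => LpN p (fun x => ((ψ (t + h) x - Ψ (t + h) x) - (ψ t x - Ψ t x)) / h -
      (Rf κ V (φ1 t) (ψ t) x - Rf κ V (φ2 t) (Ψ t) x))) (𝓝[{h : ℝ | h ≠ 0}] 0) (𝓝 0))
    (h0 : ∀ x, ψ t0 x = Ψ t0 x) (x) : ψ t1 x = Ψ t1 x := by
  choose M0 hM0 hM using fun v => (hV v).bd
  have hMb : ∀ o x, |pd (dir m o) V x| ≤ ∑ o, M0 (dir m o) := fun o x => (hM _ x).trans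
    (Finset.single_le_sum (f := fun o => M0 (dir m o)) (fun _ _ => hM0 _) (Finset.mem_univ o))
  have hw : ∀ t ∈ Icc t0 t1, C1p fun x => ψ t x - Ψ t x := fun t ht => ((h1 t ht).sub (h2 t ht)).c1
  have hs : ∀ t ∈ Icc t0 t1, Integrable (fun x => (ψ t x - Ψ t x) ^ 2) (μT m) := fun t ht =>
    ((hw t ht).comp (G := fun s => s ^ 2) (by fun_prop)).int
  have hJc : ContinuousOn (fun t => ∫ x, (ψ t x - Ψ t x) ^ 2 ∂(μT m)) (Icc t0 t1) := by
    refine Jcont hp (fun t ht => (hw t ht).int) hc fun t ht => ?_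
    obtain ⟨C, hC, hb⟩ := (hw t ht).bd
    refine ⟨2 * C + 1, by positivity, fun s hs' => ?_⟩
    have hdd := (hw s hs').sub (hw t ht)
    have i1 : Integrable (fun x => |(ψ s x - Ψ s x) - (ψ t x - Ψ t x)|) (μT m) := hdd.int.abs
    have i2 : Integrable (fun x => ((ψ s x - Ψ s x) - (ψ t x - Ψ t x)) ^ 2) (μT m) :=
      (hdd.comp (G := fun s => s ^ 2) (by fun_prop)).int
    rw [← integral_sub (hs s hs') (hs t ht), ← integral_add i1 i2, ← integral_const_mul]
    refine norm_integral_le_of_norm_le (f := fun x => (ψ s x - Ψ s x) ^ 2 - (ψ t x - Ψ t x) ^ 2)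
      ((i1.add i2).const_mul _) (ae_of_all _ fun x => ?_)
    set a := ψ s x - Ψ s x
    set b := ψ t x - Ψ t x
    have hb' : |b| ≤ C := hb x
    have e : a ^ 2 - b ^ 2 = (a - b) ^ 2 + 2 * b * (a - b) := by ring
    have e2 : |2 * b * (a - b)| ≤ 2 * C * |a - b| := by
      rw [abs_mul, abs_mul, abs_two]; have := abs_nonneg (a - b); nlinarith
    rw [Real.norm_eq_abs, e]
    refine (abs_add_le _ _).trans ?_
    rw [abs_of_nonneg (sq_nonneg (a - b))]
    have := abs_nonneg (a - b); have := mul_nonneg hC (sq_nonneg (a - b))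
    nlinarith
  have := EN (w := fun t x => ψ t x - Ψ t x) (gt := fun t x => Rf κ V (φ1 t) (ψ t) x - Rf κ V (φ2 t) (Ψ t) x)
    (by linarith) h01 (fun t ht => (hw t ht).int) (fun t ht => by
      have ht := Ioc_subset_Icc_self ht
      exact (Rf_int hV (p1 t ht) (h1 t ht)).sub (Rf_int hV (p2 t ht) (h2 t ht))) hJc hd (fun t ht => by
      have ht' := Ioc_subset_Icc_self ht
      obtain ⟨C, hC, hb⟩ := (hw t ht').bd
      refine ⟨fun x => 2 * (ψ t x - Ψ t x), 2 * C, ((hw t ht').c.continuous.const_mul 2).measurable, fun x => ?_, fun s hs' => ?_,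
        stab hκ hV hMb hK (h1 t ht') (h2 t ht') (p1 t ht') (p2 t ht') (hH t ht') (hφ t ht') (hB t ht')⟩
      · rw [abs_mul, abs_two]; exact mul_le_mul_of_nonneg_left (hb x) two_pos.le
      · have hs1 : s ∈ Icc t0 t1 := ⟨hs'.1, hs'.2.le.trans ht.2⟩
        rw [← integral_sub (hs t ht') (hs s hs1)]
        refine integral_mono ((hs t ht').sub (hs s hs1))
          (((C1p.const 2).mul (hw t ht')).mul ((hw t ht').sub (hw s hs1))).int fun x => ?_
        have := sq_nonneg ((ψ t x - Ψ t x) - (ψ s x - Ψ s x))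
        simp only; nlinarith)
  have e0 : ∫ x, (ψ t0 x - Ψ t0 x) ^ 2 ∂(μT m) = 0 := by simp [h0]
  rw [e0, zero_mul] at this
  have hw1 := hw t1 ⟨h01, le_rfl⟩
  have h4 := per_int_zero (f := fun x => (ψ t1 x - Ψ t1 x) ^ 2) (hw1.comp (G := fun s => s ^ 2) (by fun_prop)).p
    (hw1.c.continuous.pow 2) (fun x => sq_nonneg _) this x
  exact sub_eq_zero.1 (pow_eq_zero_iff two_ne_zero |>.1 h4)
end FP
end
noncomputable section
namespace FP
open scoped Topology BoundedContinuousFunction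
set_option linter.unusedSectionVars false
set_option maxSynthPendingDepth 3
open GS
attribute [local irreducible] P D
variable {m : ℕ}
lemma c1d {f : ℝ → ℝ} (hf : ContDiff ℝ 1 f) (hs : HasCompactSupport f) :
    ∃ C, 0 ≤ C ∧ (∀ a, |f a| ≤ C) ∧ ∀ a b, |f a - f b| ≤ C * |a - b| := by
  obtain ⟨C, hC⟩ := hf.lipschitzWith_of_hasCompactSupport hs one_ne_zero
  obtain ⟨D, hD⟩ := hs.exists_bound_of_continuous hf.continuous
  refine ⟨max C D, le_max_of_le_left C.2, fun a => (hD a).trans (le_max_right _ _), fun a b => ?_⟩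
  have := hC.dist_le_mul a b
  rw [Real.dist_eq, Real.dist_eq] at this
  exact this.trans (by gcongr; exact le_max_left _ _)
def pB (f g : ℝ → ℝ) (hf : Continuous f) (hg : Continuous g) (C D : ℝ) (h1 : ∀ a, |f a| ≤ C) (h2 : ∀ a, |g a| ≤ D) : (ℝ × ℝ) →ᵇ ℝ :=
  BoundedContinuousFunction.ofNormedAddCommGroup (fun p => f p.1 * g p.2) (by fun_prop) (C * D) fun p => by
    rw [Real.norm_eq_abs, abs_mul]
    exact mul_le_mul (h1 _) (h2 _) (abs_nonneg _) ((abs_nonneg _).trans (h1 0))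
lemma pL {f g : ℝ → ℝ} {C D : ℝ} (h1 : ∀ a, |f a| ≤ C) (h2 : ∀ a, |g a| ≤ D) (l1 : ∀ a b, |f a - f b| ≤ C * |a - b|)
    (l2 : ∀ a b, |g a - g b| ≤ D * |a - b|) (p q : ℝ × ℝ) : |f p.1 * g p.2 - f q.1 * g q.2| ≤ 2 * C * D * ‖p - q‖ := by
  have hC := (abs_nonneg _).trans (h1 0)
  have hD := (abs_nonneg _).trans (h2 0)
  have e : f p.1 * g p.2 - f q.1 * g q.2 = (f p.1 - f q.1) * g p.2 + f q.1 * (g p.2 - g q.2) := by ring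
  have n1 : |p.1 - q.1| ≤ ‖p - q‖ := norm_fst_le (p - q)
  have n2 : |p.2 - q.2| ≤ ‖p - q‖ := norm_snd_le (p - q)
  rw [e]
  calc _ ≤ |f p.1 - f q.1| * |g p.2| + |f q.1| * |g p.2 - g q.2| := by
        rw [← abs_mul, ← abs_mul]; exact abs_add_le _ _
    _ ≤ C * ‖p - q‖ * D + C * (D * ‖p - q‖) := by
        gcongr
        · exact (l1 _ _).trans (by gcongr)
        · exact h2 _
        · exact h1 _
        · exact (l2 _ _).trans (by gcongr)
    _ = _ := by ring
lemma exists_h (A B c : ℝ) (hA : 0 ≤ A) (hc : 0 < c) (hB : c ≤ B) : ∃ (h ha hb : (ℝ × ℝ) →ᵇ ℝ) (K : ℝ), 0 ≤ K ∧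
    (∀ p, HasFDerivAt h (ha p • ContinuousLinearMap.fst ℝ ℝ ℝ + hb p • ContinuousLinearMap.snd ℝ ℝ ℝ) p) ∧
    (∀ p q, |h p - h q| ≤ K * ‖p - q‖) ∧ (∀ p q, |ha p - ha q| ≤ K * ‖p - q‖) ∧ (∀ p q, |hb p - hb q| ≤ K * ‖p - q‖) ∧
    ∀ a b, |a| ≤ A → c ≤ b → b ≤ B → h (a, b) = a / b := by
  let θ : ContDiffBump (0 : ℝ) := ⟨A + 1, A + 2, by linarith, by linarith⟩
  let η : ContDiffBump ((c + B) / 2) := ⟨(B - c) / 2 + c / 4, (B - c) / 2 + c / 2, by linarith, by linarith⟩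
  let f : ℝ → ℝ := fun a => θ a * a
  let g : ℝ → ℝ := fun b => η b * b⁻¹
  have hf : ContDiff ℝ 2 f := θ.contDiff.mul contDiff_id
  have hg : ContDiff ℝ 2 g := contDiff_iff_contDiffAt.2 fun b => by
    by_cases hb : 0 < b
    · exact η.contDiff.contDiffAt.mul (contDiffAt_inv ℝ hb.ne')
    · have : g =ᶠ[𝓝 b] fun _ => 0 := by
        filter_upwards [Iio_mem_nhds (show b < c / 2 by linarith)] with y hy
        have : η y = 0 := η.zero_of_le_dist (by
          rw [Real.dist_eq, abs_of_nonpos (by linarith [mem_Iio.1 hy])]; show (B - c) / 2 + c / 2 ≤ _; linarith [mem_Iio.1 hy])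
        simp [g, this]
      exact contDiffAt_const.congr_of_eventuallyEq this
  have sf : HasCompactSupport f := θ.hasCompactSupport.mul_right
  have sg : HasCompactSupport g := η.hasCompactSupport.mul_right
  have hf' : ContDiff ℝ 1 (deriv f) := ((contDiff_succ_iff_deriv (n := 1)).1 hf).2.2
  have hg' : ContDiff ℝ 1 (deriv g) := ((contDiff_succ_iff_deriv (n := 1)).1 hg).2.2
  obtain ⟨C, hC, f1, f2⟩ := c1d (hf.of_le one_le_two) sf
  obtain ⟨D, hD, g1, g2⟩ := c1d (hg.of_le one_le_two) sg
  obtain ⟨C', hC', f1', f2'⟩ := c1d hf' sf.deriv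
  obtain ⟨D', hD', g1', g2'⟩ := c1d hg' sg.deriv
  refine ⟨pB f g hf.continuous hg.continuous C D f1 g1, pB (deriv f) g hf'.continuous hg.continuous C' D f1' g1,
    pB f (deriv g) hf.continuous hg'.continuous C D' f1 g1', 2 * C * D + 2 * C' * D + 2 * C * D', by positivity, ?_, ?_, ?_, ?_, ?_⟩
  · intro p
    have a1 : HasFDerivAt (fun p : ℝ × ℝ => f p.1) _ p := ((hf.differentiable two_ne_zero) p.1).hasDerivAt.comp_hasFDerivAt p (hasFDerivAt_fst (𝕜 := ℝ) (E := ℝ) (F := ℝ))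
    have a2 : HasFDerivAt (fun p : ℝ × ℝ => g p.2) _ p := ((hg.differentiable two_ne_zero) p.2).hasDerivAt.comp_hasFDerivAt p (hasFDerivAt_snd (𝕜 := ℝ) (E := ℝ) (F := ℝ))
    refine (a1.mul a2).congr_fderiv ?_
    show _ = (deriv f p.1 * g p.2) • _ + (f p.1 * deriv g p.2) • _
    rw [smul_smul, smul_smul, mul_comm (g p.2), add_comm]
  · exact fun p q => (pL f1 g1 f2 g2 p q).trans (by gcongr; nlinarith [mul_nonneg hC' hD, mul_nonneg hC hD'])
  · exact fun p q => (pL f1' g1 f2' g2 p q).trans (by gcongr; nlinarith [mul_nonneg hC hD, mul_nonneg hC hD'])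
  · exact fun p q => (pL f1 g1' f2 g2' p q).trans (by gcongr; nlinarith [mul_nonneg hC hD, mul_nonneg hC' hD])
  · intro a b h1 h2 h3
    show θ a * a * (η b * b⁻¹) = a / b
    rw [θ.one_of_mem_closedBall, η.one_of_mem_closedBall]
    · ring
    · rw [Metric.mem_closedBall, Real.dist_eq, abs_le]; constructor <;> simp only [η] <;> linarith
    · rw [Metric.mem_closedBall, dist_zero_right, Real.norm_eq_abs]; exact h1.trans (by simp only [θ]; linarith)
end FP
end
noncomputable section
namespace FP
open scoped Topology BoundedContinuousFunction
set_option linter.unusedSectionVars false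
set_option maxSynthPendingDepth 3
open GS
attribute [local irreducible] P D
variable {m : ℕ} {f g V φ : Spc m → ℝ} {κ : ℝ}
structure R2 (f : Spc m → ℝ) : Prop where
  c1 : C1p f
  d : Differentiable ℝ (grd f)
  b : ∃ C, ∀ x, ‖fderiv ℝ (grd f) x‖ ≤ C
lemma R2.of (hp : Pr f) (hc : ContDiff ℝ 2 f) : R2 f := by
  have h1 : ContDiff ℝ 1 (grd f) := hc.fderiv_right (m := 1) le_rfl
  exact ⟨⟨hp, hc.of_le one_le_two⟩, h1.differentiable one_ne_zero,
    per_bdd (per_fderiv (per_fderiv hp)) (h1.continuous_fderiv one_ne_zero)⟩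
lemma C1p.of2 (hp : Pr f) (hc : ContDiff ℝ 2 f) (v) : C1p (pd v f) :=
  ⟨hp.pd v, (hc.fderiv_right (m := 1) le_rfl).clm_apply contDiff_const⟩
lemma pd2 (h : Differentiable ℝ (grd f)) (v w : Spc m) (x) : HasFDerivAt (pd v f) ((ContinuousLinearMap.apply ℝ ℝ v).comp (fderiv ℝ (grd f) x)) x :=
  (ContinuousLinearMap.apply ℝ ℝ v).hasFDerivAt.comp x (h x).hasFDerivAt
lemma C2p.mk' (h : C1p f) (hd : Differentiable ℝ (grd f)) (hi : Integrable (fun x => ‖fderiv ℝ (grd f) x‖) (μT m)) : C2p f := by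
  refine ⟨h, fun v => ⟨h.p.pd v, fun x => (pd2 hd v v x).differentiableAt, fun w => ?_⟩⟩
  refine (hi.mul_const (‖w‖ * ‖v‖)).mono' pd_meas.aestronglyMeasurable (ae_of_all _ fun x => ?_)
  rw [pd, (pd2 hd v v x).fderiv, ← mul_assoc]
  exact ((fderiv ℝ (grd f) x) w).le_of_opNorm_le ((fderiv ℝ (grd f) x).le_opNorm w) v
lemma R2.c2 (h : R2 f) : C2p f := by
  obtain ⟨C, hC⟩ := h.b
  refine C2p.mk' h.c1 h.d (Integrable.of_bound (measurable_fderiv ℝ _).norm.aestronglyMeasurable C (ae_of_all _ fun x => ?_))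
  rw [norm_norm]; exact hC x
lemma R2.mul (hf : R2 f) (hg : R2 g) : R2 fun x => f x * g x := by
  have key : ∀ {f g : Spc m → ℝ}, R2 f → R2 g → Differentiable ℝ (fun x => f x • grd g x) ∧
      ∃ C, ∀ x, ‖fderiv ℝ (fun x => f x • grd g x) x‖ ≤ C := fun {f g} hf hg => by
    obtain ⟨C0, h0, hC0⟩ := hf.c1.bd
    obtain ⟨C1, hC1⟩ := per_bdd (per_fderiv hf.c1.p) (hf.c1.c.continuous_fderiv one_ne_zero)
    obtain ⟨C2, hC2⟩ := per_bdd (per_fderiv hg.c1.p) (hg.c1.c.continuous_fderiv one_ne_zero)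
    obtain ⟨C3, hC3⟩ := hg.b
    refine ⟨hf.c1.d.smul hg.d, C0 * C3 + C1 * C2, fun x => ?_⟩
    have := (hf.c1.d x).hasFDerivAt.smul (hg.d x).hasFDerivAt
    rw [show fderiv ℝ (fun x => f x • grd g x) x = _ from this.fderiv]
    refine (norm_add_le _ _).trans (add_le_add ?_ ?_)
    · rw [norm_smul]; exact mul_le_mul (hC0 x) (hC3 x) (norm_nonneg _) h0
    · rw [ContinuousLinearMap.norm_smulRight_apply]
      exact mul_le_mul (hC1 x) (hC2 x) (norm_nonneg _) ((norm_nonneg _).trans (hC1 x))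
  have e : grd (fun x => f x * g x) = fun x => f x • grd g x + g x • grd f x := by
    ext1 x; rw [grd, fderiv_fun_mul (hf.c1.d x) (hg.c1.d x)]; rfl
  obtain ⟨a1, C, hC⟩ := key hf hg
  obtain ⟨b1, D, hD⟩ := key hg hf
  refine ⟨hf.c1.mul hg.c1, by rw [e]; exact a1.add b1, C + D, fun x => ?_⟩
  rw [e, fderiv_fun_add (a1 x) (b1 x)]
  exact (norm_add_le _ _).trans (add_le_add (hC x) (hD x))
def Wt (κ : ℝ) (V : Spc m → ℝ) (x : Spc m) : ℝ := Real.exp (-κ⁻¹ * V x)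
lemma Wt_R2 (hp : Pr V) (hc : ContDiff ℝ 2 V) (κ) : R2 (Wt κ V) :=
  R2.of (hp.op2 hp fun a _ => Real.exp (-κ⁻¹ * a)) (Real.contDiff_exp.comp (contDiff_const.mul hc))
lemma pd_Wt (hc : Differentiable ℝ V) (v x) : pd v (Wt κ V) x = -κ⁻¹ * pd v V x * Wt κ V x := by
  have := pd_comp (v := v) (G := fun s => Real.exp (-κ⁻¹ * s)) (G' := fun s => Real.exp (-κ⁻¹ * s) * (-κ⁻¹ * 1))
    (fun s => ((hasDerivAt_id s).const_mul _).exp) hc x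
  rw [show Wt κ V = fun x => Real.exp (-κ⁻¹ * V x) from rfl, this]; ring
lemma Rf_Wt (hp : Pr V) (hc : ContDiff ℝ 2 V) (hκ : 0 < κ) (hφ : C1p φ) (hf : R2 f) (x) :
    Rf κ V φ (fun x => Wt κ V x * f x) x = Wt κ V x * (κ * lap f x - ∑ o, pd (dir m o) V x * pd (dir m o) f x -
      φ x * pd (e1 m) f x - pd (e1 m) φ x * f x + κ⁻¹ * pd (e1 m) V x * φ x * f x) := by
  have hW := Wt_R2 hp hc κ
  have hd := hc.differentiable two_ne_zero
  rw [Rf_eq (C1p.of2 hp hc) hφ (hW.mul hf).c2]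
  have e : ∀ o, Sf κ V φ (fun x => Wt κ V x * f x) o = fun x => κ * (Wt κ V x * pd (dir m o) f x) -
      (if o = none then 1 else 0) * (φ x * (Wt κ V x * f x)) := fun o => by
    ext1 y
    rw [Sf, pd_mul hW.c1.d hf.c1.d, pd_Wt hd]; field_simp; ring
  have e2 : ∀ o, pd (dir m o) (Sf κ V φ (fun x => Wt κ V x * f x) o) x = Wt κ V x * (κ * pd (dir m o) (pd (dir m o) f) x -
      pd (dir m o) V x * pd (dir m o) f x - (if o = none then 1 else 0) * (φ x * pd (dir m o) f x + pd (dir m o) φ x * f x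
        - κ⁻¹ * pd (dir m o) V x * φ x * f x)) := fun o => by
    have d1 := (hf.c2.d2 (dir m o)).d
    have d2 : Differentiable ℝ fun x => Wt κ V x * pd (dir m o) f x := hW.c1.d.mul d1
    have d3 := hW.c1.mul hf.c1
    have d4 := hφ.mul d3
    rw [e, pd_sub (d2.const_mul _) (d4.d.const_mul _), pd_cmul _ d2, pd_cmul _ d4.d, pd_mul hW.c1.d d1, pd_mul hφ.d d3.d,
      pd_mul hW.c1.d hf.c1.d, pd_Wt hd]
    field_simp; ring
  rw [Finset.sum_congr rfl fun o _ => e2 o, ← Finset.mul_sum, Finset.sum_sub_distrib, Finset.sum_sub_distrib, ← Finset.mul_sum]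
  congr 1
  rw [show (∑ o, pd (dir m o) (pd (dir m o) f) x) = lap f x by rw [Fintype.sum_option]; rfl]
  simp only [ite_mul, one_mul, zero_mul, Finset.sum_ite_eq', Finset.sum_ite_eq, Finset.mem_univ, if_true]
  rw [show dir m none = e1 m from rfl]; ring
end FP
end
noncomputable section
namespace FP
open scoped Topology BoundedContinuousFunction
set_option linter.unusedSectionVars false
set_option maxSynthPendingDepth 3
open GS
attribute [local irreducible] P D
variable {m : ℕ} {f g V φ : Spc m → ℝ} {κ : ℝ}
lemma D1.fd {f : X m} {f'} (h : D1 f f') : fderiv ℝ f = f' := funext fun x => (h x).fderiv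
lemma D1.c1 {f : X m} {f'} (h : D1 f f') (hp : Pr f) : C1p f :=
  ⟨hp, contDiff_one_iff_fderiv.2 ⟨fun x => (h x).differentiableAt, by rw [h.fd]; exact f'.continuous⟩⟩
lemma D1.r2 {f : X m} {f' f''} (h : D1 f f') (h2 : D1 f' f'') (hp : Pr f) : R2 f := by
  have e : grd (f : Spc m → ℝ) = f' := h.fd
  refine ⟨h.c1 hp, ?_, ‖f''‖, fun x => ?_⟩
  · rw [e]; exact fun x => (h2 x).differentiableAt
  · rw [e, (h2 x).fderiv]; exact f''.norm_coe_le_norm x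
lemma lap_tr {f : X m} {f' f''} (h : D1 f f') (h2 : D1 f' f'') (x) : lap f x = trC (Spc m) f'' x := by
  have : ∀ v, pd v (pd v f) x = f'' x v v := fun v => by
    have e : pd v f = fun x => f' x v := by ext1 y; rw [pd, h.fd]
    have := (ContinuousLinearMap.apply ℝ ℝ v).hasFDerivAt.comp x (h2 x)
    rw [pd, e, show fderiv ℝ (fun x => f' x v) x = _ from this.fderiv]; rfl
  rw [trC_apply, trL_apply, lap, this, Finset.sum_congr rfl fun i _ => this (eC m i)]; rfl
theorem exW (hp : Pr V) (hc : ContDiff ℝ 2 V) (hκ : 0 < κ) {h ha hb : (ℝ × ℝ) →ᵇ ℝ} {K : ℝ} (hK : 0 ≤ K)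
    (dh : ∀ p, HasFDerivAt h (ha p • ContinuousLinearMap.fst ℝ ℝ ℝ + hb p • ContinuousLinearMap.snd ℝ ℝ ℝ) p)
    (lh : ∀ p q, |h p - h q| ≤ K * ‖p - q‖) (lha : ∀ p q, |ha p - ha q| ≤ K * ‖p - q‖)
    (lhb : ∀ p q, |hb p - hb q| ≤ K * ‖p - q‖) (hf : C1p f) {L : ℝ} (hL : 0 < L) :
    ∃ Ψ G : ℝ → X m, Continuous Ψ ∧ (∀ x, Ψ 0 x = f x) ∧ (∀ t, C1p (Ψ t)) ∧ (∀ t ∈ Ioo 0 L, R2 (Ψ t)) ∧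
      (∀ t, C1p fun x => h (av (fun z => pd (e1 m) V z * Ψ t z) x, av (Ψ t) x)) ∧
      (∀ t ∈ Ioo 0 L, HasDerivAt Ψ (G t) t) ∧ ContinuousOn G (Ioo 0 L) ∧
      ∀ t ∈ Ioo 0 L, ∀ x, G t x = Rf κ V (fun x => h (av (fun z => pd (e1 m) V z * Ψ t z) x, av (Ψ t) x)) (Ψ t) x := by
  have hV := C1p.of2 hp hc
  have hd := hc.differentiable two_ne_zero
  have hW := Wt_R2 hp hc κ
  have ca := (hV (e1 m)).mul hW.c1
  have bV := (C1p.const (m := m) κ⁻¹).mul (hV (e1 m))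
  let c : Cf m := {
    g := fun o => _, g' := _, ca := _, ca' := _, cb := _, cb' := _, bV := _, bV' := _, h := h, ha := ha, hb := hb, K := K, K0 := hK
    dg := fun o => (hV (dir m o)).D1, dca := ca.D1, dcb := hW.c1.D1, dbV := bV.D1
    pg := fun o => (hV _).p, pca := ca.p, pcb := hW.c1.p, pca' := per_fderiv ca.p, pcb' := per_fderiv hW.c1.p, pbV := bV.p
    dh := dh, lh := lh, lha := lha, lhb := lhb }
  set Wb : X m := toB (Wt κ V) hW.c1.p hW.c1.c.continuous with hWb
  have hI : R2 fun x => Real.exp (κ⁻¹ * V x) :=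
    R2.of (hp.op2 hp fun a _ => Real.exp (κ⁻¹ * a)) (Real.contDiff_exp.comp (contDiff_const.mul hc))
  have h0 := hI.c1.mul hf
  have hN := c.NL hκ
  obtain ⟨u, u', cu, cu', h1, cg, h2⟩ := mild_sol hκ hN h0.D1 h0.p (per_fderiv h0.p)
    (per_uc (per_fderiv h0.p) (h0.c.continuous_fderiv one_ne_zero)) hL.le
  have hS : Sol κ _ c.N L _ _ u u' := ⟨hκ, hN, cu, cu', fun t => (h1 t).1, fun t => (h1 t).2.1, fun t => (h1 t).2.2, cg,
    fun t ht => (h2 t ht).1, fun t ht => (h2 t ht).2, h0.D1⟩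
  obtain ⟨u'', hu, hc'⟩ := hS.reg fun f hf => per_uc hf f.continuous
  have hA : ∀ t x, c.A (u t, u' t) x = av (fun z => pd (e1 m) V z * (Wb * u t) z) x := fun t x => by
    refine integral_congr_ae (ae_of_all _ fun y => ?_)
    show pd (e1 m) V (x.1, y) * Wt κ V (x.1, y) * u t (x.1, y) = pd (e1 m) V (x.1, y) * (Wt κ V (x.1, y) * u t (x.1, y))
    ring
  have hph : ∀ t, (fun x => h (av (fun z => pd (e1 m) V z * (Wb * u t) z) x, av (Wb * u t) x)) = c.ph (u t, u' t) := fun t => by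
    ext1 x; rw [← hA]; rfl
  have hphc : ∀ t, C1p (c.ph (u t, u' t)) := fun t => (c.dph (h1 t).1).c1 (by
    intro k hk x
    rw [← hph]
    have q1 := av_per (f := fun z => pd (e1 m) V z * (Wb * u t) z) ((hV _).p.op2 (hW.c1.p.op2 (h1 t).2.1 (· * ·)) (· * ·))
      ((hV _).c.continuous.mul (Wb * u t).continuous) k hk x
    have q2 := av_per (f := Wb * u t) (hW.c1.p.op2 (h1 t).2.1 (· * ·)) (Wb * u t).continuous k hk x
    simp only [q1, q2])
  refine ⟨fun t => Wb * u t, fun t => Wb * (κ • trC (Spc m) (u'' t) + c.N (u t, u' t)), continuous_const.mul cu, fun x => ?_,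
    fun t => hW.c1.mul ((h1 t).1.c1 (h1 t).2.1), fun t ht => hW.mul ((h1 t).1.r2 (hu t ht).1 (h1 t).2.1),
    fun t => by rw [hph]; exact hphc t, fun t ht => (hu t ht).2.const_mul Wb, continuousOn_const.mul hc', fun t ht x => ?_⟩
  · have := (h2 0 ⟨le_rfl, hL.le⟩).1
    rw [H_zero, cvT, Ioc_self, setIntegral_empty, add_zero] at this
    show Wt κ V x * u 0 x = f x
    rw [this]
    show Real.exp (-κ⁻¹ * V x) * (Real.exp (κ⁻¹ * V x) * f x) = f x
    rw [← mul_assoc, ← Real.exp_add]; simp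
  · have r := (h1 t).1.r2 (hu t ht).1 (h1 t).2.1
    rw [hph, show ((Wb * u t : X m) : Spc m → ℝ) = fun x => Wt κ V x * u t x from rfl, Rf_Wt hp hc hκ (hphc t) r,
      lap_tr (h1 t).1 (hu t ht).1]
    have e1' : ∀ v, pd v (u t) x = u' t x v := fun v => by rw [pd, (h1 t).1.fd]
    have e2' : pd (e1 m) (c.ph (u t, u' t)) x = c.ph1 (u t, u' t) x := by
      rw [pd, (c.dph (h1 t).1).fd, Cf.dx1_apply]; simp [e1]
    simp only [e1', e2']
    show Wt κ V x * (κ * trC (Spc m) (u'' t) x + c.N (u t, u' t) x) = _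
    have : c.N (u t, u' t) x = -(∑ o, pd (dir m o) V x * u' t x (dir m o)) - c.ph (u t, u' t) x * u' t x (e1 m) -
        c.ph1 (u t, u' t) x * u t x + κ⁻¹ * pd (e1 m) V x * c.ph (u t, u' t) x * u t x := by
      simp only [Cf.N, BoundedContinuousFunction.add_apply, BoundedContinuousFunction.sub_apply, BoundedContinuousFunction.neg_apply,
        BoundedContinuousFunction.mul_apply, BoundedContinuousFunction.sum_apply, ev_apply]
      rfl
    rw [this]; ring
end FP
end
noncomputable section
namespace FP
open scoped Topology BoundedContinuousFunction
set_option linter.unusedSectionVars false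
set_option maxSynthPendingDepth 3
open GS
attribute [local irreducible] P D
variable {m : ℕ} {f g V φ : Spc m → ℝ} {κ p σ : ℝ}
lemma it2 (f : Spc m → ℝ) (x) : ‖iteratedFDeriv ℝ 2 f x‖ = ‖fderiv ℝ (grd f) x‖ := by
  rw [← norm_iteratedFDeriv_one, ← norm_iteratedFDeriv_fderiv]; rfl
lemma W2_c2 (hp : 1 ≤ p) (h : MemW 2 p f) : C2p f := by
  obtain ⟨h1, h2, h3, h4, h5⟩ := h
  have h3 := h3 one_le_two
  have h4 := h4 le_rfl
  refine C2p.mk' ⟨per_iff.1 h1, contDiff_one_iff_fderiv.2 ⟨h3, h4.continuous⟩⟩ h4 ?_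
  simp only [WNorm, it2, show ¬ (2 : ℝ) ≤ 0 by norm_num, show ¬ (2 : ℝ) < 1 by norm_num, lt_irrefl, if_false] at h5
  have : MemLp (fun x => ‖fderiv ℝ (grd f) x‖) (ENNReal.ofReal p) (μT m) :=
    ⟨(measurable_fderiv ℝ _).norm.aestronglyMeasurable, lt_of_le_of_lt le_add_self h5⟩
  exact this.integrable (by rwa [ENNReal.one_le_ofReal])
lemma eLp_le {F : Type} [NormedAddCommGroup F] {f : Spc m → F} {C : ℝ} (h : ∀ x, ‖f x‖ ≤ C) :
    eLpNorm f (ENNReal.ofReal p) (μT m) ≤ ENNReal.ofReal C := by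
  have := eLpNorm_le_of_ae_bound (p := ENNReal.ofReal p) (μ := μT m) (ae_of_all _ h)
  rwa [measure_univ, ENNReal.one_rpow, one_mul] at this
lemma R2.lp (h : R2 f) (p : ℝ) : LpN p f + eLpNorm (fun x => ‖grd f x‖) (ENNReal.ofReal p) (μT m) < ⊤ := by
  obtain ⟨C0, -, hC0⟩ := h.c1.bd
  obtain ⟨C1, hC1⟩ := per_bdd (per_fderiv h.c1.p) (h.c1.c.continuous_fderiv one_ne_zero)
  exact ENNReal.add_lt_top.2 ⟨(eLp_le hC0).trans_lt ofReal_lt_top,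
    (eLp_le (f := fun x => ‖grd f x‖) fun x => by rw [norm_norm]; exact hC1 x).trans_lt ofReal_lt_top⟩
lemma R2.w2 (h : R2 f) (p : ℝ) : MemW 2 p f := by
  refine ⟨per_iff.2 h.c1.p, h.c1.d.continuous.measurable, fun _ => h.c1.d, fun _ => h.d, ?_⟩
  obtain ⟨C, hC⟩ := h.b
  simp only [WNorm, it2, show ¬ (2 : ℝ) ≤ 0 by norm_num, show ¬ (2 : ℝ) < 1 by norm_num, lt_irrefl, if_false]
  exact ENNReal.add_lt_top.2 ⟨h.lp p, (eLp_le (f := fun x => ‖fderiv ℝ (grd f) x‖)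
    fun x => by rw [norm_norm]; exact hC x).trans_lt ofReal_lt_top⟩
lemma gagl_fin {g : Spc m → Spc m →L[ℝ] ℝ} {C s : ℝ} (hC : 0 ≤ C) (hg : ∀ x y, ‖g x - g y‖ ≤ C * ‖x - y‖) (hp : 0 < p)
    (hs : s < 1) : gagl s p g < ⊤ := by
  set α : ℝ := (m : ℝ) + 1 + s * p - p
  set F : Spc m → ℝ := fun z => C ^ p * ‖z‖ ^ (-α)
  have hdim : Module.finrank ℝ (Spc m) = m + 1 := by simp [add_comm]
  have hI : IntegrableOn F (Metric.ball 0 2) volume := by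
    refine integrableOn_ball_of_norm_le_rpow (C := C ^ p) (α := α) (by omega) (by rw [hdim]; push_cast; nlinarith)
      (ae_of_all _ fun x => ?_) ?_
    · rw [Real.norm_eq_abs, abs_of_nonneg (by positivity)]
    · exact (measurable_const.mul (measurable_norm.pow_const _)).aestronglyMeasurable
  have hfin : ∫⁻ z in Metric.ball (0 : Spc m) 2, ENNReal.ofReal (F z) < ⊤ := by
    have := hI.2
    rw [hasFiniteIntegral_iff_ofReal (ae_of_all _ fun z => by show 0 ≤ C ^ p * ‖z‖ ^ (-α); positivity)] at this
    exact this
  refine ENNReal.rpow_lt_top_of_nonneg (by positivity) (ne_of_lt ?_)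
  have key : ∀ x ∈ cube m, ∫⁻ y in cube m, ENNReal.ofReal (‖g x - g y‖ ^ p / ‖x - y‖ ^ ((m : ℝ) + 1 + s * p)) ≤
      ∫⁻ z in Metric.ball (0 : Spc m) 2, ENNReal.ofReal (F z) := fun x hx => by
    rw [← lintegral_indicator meas_cube, ← lintegral_indicator measurableSet_ball,
      ← lintegral_sub_left_eq_self (μ := volume) ((Metric.ball (0 : Spc m) 2).indicator _) x]
    refine lintegral_mono fun y => ?_
    by_cases hy : y ∈ cube m
    · have hb : x - y ∈ Metric.ball (0 : Spc m) 2 := by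
        rw [mem_ball_zero_iff]
        rw [mem_cube] at hx hy
        refine lt_of_le_of_lt (b := 1) ?_ one_lt_two
        rw [Prod.norm_def, sup_le_iff, pi_norm_le_iff_of_nonneg zero_le_one]
        refine ⟨abs_le.2 ⟨?_, ?_⟩, fun i => abs_le.2 ⟨?_, ?_⟩⟩
        · simp only [Prod.fst_sub]; linarith [hx.1.1, hx.1.2, hy.1.1, hy.1.2]
        · simp only [Prod.fst_sub]; linarith [hx.1.1, hx.1.2, hy.1.1, hy.1.2]
        · simp only [Prod.snd_sub, Pi.sub_apply]; linarith [(hx.2 i).1, (hx.2 i).2, (hy.2 i).1, (hy.2 i).2]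
        · simp only [Prod.snd_sub, Pi.sub_apply]; linarith [(hx.2 i).1, (hx.2 i).2, (hy.2 i).1, (hy.2 i).2]
      rw [indicator_of_mem hy, indicator_of_mem hb]
      refine ENNReal.ofReal_le_ofReal ?_
      by_cases hxy : x = y
      · rw [hxy, sub_self, norm_zero, Real.zero_rpow hp.ne', zero_div]; positivity
      · have h0 : 0 < ‖x - y‖ := norm_pos_iff.2 (sub_ne_zero.2 hxy)
        show _ ≤ C ^ p * ‖x - y‖ ^ (-α)
        rw [show -α = p - ((m : ℝ) + 1 + s * p) by simp only [α]; ring, Real.rpow_sub h0, ← mul_div_assoc,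
          ← Real.mul_rpow hC h0.le]
        gcongr
        exact hg x y
    · rw [indicator_of_notMem hy]; exact zero_le
  calc _ ≤ ∫⁻ x in cube m, ∫⁻ z in Metric.ball (0 : Spc m) 2, ENNReal.ofReal (F z) := setLIntegral_mono' meas_cube key
    _ < ⊤ := by
      rw [lintegral_const]
      exact ENNReal.mul_lt_top hfin (measure_lt_top (μT m) _)
lemma R2.lip (h : R2 f) : ∃ C, 0 ≤ C ∧ ∀ x y, ‖grd f x - grd f y‖ ≤ C * ‖x - y‖ := by
  obtain ⟨C, hC⟩ := h.b
  exact ⟨C, (norm_nonneg _).trans (hC 0), fun x y =>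
    convex_univ.norm_image_sub_le_of_norm_fderiv_le (fun z _ => h.d z) (fun z _ => hC z) (mem_univ y) (mem_univ x)⟩
lemma R2.wσ (h : R2 f) (hp : 0 < p) (h1 : 1 < σ) (h2 : σ < 2) : MemW σ p f := by
  refine ⟨per_iff.2 h.c1.p, h.c1.d.continuous.measurable, fun _ => h.c1.d, fun _ => h.d, ?_⟩
  obtain ⟨C, hC, hl⟩ := h.lip
  simp only [WNorm, show ¬ σ ≤ 0 by linarith, show ¬ σ < 1 by linarith, h2, h1.ne', if_false, if_true]
  exact ENNReal.add_lt_top.2 ⟨h.lp p, gagl_fin hC hl hp (by linarith)⟩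
end FP
end
noncomputable section
namespace FP
open scoped Topology BoundedContinuousFunction
set_option linter.unusedSectionVars false
set_option maxSynthPendingDepth 3
open GS
attribute [local irreducible] P D
variable {m : ℕ} {f g V φ ψ0 : Spc m → ℝ} {κ p σ β : ℝ}
lemma W0 (f : Spc m → ℝ) : WNorm 0 p f = LpN p f := by simp [WNorm]
lemma sup_contW {Γ : ℝ → X m} {s : Set ℝ} (h : ContinuousOn Γ s) : ContW 0 p s fun t x => Γ t x := by
  intro t ht ε hε
  obtain ⟨δ, hδ, hd⟩ := Metric.continuousOn_iff.1 h t ht (ε / 2) (by positivity)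
  refine ⟨δ, hδ, fun t' ht' h' => ?_⟩
  have := hd t' ht' h'
  rw [W0]
  refine (eLp_le (C := ε / 2) fun x => ?_).trans_lt ((ENNReal.ofReal_lt_ofReal_iff hε).2 (by linarith))
  rw [dist_eq_norm] at this
  exact ((Γ t' - Γ t).norm_coe_le_norm x).trans this.le
lemma sup_der {Γ : ℝ → X m} {G : X m} {t : ℝ} (h : HasDerivAt Γ G t) :
    Tendsto (fun h : ℝ => LpN p (fun x => (Γ (t + h) x - Γ t x) / h - G x)) (𝓝[{h : ℝ | h ≠ 0}] 0) (𝓝 0) := by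
  have h1 := hasDerivAt_iff_tendsto_slope_zero.1 h
  have h2 : Tendsto (fun h : ℝ => ENNReal.ofReal ‖h⁻¹ • (Γ (t + h) - Γ t) - G‖) (𝓝[≠] 0) (𝓝 0) := by
    have := ENNReal.tendsto_ofReal ((h1.sub_const G).norm)
    rwa [sub_self, norm_zero, ENNReal.ofReal_zero] at this
  refine tendsto_of_tendsto_of_tendsto_of_le_of_le tendsto_const_nhds h2 (fun _ => zero_le) fun k => eLp_le fun x => ?_
  refine le_trans (le_of_eq ?_) ((k⁻¹ • (Γ (t + k) - Γ t) - G).norm_coe_le_norm x)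
  rw [div_eq_inv_mul]; rfl
lemma glueW {a b r : ℝ → Spc m → ℝ} {s : Set ℝ} {T t0 : ℝ} (h0 : t0 < T) (ha : ContW 0 p (s ∩ Iio T) a)
    (hb : ContW 0 p (s ∩ Ioi t0) b) (h1 : ∀ t ∈ s, t < T → r t = a t) (h2 : ∀ t ∈ s, t0 < t → r t = b t) : ContW 0 p s r := by
  intro t ht ε hε
  rcases lt_or_ge t T with hT | hT
  · obtain ⟨δ, hδ, hd⟩ := ha t ⟨ht, hT⟩ ε hε
    refine ⟨min δ (T - t), lt_min hδ (by linarith), fun t' ht' h' => ?_⟩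
    have hT' : t' < T := by linarith [(abs_lt.1 (h'.trans_le (min_le_right _ _))).2]
    rw [h1 t ht hT, h1 t' ht' hT']
    exact hd t' ⟨ht', hT'⟩ (h'.trans_le (min_le_left _ _))
  · have hT0 : t0 < t := by linarith
    obtain ⟨δ, hδ, hd⟩ := hb t ⟨ht, hT0⟩ ε hε
    refine ⟨min δ (t - t0), lt_min hδ (by linarith), fun t' ht' h' => ?_⟩
    have hT' : t0 < t' := by linarith [(abs_lt.1 (h'.trans_le (min_le_right _ _))).1]
    rw [h2 t ht hT0, h2 t' ht' hT']
    exact hd t' ⟨ht', hT'⟩ (h'.trans_le (min_le_left _ _))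
lemma Ico0_eq {T : ℝ} (hT : 0 < T) : Ico0 (ENNReal.ofReal T) = Ico 0 T := by
  ext t; simp [Ico0, ENNReal.ofReal_lt_ofReal_iff hT]
lemma Ioo0_eq {T : ℝ} (hT : 0 < T) : Ioo0 (ENNReal.ofReal T) = Ioo 0 T := by
  ext t; simp [Ioo0, ENNReal.ofReal_lt_ofReal_iff hT]
lemma mem_Ico_cases {T t : ℝ} (h : t ∈ Ico 0 T) : t = 0 ∨ t ∈ Ioo 0 T := by
  rcases h.1.eq_or_lt with e | e; exacts [Or.inl e.symm, Or.inr ⟨e, h.2⟩]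
lemma toAP {T : ℝ} (hT : 0 < T) {ψ : ℝ → Spc m → ℝ} (hp : 2 ≤ p) (hσ : 1 ≤ σ) (hV : ContDiff ℝ 2 V) (hVper : IsPeriodic V) (hβ : 0 < β)
    (h0 : MemD σ p ψ0) (h : IsLpSolution V β σ p ψ0 (ENNReal.ofReal T) ψ) : AP β⁻¹ V p T ψ := by
  have hi : ψ 0 = ψ0 := funext h.init
  have h2 := h.regW2
  have h3 := h.regD
  have h4 := h.contLp
  have h5 := h.eqn
  rw [Ioo0_eq hT] at h2 h3 h5
  rw [Ico0_eq hT] at h4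
  have hD : ∀ t ∈ Ico 0 T, MemD σ p (ψ t) := fun t ht => by
    rcases mem_Ico_cases ht with rfl | ht
    · rwa [hi]
    · exact h3 t ht
  exact ⟨hp, inv_pos.2 hβ, C1p.of2 (per_iff.1 hVper) hV, fun t ht => per_iff.1 (hD t ht).1.1,
    fun t ht => ((hD t ht).1.2.2.1 hσ).continuous, fun t ht => W2_c2 (by linarith) (h2 t ht), fun t ht x => (hD t ht).2 x.1, h4, h5⟩
end FP
end
noncomputable section
namespace FP
open scoped Topology BoundedContinuousFunction
set_option linter.unusedSectionVars false
set_option maxSynthPendingDepth 3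
open GS
attribute [local irreducible] P D
variable {m : ℕ} {f g V φ ψ0 : Spc m → ℝ} {κ p σ β : ℝ}
lemma av_mono (hf : Pr f) (hg : Pr g) (cf : Continuous f) (cg : Continuous g) (h : ∀ x, f x ≤ g x) (x) : av f x ≤ av g x :=
  integral_mono (sec_int hf cf x.1) (sec_int hg cg x.1) fun _ => h _
lemma av_dif (hf : Pr f) (hg : Pr g) (cf : Continuous f) (cg : Continuous g) {q : Spc m → ℝ} (hq : C1p q) {M : ℝ}
    (hM : ∀ x, |q x| ≤ M) (x) : |av (fun z => q z * f z) x - av (fun z => q z * g z) x| ≤ M * av (fun z => |f z - g z|) x := by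
  have i1 := sec_int (f := fun z => q z * f z) (hq.p.op2 hf (· * ·)) (hq.c.continuous.mul cf) x.1
  have i2 := sec_int (f := fun z => q z * g z) (hq.p.op2 hg (· * ·)) (hq.c.continuous.mul cg) x.1
  have i3 := sec_int (f := fun z => |f z - g z|) (hf.op2 hg fun a b => |a - b|) (cf.sub cg).abs x.1
  rw [av, av, ← integral_sub i1 i2, av, ← integral_const_mul]
  refine norm_integral_le_of_norm_le (f := fun y => q (x.1, y) * f (x.1, y) - q (x.1, y) * g (x.1, y)) (i3.const_mul M) (ae_of_all _ fun y => ?_)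
  rw [← mul_sub, norm_mul]
  exact mul_le_mul_of_nonneg_right (hM _) (norm_nonneg _)
lemma av_dif1 (hf : Pr f) (hg : Pr g) (cf : Continuous f) (cg : Continuous g) (x) : |av f x - av g x| ≤ av (fun z => |f z - g z|) x := by
  have := av_dif hf hg cf cg (C1p.const 1) (M := 1) (fun _ => by simp) x
  simpa using this
lemma av_bd {ε : ℝ} (hf : Pr f) (cf : Continuous f) (h : ∀ x, f x ≤ ε) (x) : av f x ≤ ε := by
  refine (av_mono hf (C1p.const ε).p cf continuous_const h x).trans (le_of_eq ?_)
  rw [av, integral_const, measureReal_restrict_apply_univ, ← measureReal_restrict_apply_univ, probReal_univ, one_smul]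
lemma AP.bounds {T : ℝ} {ψ : ℝ → Spc m → ℝ} (h : AP κ V p T ψ) (hT : 0 < T) (h0 : ∀ x, 0 ≤ ψ 0 x) {M : ℝ} (hM : ∀ x, |pd (e1 m) V x| ≤ M) :
    ∃ c B, 0 < c ∧ c ≤ B ∧ ∀ t ∈ Ico 0 T, ∀ x, c ≤ av (ψ t) x ∧ av (ψ t) x ≤ B ∧
      |av (fun z => pd (e1 m) V z * ψ t z) x| ≤ M * B := by
  have h00 : (0 : ℝ) ∈ Ico 0 T := ⟨le_rfl, hT⟩
  have ap := av_per (h.per 0 h00) (h.c 0 h00)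
  have ac := av_cont (h.per 0 h00) (h.c 0 h00)
  obtain ⟨B, hB⟩ := per_bdd ap ac
  obtain ⟨C, hC⟩ := per_bdd (f := fun x => (av (ψ 0) x)⁻¹) (ap.op2 ap fun a _ => a⁻¹) (ac.inv₀ fun x => (h.mpos 0 h00 x).ne')
  have hi : ∀ x, (av (ψ 0) x)⁻¹ ≤ C := fun x => (le_abs_self _).trans (hC x)
  have hC0 : 0 < C := (inv_pos.2 (h.mpos 0 h00 0)).trans_le (hi 0)
  have h1 : ∀ x, C⁻¹ ≤ av (ψ 0) x := fun x => inv_le_of_inv_le₀ (h.mpos 0 h00 x) (hi x)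
  have h2 : ∀ x, av (ψ 0) x ≤ B := fun x => (le_abs_self _).trans (hB x)
  refine ⟨C⁻¹, B, inv_pos.2 hC0, (h1 0).trans (h2 0), fun t ht x => ?_⟩
  have a1 := h.mbd 1 C⁻¹ (by simp) (fun x => by linarith [h1 x]) ht x
  have a2 := h.mbd (-1) B (by simp) (fun x => by linarith [h2 x]) ht x
  have a3 := av_dif (h.per t ht) (C1p.const 0).p (h.c t ht) continuous_const (h.hV (e1 m)) hM x
  have e0 : av (fun _ : Spc m => (0 : ℝ)) x = 0 := by simp [av]
  simp only [mul_zero, sub_zero, e0, abs_of_nonneg (h.pos h0 ht _)] at a3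
  refine ⟨by linarith, by linarith, a3.trans ?_⟩
  exact mul_le_mul_of_nonneg_left (by linarith) ((abs_nonneg _).trans (hM 0))
end FP
end
noncomputable section
namespace FP
open scoped Topology BoundedContinuousFunction
set_option linter.unusedSectionVars false
set_option maxSynthPendingDepth 3
open GS
attribute [local irreducible] P D
variable {m : ℕ} {f g V φ ψ0 : Spc m → ℝ} {κ p σ β : ℝ}
lemma LpN_sub {a b : Spc m → ℝ} (hp : 1 ≤ p) (ha : AEStronglyMeasurable a (μT m)) (hb : AEStronglyMeasurable b (μT m)) :
    LpN p (fun x => a x - b x) ≤ LpN p a + LpN p b :=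
  eLpNorm_sub_le ha hb (by rwa [ENNReal.one_le_ofReal])
lemma coincide {T t0 L : ℝ} {ψ : ℝ → Spc m → ℝ} (h : AP κ V p T ψ) (ht0 : 0 < t0) (hL : T ≤ t0 + L)
    {hh : (ℝ × ℝ) →ᵇ ℝ} {K M : ℝ} (hK : 0 ≤ K) (lh : ∀ p q, |hh p - hh q| ≤ K * ‖p - q‖)
    (hM : ∀ x, |pd (e1 m) V x| ≤ M) (hM0 : 0 ≤ M) {Ψ G : ℝ → X m} (cΨ : Continuous Ψ) (i0 : ∀ x, Ψ 0 x = ψ t0 x) (c1 : ∀ t, C1p (Ψ t))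
    (r2 : ∀ t ∈ Ioo 0 L, R2 (Ψ t)) (cφ : ∀ t, C1p fun x => hh (av (fun z => pd (e1 m) V z * Ψ t z) x, av (Ψ t) x))
    (dΨ : ∀ t ∈ Ioo 0 L, HasDerivAt Ψ (G t) t)
    (eG : ∀ t ∈ Ioo 0 L, ∀ x, G t x = Rf κ V (fun x => hh (av (fun z => pd (e1 m) V z * Ψ t z) x, av (Ψ t) x)) (Ψ t) x)
    (hreg : ∀ t ∈ Ico 0 T, ∀ x, hh (av (fun z => pd (e1 m) V z * ψ t z) x, av (ψ t) x) = phf V (ψ t) x)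
    {t1 : ℝ} (h1 : t0 ≤ t1) (h2 : t1 < T) (x) : ψ t1 x = Ψ (t1 - t0) x := by
  have hI : ∀ t ∈ Icc t0 t1, t ∈ Ioo 0 T := fun t ht => ⟨ht0.trans_le ht.1, ht.2.trans_lt h2⟩
  have hJ : ∀ t ∈ Icc t0 t1, t ∈ Ico 0 T := fun t ht => Ioo_subset_Ico_self (hI t ht)
  have hp1 : 1 ≤ p := one_le_two.trans h.hp
  have hpos : ∀ t ∈ Ioc t0 t1, t - t0 ∈ Ioo 0 L := fun t ht => ⟨by linarith [ht.1], by linarith [ht.2]⟩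
  have cΦ : Continuous fun t => Ψ (t - t0) := cΨ.comp (by fun_prop)
  obtain ⟨B, hB⟩ := isCompact_Icc.exists_bound_of_continuousOn (s := Icc t0 t1) cΦ.continuousOn
  refine uniq (ψ := ψ) (Ψ := fun t => Ψ (t - t0)) (φ1 := fun t => phf V (ψ t)) (K := K * (M + 1)) (Hb := ‖hh‖) (B := B)
    (φ2 := fun t x => hh (av (fun z => pd (e1 m) V z * Ψ (t - t0) z) x, av (Ψ (t - t0)) x)) h.hp h1 h.hκ h.hV (by positivity)
    (fun t ht => h.c2 t (hI t ht)) (fun t ht => ?_) (fun t ht => h.ph (hI t ht)) (fun t _ => cφ _) (fun t ht x => ?_) (fun t ht x => ?_)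
    (fun t ht x => ((Ψ (t - t0)).norm_coe_le_norm x).trans (hB t ht)) (fun t ht ε hε => ?_) (fun t ht => ?_) (fun x => ?_) x
  · rcases ht.1.eq_or_lt with e | e
    · have : (Ψ (t - t0) : Spc m → ℝ) = ψ t0 := by rw [← e, sub_self]; exact funext i0
      simp only [this]; exact h.c2 t0 (hI t0 ⟨le_rfl, h1⟩)
    · exact (r2 _ (hpos t ⟨e, ht.2⟩)).c2
  · rw [← hreg t (hJ t ht)]; exact hh.norm_coe_le_norm _
  · rw [← hreg t (hJ t ht), mul_assoc]
    refine (lh _ _).trans (mul_le_mul_of_nonneg_left ?_ hK)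
    have a := h.per t (hJ t ht)
    have b := h.c t (hJ t ht)
    have b1 := av_dif a (c1 (t - t0)).p b (Ψ (t - t0)).continuous (h.hV (e1 m)) hM x
    have b2 := av_dif1 a (c1 (t - t0)).p b (Ψ (t - t0)).continuous x
    have b3 := (abs_nonneg _).trans b2
    rw [Prod.norm_def, sup_le_iff]
    constructor
    · exact b1.trans (by nlinarith)
    · exact b2.trans (by nlinarith)
  · obtain ⟨δ1, hδ1, hd1⟩ := h.cont t (hJ t ht) (ε / 2) (by positivity)
    obtain ⟨δ2, hδ2, hd2⟩ := sup_contW (p := p) cΦ.continuousOn t ht (ε / 2) (by positivity)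
    refine ⟨min δ1 δ2, lt_min hδ1 hδ2, fun t' ht' h' => ?_⟩
    have e1 := hd1 t' (hJ t' ht') (h'.trans_le (min_le_left _ _))
    have e2 := hd2 t' ht' (h'.trans_le (min_le_right _ _))
    rw [W0] at e1 e2 ⊢
    have := LpN_sub hp1 (a := fun x => ψ t' x - ψ t x) (b := fun x => Ψ (t' - t0) x - Ψ (t - t0) x)
      ((h.c t' (hJ t' ht')).sub (h.c t (hJ t ht))).aestronglyMeasurable
      ((Ψ (t' - t0)).continuous.sub (Ψ (t - t0)).continuous).aestronglyMeasurable
    have e3 := this.trans_lt (ENNReal.add_lt_add e1 e2)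
    rw [← ENNReal.ofReal_add (by positivity) (by positivity), add_halves] at e3
    refine lt_of_eq_of_lt ?_ e3
    congr 1; ext1 x; ring
  · have ht' := Ioc_subset_Icc_self ht
    have hs := hpos t ht
    have d2 := sup_der (p := p) (Γ := fun t => Ψ (t - t0)) (by simpa using (dΨ _ hs).comp_sub_const t t0)
    have d1 := h.eqn t (hI t ht')
    have d3 := d1.add d2
    rw [add_zero] at d3
    refine tendsto_of_tendsto_of_tendsto_of_le_of_le' tendsto_const_nhds d3 (Eventually.of_forall fun _ => zero_le) ?_
    have ev : ∀ᶠ k : ℝ in 𝓝[{h : ℝ | h ≠ 0}] 0, t + k ∈ Ioo 0 T := by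
      have : Tendsto (fun k : ℝ => t + k) (𝓝 0) (𝓝 t) := by
        have : Continuous fun k : ℝ => t + k := by fun_prop
        simpa using this.tendsto 0
      exact (this.eventually (isOpen_Ioo.mem_nhds (hI t ht'))).filter_mono nhdsWithin_le_nhds
    filter_upwards [ev] with k hk
    have m1 : AEStronglyMeasurable (fun x => (ψ (t + k) x - ψ t x) / k - Rf κ V (phf V (ψ t)) (ψ t) x) (μT m) :=
      (((h.c _ (Ioo_subset_Ico_self hk)).sub (h.c t (hJ t ht'))).div_const k).aestronglyMeasurable.sub
        (Rf_int h.hV (h.ph (hI t ht')) (h.c2 t (hI t ht'))).aestronglyMeasurable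
    have m2 : AEStronglyMeasurable (fun x => (Ψ (t + k - t0) x - Ψ (t - t0) x) / k - G (t - t0) x) (μT m) :=
      ((((Ψ _).continuous.sub (Ψ _).continuous).div_const k).sub (G (t - t0)).continuous).aestronglyMeasurable
    refine le_trans (le_of_eq ?_) (LpN_sub hp1 m1 m2)
    congr 1; ext1 x
    rw [eG _ hs]; ring
  · simp only [sub_self]; exact (i0 x).symm
end FP
end
noncomputable section
namespace FP
open scoped Topology BoundedContinuousFunction
set_option linter.unusedSectionVars false
set_option maxSynthPendingDepth 3
open GS
attribute [local irreducible] P D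
variable {m : ℕ} {V ψ0 : Spc m → ℝ} {p σ β : ℝ}
theorem extend {T : ℝ} (hT : 0 < T) {ψ : ℝ → Spc m → ℝ} (hV : ContDiff ℝ 2 V) (hVper : IsPeriodic V) (hβ : 0 < β)
    (h1 : Hyp1 σ p ψ0) (h2 : Hyp2 m σ p) (hψ : IsLpSolution V β σ p ψ0 (ENNReal.ofReal T) ψ) :
    ∃ T' > T, ∃ ψ', IsLpSolution V β σ p ψ0 (ENNReal.ofReal T') ψ' ∧ ∀ t < T, ψ' t = ψ t := by
  obtain ⟨hm, hpm, hσ1, hσ2⟩ := h2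
  have hm' : (1 : ℝ) ≤ m := by exact_mod_cast hm
  have hp2 : 2 ≤ p := by linarith
  have hσ : 1 < σ := by
    have : 0 ≤ ((m : ℝ) + 1) / p := by positivity
    linarith
  have hp := per_iff.1 hVper
  have hκ := inv_pos.2 hβ
  have h := toAP hT hp2 hσ.le hV hVper hβ h1.1 hψ
  obtain ⟨M, hM0, hM⟩ := (h.hV (e1 m)).bd
  obtain ⟨c, B, hc, hcB, hb⟩ := h.bounds hT (fun x => by rw [hψ.init]; exact h1.2.1 x) hM
  have hB := hc.trans_le hcB
  obtain ⟨hh, ha, hb', K, hK, dh, lh, lha, lhb, hreg⟩ := exists_h (M * B + 1) (B + 1) (c / 2) (by positivity) (by positivity) (by linarith)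
  set t0 := T / 2 with ht0
  have t00 : t0 ∈ Ioo 0 T := ⟨by positivity, by linarith⟩
  obtain ⟨Ψ, G, cΨ, i0, c1, r2, cφ, dΨ, cG, eG⟩ := exW hp hV hκ hK dh lh lha lhb (h.c2 t0 t00).c1 hT
  have co : ∀ t, t0 ≤ t → t < T → ψ t = Ψ (t - t0) := fun t a b => funext fun x =>
    coincide h t00.1 (by linarith) hK lh hM hM0 cΨ i0 c1 r2 cφ dΨ eG (fun t ht x => by
      obtain ⟨b1, b2, b3⟩ := hb t ht x
      exact hreg _ _ (by linarith) (by linarith) (by linarith)) a b x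
  have cΦ : Continuous fun t => Ψ (t - t0) := cΨ.comp (by fun_prop)
  set ε := min (c / 2) (1 / (M + 1)) with hε
  have hε0 : 0 < ε := lt_min (by positivity) (by positivity)
  obtain ⟨δ0, hδ0, hd⟩ := Metric.continuous_iff.1 cΦ T (ε / 2) (by positivity)
  set δ := min δ0 t0 with hδ
  have hδp : 0 < δ := lt_min hδ0 t00.1
  have δ1 : δ ≤ δ0 := min_le_left _ _
  have δ2 : δ ≤ t0 := min_le_right _ _
  have near : ∀ t, t0 ≤ t → t < T + δ → ∃ s ∈ Ico 0 T, ∀ x, |Ψ (t - t0) x - ψ s x| ≤ ε := fun t a b => by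
    rcases lt_or_ge t T with e | e
    · exact ⟨t, ⟨t00.1.le.trans a, e⟩, fun x => by rw [co t a e, sub_self, abs_zero]; exact hε0.le⟩
    · refine ⟨T - δ / 2, ⟨by linarith, by linarith⟩, fun x => ?_⟩
      rw [co _ (by linarith) (by linarith)]
      have d1 := hd t (by rw [Real.dist_eq, abs_of_nonneg] <;> linarith)
      have d2 := hd (T - δ / 2) (by rw [Real.dist_eq, abs_of_nonpos] <;> linarith)
      have d3 := (dist_triangle_right _ _ _).trans_lt (add_lt_add d1 d2)
      rw [add_halves, dist_eq_norm] at d3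
      exact ((Ψ (t - t0) - Ψ (T - δ / 2 - t0)).norm_coe_le_norm x).trans d3.le
  have good : ∀ t, t0 ≤ t → t < T + δ → ∀ x, 0 < av (Ψ (t - t0)) x ∧
      hh (av (fun z => pd (e1 m) V z * Ψ (t - t0) z) x, av (Ψ (t - t0)) x) = phf V (Ψ (t - t0)) x := fun t a b x => by
    obtain ⟨s, hs, hn⟩ := near t a b
    obtain ⟨b1, b2, b3⟩ := hb s hs x
    have pΨ := (c1 (t - t0)).p
    have kΨ := (Ψ (t - t0)).continuous
    have l0 := av_bd (f := fun z => |Ψ (t - t0) z - ψ s z|) (pΨ.op2 (h.per s hs) fun a b => |a - b|) (kΨ.sub (h.c s hs)).abs hn x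
    have l1 := abs_le.1 ((av_dif1 pΨ (h.per s hs) kΨ (h.c s hs) x).trans l0)
    have l2 := (av_dif pΨ (h.per s hs) kΨ (h.c s hs) (h.hV (e1 m)) hM x).trans (mul_le_mul_of_nonneg_left l0 hM0)
    have ε1 : ε ≤ c / 2 := min_le_left _ _
    have ε2 : ε * (M + 1) ≤ 1 := (le_div_iff₀ (by positivity)).1 (min_le_right _ _)
    have ε3 : 0 ≤ ε * M := by positivity
    refine ⟨by linarith [l1.1], hreg _ _ ?_ (by linarith [l1.1]) ?_⟩
    · have := abs_sub_abs_le_abs_sub (av (fun z => pd (e1 m) V z * Ψ (t - t0) z) x) (av (fun z => pd (e1 m) V z * ψ s z) x)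
      linarith
    · linarith [l1.2]
  have hT' : 0 < T + δ := by linarith
  have hpos : ∀ t, t0 < t → t < T + δ → t - t0 ∈ Ioo 0 T := fun t a b => ⟨by linarith, by linarith⟩
  have eG' : ∀ t, t0 < t → t < T + δ → ∀ x, G (t - t0) x = β⁻¹ * lap (Ψ (t - t0)) x + Fop V (Ψ (t - t0)) x := fun t a b x => by
    rw [eG _ (hpos t a b), funext fun x => (good t a.le b x).2]; rfl
  set ψ' : ℝ → Spc m → ℝ := fun t => if t < T then ψ t else Ψ (t - t0) with hψ'
  have e1' : ∀ t, t < T → ψ' t = ψ t := fun t ht => if_pos ht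
  have e2' : ∀ t, t0 ≤ t → ψ' t = Ψ (t - t0) := fun t ht => by
    rcases lt_or_ge t T with e | e
    · rw [e1' t e, co t ht e]
    · exact if_neg (not_lt.2 e)
  have r2' : ∀ t, t0 < t → t < T + δ → R2 (ψ' t) := fun t a b => by rw [e2' t a.le]; exact r2 _ (hpos t a b)
  have hc0 := hψ.contLp
  have hw := hψ.regW2
  have hD := hψ.regD
  have he := hψ.eqn
  have hdc := hψ.derivCont
  rw [Ioo0_eq hT] at hw hD he hdc
  rw [Ico0_eq hT] at hc0
  have mono : ∀ {s s' : Set ℝ} {a : ℝ → Spc m → ℝ}, s ⊆ s' → ContW 0 p s' a → ContW 0 p s a := fun hs h t ht ε hε => by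
    obtain ⟨δ, hδ, hd⟩ := h t (hs ht) ε hε
    exact ⟨δ, hδ, fun t' ht' => hd t' (hs ht')⟩
  have sub1 : Ico 0 (T + δ) ∩ Iio T ⊆ Ico 0 T := fun t ht => ⟨ht.1.1, ht.2⟩
  have sub2 : Ioo 0 (T + δ) ∩ Iio T ⊆ Ioo 0 T := fun t ht => ⟨ht.1.1, ht.2⟩
  refine ⟨T + δ, by linarith, ψ', ⟨fun x => ?_, ?_, ?_, ?_, ?_, ?_⟩, e1'⟩
  · rw [e1' 0 hT, hψ.init]
  · rw [Ico0_eq hT']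
    exact glueW t00.2 (mono sub1 hc0) (sup_contW cΦ.continuousOn) (fun t _ => e1' t) fun t _ ht => e2' t (le_of_lt ht)
  · rw [Ioo0_eq hT']
    intro t ht
    rcases lt_or_ge t T with e | e
    · rw [e1' t e]; exact hw t ⟨ht.1, e⟩
    · exact (r2' t (by linarith [t00.2]) ht.2).w2 p
  · rw [Ioo0_eq hT']
    intro t ht
    rcases lt_or_ge t T with e | e
    · rw [e1' t e]; exact hD t ⟨ht.1, e⟩
    · have a : t0 < t := by linarith [t00.2]
      refine ⟨(r2' t a ht.2).wσ (by linarith) hσ hσ2, fun x1 => ?_⟩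
      rw [e2' t a.le]; exact (good t a.le ht.2 (x1, 0)).1
  · rw [Ioo0_eq hT']
    intro t ht
    have tk : Tendsto (fun k : ℝ => t + k) (𝓝[{h : ℝ | h ≠ 0}] 0) (𝓝 t) := by
      have : Continuous fun k : ℝ => t + k := by fun_prop
      exact Tendsto.mono_left (by simpa using this.tendsto 0) nhdsWithin_le_nhds
    rcases lt_or_ge t T with e | e
    · refine (he t ⟨ht.1, e⟩).congr' ?_
      filter_upwards [tk.eventually (Iio_mem_nhds e)] with k hk
      rw [e1' t e, e1' (t + k) hk]
    · have a : t0 < t := by linarith [t00.2]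
      have d2 := sup_der (p := p) (Γ := fun t => Ψ (t - t0)) (by simpa using (dΨ _ (hpos t a ht.2)).comp_sub_const t t0)
      refine d2.congr' ?_
      filter_upwards [tk.eventually (Ioi_mem_nhds a)] with k hk
      rw [e2' t a.le, e2' (t + k) (le_of_lt hk)]
      simp only [eG' t a ht.2]
  · rw [Ioo0_eq hT']
    have cG' : ContinuousOn (fun t => G (t - t0)) (Ioo 0 (T + δ) ∩ Ioi t0) :=
      cG.comp (by fun_prop) fun t ht => hpos t ht.2 ht.1.2
    refine glueW (r := fun t x => β⁻¹ * lap (ψ' t) x + Fop V (ψ' t) x) t00.2 (mono sub2 hdc) (sup_contW cG') (fun t _ ht => by rw [e1' t ht]) fun t ht ht' => by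
      rw [e2' t (le_of_lt ht')]; exact funext fun x => (eG' t ht' ht.2 x).symm
end FP
end

/-- **Global existence (Theorem `glo` (i)).** Assume `[H₁]` and `[H₂]` and let `ψ` be the
maximal `L^p`-solution of the nonlocal Fokker–Planck equation with maximal interval of
existence `(0, T_max)`. Then `T_max = +∞`: the solution is global in time. -/
theorem fokkerPlanck_global_existence
    (m : ℕ) (V : Spc m → ℝ) (β σ p : ℝ) (ψ0 : Spc m → ℝ)
    (Tmax : ℝ≥0∞) (ψ : ℝ → Spc m → ℝ)
    (hV : ContDiff ℝ 2 V) (hVper : IsPeriodic V) (hβ : 0 < β)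
    (h1 : Hyp1 σ p ψ0) (h2 : Hyp2 m σ p)
    (hψ : IsMaximalLpSolution V β σ p ψ0 Tmax ψ) :
    Tmax = ⊤ := by
  by_contra hne
  have hT : 0 < Tmax.toReal := ENNReal.toReal_pos hψ.2.1.ne' hne
  have e : ENNReal.ofReal Tmax.toReal = Tmax := ENNReal.ofReal_toReal hne
  obtain ⟨T', hT', ψ', h', he⟩ := FP.extend hT hV hVper hβ h1 h2 (by rw [e]; exact hψ.1)
  have h3 := hψ.2.2 (ENNReal.ofReal T') ψ' h' (fun t ht => he t ((ENNReal.ofReal_lt_ofReal_iff hT).1 (by rw [e]; exact ht.2)))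
  have h4 := (ENNReal.ofReal_le_ofReal_iff hT.le).1 (h3.trans_eq e.symm)
  linarith
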